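/- arXiv:1206.4712 — 2 statements merged into one kernel-verified Lean document; each statement's English description precedes it below -/
import Mathlib

section
/- Let a ∈ S^m_{ρ,δ}(n,2) with 0 ≤ δ ≤ ρ ≤ 1, δ < 1, let p, q ∈ [2,∞] and r defined by 1/r = 1/q + 1/p. If m < 2n(ρ−1)·max{|1/p − 1/2|, |1/q − 1/2|} + n(ρ−1)/2, then there is a constant C such that ‖T_a(f,g)‖_{L^r(ℝⁿ)} ≤ C‖f‖_{L^q(ℝⁿ)}‖g‖_{L^p(ℝⁿ)} for all Schwartz functions f, g on ℝⁿ. -/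
open MeasureTheory Metric Complex
open scoped ENNReal NNReal RealInnerProductSpace BigOperators

noncomputable section

abbrev Rn (n : ℕ) : Type := EuclideanSpace ℝ (Fin n)

/-- The bilinear Hörmander class `S^m_{ρ,δ}(n,2)`: `a(x,ξ,η)` is smooth and for all
orders of differentiation `kx` in `x`, `kξ` in `ξ` and `kη` in `η` one has the bound
`C(kx,kξ,kη) (1+|ξ|²+|η|²)^{(m-ρ(kξ+kη)+δ kx)/2}`. -/
def BilinSmRhoDelta (n : ℕ) (m ρ δ : ℝ) (a : Rn n → Rn n → Rn n → ℂ) : Prop :=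
  ContDiff ℝ (⊤ : ℕ∞) (fun p : Rn n × Rn n × Rn n => a p.1 p.2.1 p.2.2) ∧
  ∀ kx kξ kη : ℕ, ∃ C : ℝ, ∀ (x ξ η : Rn n),
    ‖iteratedFDeriv ℝ kx
        (fun x' => iteratedFDeriv ℝ kξ
          (fun ξ' => iteratedFDeriv ℝ kη (fun η' => a x' ξ' η') η) ξ) x‖ ≤
      C * (1 + ‖ξ‖ ^ 2 + ‖η‖ ^ 2) ^ ((m - ρ * (kξ + kη) + δ * kx) / 2)

/-- The Fourier transform `f̂(ξ) = ∫ f(y) e^{-i ξ·y} dy`. -/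
def fourierT {n : ℕ} (f : Rn n → ℂ) (ξ : Rn n) : ℂ :=
  ∫ y : Rn n, f y * Complex.exp (-Complex.I * (⟪ξ, y⟫ : ℂ))

/-- The bilinear pseudodifferential operator
`T_a(f,g)(x) = ∬ a(x,ξ,η) f̂(ξ) ĝ(η) e^{ix·(ξ+η)} dξ dη`. -/
def Tbilin {n : ℕ} (a : Rn n → Rn n → Rn n → ℂ) (f g : Rn n → ℂ) (x : Rn n) : ℂ :=
  ∫ ξ : Rn n, ∫ η : Rn n,
    a x ξ η * fourierT f ξ * fourierT g η * Complex.exp (Complex.I * ((⟪x, ξ + η⟫ : ℝ) : ℂ))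

open Filter Topology
open scoped ContDiff SchwartzMap FourierTransform

section DirectionalDerivatives

variable {E F G : Type*} [NormedAddCommGroup E] [NormedSpace ℝ E]
  [NormedAddCommGroup F] [NormedSpace ℝ F] [NormedAddCommGroup G] [NormedSpace ℝ G]

/-- Iterated directional derivative of `f` along the vectors of a list, the head of the list being
differentiated first. -/
def dirD : List E → (E → F) → E → F
  | [], f => f
  | w :: l, f => dirD l (fun x => fderiv ℝ f x w)

theorem dirD_append (l l' : List E) (f : E → F) : dirD (l ++ l') f = dirD l' (dirD l f) := by
  induction l generalizing f with
  | nil => rfl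
  | cons w l ih => exact ih _

theorem ContDiff.fderiv_dir {f : E → F} (hf : ContDiff ℝ ∞ f) (w : E) :
    ContDiff ℝ ∞ (fun x => fderiv ℝ f x w) :=
  (hf.fderiv_right (m := ∞) (by simp)).clm_apply contDiff_const

theorem ContDiff.dirD {f : E → F} (hf : ContDiff ℝ ∞ f) (l : List E) :
    ContDiff ℝ ∞ (dirD l f) := by
  induction l generalizing f with
  | nil => exact hf
  | cons w l ih => exact ih (hf.fderiv_dir w)

theorem dirD_perm {l l' : List E} (h : l.Perm l') {f : E → F} (hf : ContDiff ℝ ∞ f) :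
    dirD l f = dirD l' f := by
  induction h generalizing f with
  | nil => rfl
  | cons w _ ih => exact ih (hf.fderiv_dir w)
  | swap v w l =>
    simp only [dirD]
    congr 1
    ext x
    have h1 : ∀ u, HasFDerivAt (fun x => fderiv ℝ f x u)
        ((ContinuousLinearMap.apply ℝ F u).comp (fderiv ℝ (fderiv ℝ f) x)) x := fun u =>
      (ContinuousLinearMap.apply ℝ F u).hasFDerivAt.comp x
        (((hf.fderiv_right (m := ∞) (by simp)).differentiable (by simp)) x).hasFDerivAt
    rw [(h1 v).fderiv, (h1 w).fderiv]
    exact (hf.contDiffAt.isSymmSndFDerivAt (by simpa using WithTop.coe_le_coe.2 (le_top : (2 : ℕ∞) ≤ ⊤))).eq _ _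
  | trans _ _ ih₁ ih₂ => exact (ih₁ hf).trans (ih₂ hf)

theorem dirD_comp_clm (L : E →L[ℝ] F) (l : List E) {f : F → G} (hf : ContDiff ℝ ∞ f) :
    dirD l (fun x => f (L x)) = fun x => dirD (l.map L) f (L x) := by
  induction l generalizing f with
  | nil => rfl
  | cons w l ih =>
    rw [List.map_cons, dirD, dirD, ← ih (hf.fderiv_dir _)]
    congr 1
    ext x
    have := ((hf.differentiable (by simp)) (L x)).hasFDerivAt.comp x L.hasFDerivAt
    exact congrArg (fun T => T w) this.fderiv

theorem dirD_const_add (c : E) (l : List E) (f : E → F) :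
    dirD l (fun x => f (c + x)) = fun x => dirD l f (c + x) := by
  induction l generalizing f with
  | nil => rfl
  | cons w l ih =>
    rw [dirD, dirD, ← ih]
    simp only [fderiv_comp_add_left]

theorem dirD_clm_comp (L : F →L[ℝ] G) (l : List E) {f : E → F} (hf : ContDiff ℝ ∞ f) :
    dirD l (fun x => L (f x)) = fun x => L (dirD l f x) := by
  induction l generalizing f with
  | nil => rfl
  | cons w l ih =>
    rw [dirD, dirD, ← ih (hf.fderiv_dir _)]
    congr 1
    ext x
    have := L.hasFDerivAt.comp x ((hf.differentiable (by simp)) x).hasFDerivAt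
    exact congrArg (fun T => T w) this.fderiv

theorem dirD_const_smul {R : Type*} [NormedField R] [NormedSpace ℝ R] [NormedSpace R F]
    [SMulCommClass ℝ R F] [ContinuousConstSMul R F] (c : R) (l : List E) {f : E → F}
    (hf : ContDiff ℝ ∞ f) :
    dirD l (fun x => c • f x) = fun x => c • dirD l f x := by
  induction l generalizing f with
  | nil => rfl
  | cons w l ih =>
    rw [dirD, dirD, ← ih (hf.fderiv_dir _)]
    congr 1
    ext x
    rw [fderiv_fun_const_smul ((hf.differentiable (by simp)) x)]
    rfl

theorem dirD_map_smul {ι : Type*} (c : ι → ℝ) (v : ι → E) (l : List ι) {f : E → F}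
    (hf : ContDiff ℝ ∞ f) (x : E) :
    dirD (l.map fun i => c i • v i) f x = (l.map c).prod • dirD (l.map v) f x := by
  induction l generalizing f with
  | nil => simp [dirD]
  | cons w l ih =>
    simp only [List.map_cons, dirD, map_smul, List.prod_cons]
    rw [ih ((hf.fderiv_dir _).const_smul _), dirD_const_smul _ _ (hf.fderiv_dir _), smul_smul,
      mul_comm]

theorem dirD_add (l : List E) {f g : E → F} (hf : ContDiff ℝ ∞ f) (hg : ContDiff ℝ ∞ g) :
    dirD l (fun x => f x + g x) = fun x => dirD l f x + dirD l g x := by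
  induction l generalizing f g with
  | nil => rfl
  | cons w l ih =>
    rw [dirD, dirD, dirD, ← ih (hf.fderiv_dir _) (hg.fderiv_dir _)]
    congr 1
    ext x
    rw [fderiv_fun_add ((hf.differentiable (by simp)) x) ((hg.differentiable (by simp)) x)]
    rfl

theorem dirD_eq_zero_of_notMem_tsupport (l : List E) {f : E → F} {x : E} (hx : x ∉ tsupport f) :
    dirD l f x = 0 := by
  induction l generalizing f with
  | nil => exact image_eq_zero_of_notMem_tsupport hx
  | cons w l ih =>
    exact ih fun h => hx (tsupport_fderiv_apply_subset ℝ w h)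

/-- The directional derivative along `l` is a fixed linear functional of the total derivative. -/
theorem exists_clm_dirD (l : List E) : ∃ Λ : (E [×l.length]→L[ℝ] F) →L[ℝ] F,
    ∀ f : E → F, ContDiff ℝ ∞ f → ∀ x, dirD l f x = Λ (iteratedFDeriv ℝ l.length f x) := by
  induction l with
  | nil =>
    exact ⟨ContinuousMultilinearMap.apply ℝ (fun _ : Fin 0 => E) F 0, fun f _ x => by simp [dirD]⟩
  | cons w l ih =>
    obtain ⟨Λ, hΛ⟩ := ih
    refine ⟨Λ.comp (((ContinuousLinearMap.compContinuousMultilinearMapL ℝ (fun _ : Fin l.length => E)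
      (E →L[ℝ] F) F) (ContinuousLinearMap.apply ℝ F w)).comp
      ((continuousMultilinearCurryRightEquiv' ℝ l.length E F).toContinuousLinearEquiv :
        (E [×l.length + 1]→L[ℝ] F) →L[ℝ] (E [×l.length]→L[ℝ] (E →L[ℝ] F)))), fun f hf x => ?_⟩
    rw [dirD, hΛ _ (hf.fderiv_dir w)]
    simp only [ContinuousLinearMap.comp_apply, List.length_cons]
    congr 1
    have h1 := (ContinuousLinearMap.apply ℝ F w).iteratedFDeriv_comp_left
      (f := fderiv ℝ f) (x := x) (n := ∞) (i := l.length)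
      (hf.fderiv_right (m := ∞) (by simp)).contDiffAt (by exact_mod_cast le_top)
    have h2 : (fun x => fderiv ℝ f x w) = (ContinuousLinearMap.apply ℝ F w) ∘ fderiv ℝ f := rfl
    rw [h2, h1]
    have h3 := iteratedFDeriv_succ_eq_comp_right (𝕜 := ℝ) (f := f) (n := l.length) (x := x)
    rw [h3]
    simp only [Function.comp_apply, ContinuousLinearMap.compContinuousMultilinearMapL_apply]
    congr 1
    exact (LinearIsometryEquiv.apply_symm_apply _ _).symm

theorem exists_clm_dirD_bound (l : List E) : ∃ (Λ : (E [×l.length]→L[ℝ] F) →L[ℝ] F) (C : ℝ),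
    0 ≤ C ∧ (∀ T, ‖Λ T‖ ≤ C * ‖T‖) ∧
    ∀ f : E → F, ContDiff ℝ ∞ f → ∀ x, dirD l f x = Λ (iteratedFDeriv ℝ l.length f x) := by
  obtain ⟨Λ, h⟩ := exists_clm_dirD (F := F) l
  obtain ⟨C, hC, hb⟩ := Λ.bound
  exact ⟨Λ, C, hC.le, hb, h⟩

theorem contDiff_iteratedFDeriv_param {f : E → F → G} (hf : ContDiff ℝ ∞ (Function.uncurry f))
    (k : ℕ) : ContDiff ℝ ∞ (Function.uncurry fun p y => iteratedFDeriv ℝ k (f p) y) := by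
  induction k with
  | zero =>
    have : (Function.uncurry fun p y => iteratedFDeriv ℝ 0 (f p) y) =
        fun z => (continuousMultilinearCurryFin0 ℝ F G).symm (Function.uncurry f z) := by
      ext z; rfl
    rw [this]
    exact (continuousMultilinearCurryFin0 ℝ F G).symm.contDiff.comp hf
  | succ k ih =>
    have : (Function.uncurry fun p y => iteratedFDeriv ℝ (k + 1) (f p) y) =
        fun z => (continuousMultilinearCurryLeftEquiv ℝ (fun _ : Fin (k + 1) => F) G).symm
          (fderiv ℝ (iteratedFDeriv ℝ k (f z.1)) z.2) := by
      ext z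
      simp only [Function.uncurry, iteratedFDeriv_succ_eq_comp_left]
      rfl
    rw [this]
    have h : ContDiff ℝ ∞ fun z : E × F => fderiv ℝ (iteratedFDeriv ℝ k (f z.1)) z.2 :=
      ContDiff.fderiv (f := fun (z : E × F) y => iteratedFDeriv ℝ k (f z.1) y) (n := ∞)
        (ih.comp ((contDiff_fst.comp contDiff_fst).prodMk contDiff_snd)) contDiff_snd (by simp)
    exact h.continuousLinearMap_comp ((continuousMultilinearCurryLeftEquiv ℝ
      (fun _ : Fin (k + 1) => F) G).symm : _ →L[ℝ] F [×k + 1]→L[ℝ] G)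

/-- Uniform bounds, on sets `S j`, of all iterated derivatives along directions in `W`. -/
def BddDirOn {ι : Type*} (W : Set E) (S : ι → Set E) (f : ι → E → ℂ) : Prop :=
  ∀ l : List E, (∀ w ∈ l, w ∈ W) → ∃ C : ℝ, ∀ j, ∀ x ∈ S j, ‖dirD l (f j) x‖ ≤ C

variable {ι : Type*} {W : Set E} {S : ι → Set E} {f g : ι → E → ℂ}

theorem BddDirOn.fderiv (hf : BddDirOn W S f) {w : E} (hw : w ∈ W) :
    BddDirOn W S (fun j x => fderiv ℝ (f j) x w) := fun l hl => hf (w :: l) (by simpa [hw] using hl)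

theorem BddDirOn.add (hf : BddDirOn W S f) (hg : BddDirOn W S g)
    (hf' : ∀ j, ContDiff ℝ ∞ (f j)) (hg' : ∀ j, ContDiff ℝ ∞ (g j)) :
    BddDirOn W S (fun j x => f j x + g j x) := fun l hl => by
  obtain ⟨C, hC⟩ := hf l hl
  obtain ⟨D, hD⟩ := hg l hl
  refine ⟨C + D, fun j x hx => ?_⟩
  rw [dirD_add l (hf' j) (hg' j)]
  exact (norm_add_le _ _).trans (add_le_add (hC j x hx) (hD j x hx))

theorem BddDirOn.mul (hf : BddDirOn W S f) (hg : BddDirOn W S g)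
    (hf' : ∀ j, ContDiff ℝ ∞ (f j)) (hg' : ∀ j, ContDiff ℝ ∞ (g j)) :
    BddDirOn W S (fun j x => f j x * g j x) := fun l hl => by
  induction l generalizing f g with
  | nil =>
    obtain ⟨C, hC⟩ := hf [] (by simp)
    obtain ⟨D, hD⟩ := hg [] (by simp)
    refine ⟨C * D, fun j x hx => ?_⟩
    have h := hC j x hx
    simp only [dirD] at h ⊢
    rw [norm_mul]
    exact mul_le_mul h (hD j x hx) (norm_nonneg _) ((norm_nonneg _).trans h)
  | cons w l ih =>
    have hw : w ∈ W := hl w (by simp)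
    have hl' : ∀ v ∈ l, v ∈ W := fun v hv => hl v (by simp [hv])
    obtain ⟨C, hC⟩ := ih (hf.fderiv hw) hg (fun j => (hf' j).fderiv_dir w) hg' hl'
    obtain ⟨D, hD⟩ := ih hf (hg.fderiv hw) hf' (fun j => (hg' j).fderiv_dir w) hl'
    refine ⟨D + C, fun j x hx => ?_⟩
    have : (fun x => _root_.fderiv ℝ (fun x => f j x * g j x) x w) = fun x =>
        f j x * _root_.fderiv ℝ (g j) x w + _root_.fderiv ℝ (f j) x w * g j x := by
      ext x
      rw [fderiv_fun_mul ((hf' j).differentiable (by simp) x) ((hg' j).differentiable (by simp) x)]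
      simp [mul_comm]
    rw [dirD, this, dirD_add l ((hf' j).mul ((hg' j).fderiv_dir w))
      (((hf' j).fderiv_dir w).mul (hg' j))]
    exact (norm_add_le _ _).trans (add_le_add (hD j x hx) (hC j x hx))

theorem BddDirOn.conj (hf : BddDirOn W S f) (hf' : ∀ j, ContDiff ℝ ∞ (f j)) :
    BddDirOn W S (fun j x => starRingEnd ℂ (f j x)) := fun l hl => by
  obtain ⟨C, hC⟩ := hf l hl
  refine ⟨C, fun j x hx => ?_⟩
  have := dirD_clm_comp (Complex.conjCLE : ℂ →L[ℝ] ℂ) l (hf' j)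
  simp only [ContinuousLinearEquiv.coe_coe, Complex.conjCLE_apply] at this
  rw [this]
  simpa using hC j x hx

theorem exists_bound_dirD_of_hasCompactSupport {f : E → ℂ} (hf : ContDiff ℝ ∞ f)
    (hs : HasCompactSupport f) (l : List E) : ∃ C : ℝ, ∀ x, ‖dirD l f x‖ ≤ C := by
  refine (hs.mono' ?_).exists_bound_of_continuous (hf.dirD l).continuous
  intro x hx
  by_contra h
  exact hx (dirD_eq_zero_of_notMem_tsupport l h)

end DirectionalDerivatives

section Symbols

variable {n : ℕ}

/-- The inclusion of the `x`-variable into phase space. -/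
def inX (n : ℕ) : Rn n →L[ℝ] Rn n × Rn n × Rn n := ContinuousLinearMap.inl ℝ (Rn n) (Rn n × Rn n)

/-- The inclusion of the first frequency variable into phase space. -/
def inXi (n : ℕ) : Rn n →L[ℝ] Rn n × Rn n × Rn n :=
  (ContinuousLinearMap.inr ℝ (Rn n) (Rn n × Rn n)).comp (ContinuousLinearMap.inl ℝ (Rn n) (Rn n))

/-- The inclusion of the second frequency variable into phase space. -/
def inEta (n : ℕ) : Rn n →L[ℝ] Rn n × Rn n × Rn n :=
  (ContinuousLinearMap.inr ℝ (Rn n) (Rn n × Rn n)).comp (ContinuousLinearMap.inr ℝ (Rn n) (Rn n))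

@[simp] theorem inX_apply (v : Rn n) : inX n v = (v, 0, 0) := rfl

@[simp] theorem inXi_apply (v : Rn n) : inXi n v = (0, v, 0) := rfl

@[simp] theorem inEta_apply (v : Rn n) : inEta n v = (0, 0, v) := rfl

/-- Directions in which only one of the three variables moves. -/
def pureDir (n : ℕ) : Set (Rn n × Rn n × Rn n) :=
  Set.range (inX n) ∪ Set.range (inXi n) ∪ Set.range (inEta n)

theorem dirD_comp_affine {E F G : Type*} [NormedAddCommGroup E] [NormedSpace ℝ E]
    [NormedAddCommGroup F] [NormedSpace ℝ F] [NormedAddCommGroup G] [NormedSpace ℝ G]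
    (c : F) (L : E →L[ℝ] F) (l : List E) {f : F → G} (hf : ContDiff ℝ ∞ f) (y : E) :
    dirD l (fun y => f (c + L y)) y = dirD (l.map L) f (c + L y) := by
  have h : ContDiff ℝ ∞ (fun z => f (c + z)) := hf.comp (contDiff_const.add contDiff_id)
  rw [dirD_comp_clm L l h, dirD_const_add]

theorem perm_of_pureDir (l : List (Rn n × Rn n × Rn n)) (hl : ∀ w ∈ l, w ∈ pureDir n) :
    ∃ lx lξ lη : List (Rn n),
      l.Perm (lη.map (inEta n) ++ lξ.map (inXi n) ++ lx.map (inX n)) := by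
  induction l with
  | nil => exact ⟨[], [], [], by simp⟩
  | cons w l ih =>
    obtain ⟨lx, lξ, lη, h⟩ := ih fun v hv => hl v (by simp [hv])
    rcases hl w (by simp) with (⟨v, rfl⟩ | ⟨v, rfl⟩) | ⟨v, rfl⟩
    · refine ⟨v :: lx, lξ, lη, (h.cons _).trans ?_⟩
      rw [List.map_cons]
      exact List.perm_middle.symm
    · refine ⟨lx, v :: lξ, lη, (h.cons _).trans ?_⟩
      rw [List.map_cons, List.append_assoc, List.append_assoc, List.cons_append]
      exact List.perm_middle.symm
    · exact ⟨lx, lξ, v :: lη, h.cons _⟩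

/-- The symbol as a function on phase space. -/
def symFun (a : Rn n → Rn n → Rn n → ℂ) (p : Rn n × Rn n × Rn n) : ℂ := a p.1 p.2.1 p.2.2

theorem BilinSmRhoDelta.exists_dirD_le {m ρ δ : ℝ} {a : Rn n → Rn n → Rn n → ℂ}
    (ha : BilinSmRhoDelta n m ρ δ a) (lx lξ lη : List (Rn n)) :
    ∃ C : ℝ, 0 ≤ C ∧ ∀ p : Rn n × Rn n × Rn n,
      ‖dirD (lη.map (inEta n) ++ lξ.map (inXi n) ++ lx.map (inX n)) (symFun a) p‖ ≤
        C * (1 + ‖p.2.1‖ ^ 2 + ‖p.2.2‖ ^ 2) ^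
          ((m - ρ * (lξ.length + lη.length) + δ * lx.length) / 2) := by
  have hs : ContDiff ℝ ∞ (symFun a) := ha.1
  obtain ⟨Λη, Cη, hCη, hbη, hη⟩ := exists_clm_dirD_bound (F := ℂ) lη
  obtain ⟨Λξ, Cξ, hCξ, hbξ, hξ⟩ := exists_clm_dirD_bound (F := Rn n [×lη.length]→L[ℝ] ℂ) lξ
  obtain ⟨Λx, Cx, hCx, hbx, hx⟩ :=
    exists_clm_dirD_bound (F := Rn n [×lξ.length]→L[ℝ] (Rn n [×lη.length]→L[ℝ] ℂ)) lx
  obtain ⟨C, hC⟩ := ha.2 lx.length lξ.length lη.length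
  have hA : ContDiff ℝ ∞ (Function.uncurry fun (p : Rn n × Rn n) η =>
      iteratedFDeriv ℝ lη.length (fun η' => a p.1 p.2 η') η) := by
    refine contDiff_iteratedFDeriv_param (f := fun (p : Rn n × Rn n) η' => a p.1 p.2 η') ?_ _
    exact hs.comp ((contDiff_fst.comp contDiff_fst).prodMk
      ((contDiff_snd.comp contDiff_fst).prodMk contDiff_snd))
  have hB : ContDiff ℝ ∞ (Function.uncurry fun (p : Rn n × Rn n) ξ =>
      iteratedFDeriv ℝ lξ.length
        (fun ξ' => iteratedFDeriv ℝ lη.length (fun η' => a p.1 ξ' η') p.2) ξ) := by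
    refine contDiff_iteratedFDeriv_param (f := fun (p : Rn n × Rn n) ξ' =>
      iteratedFDeriv ℝ lη.length (fun η' => a p.1 ξ' η') p.2) ?_ _
    exact hA.comp (((contDiff_fst.comp contDiff_fst).prodMk contDiff_snd).prodMk
      (contDiff_snd.comp contDiff_fst))
  have key : ∀ x ξ η : Rn n,
      dirD (lη.map (inEta n) ++ lξ.map (inXi n) ++ lx.map (inX n)) (symFun a) (x, ξ, η) =
        Λη (Λξ (Λx (iteratedFDeriv ℝ lx.length (fun x' => iteratedFDeriv ℝ lξ.length
          (fun ξ' => iteratedFDeriv ℝ lη.length (fun η' => a x' ξ' η') η) ξ) x))) := by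
    intro x ξ η
    have e1 : ∀ x ξ η : Rn n, dirD (lη.map (inEta n)) (symFun a) (x, ξ, η) =
        Λη (iteratedFDeriv ℝ lη.length (fun η' => a x ξ η') η) := by
      intro x ξ η
      have h := dirD_comp_affine (x, ξ, 0) (inEta n) lη hs η
      simp only [inEta_apply, Prod.mk_add_mk, add_zero, zero_add] at h
      rw [← h, hη]
      · rfl
      · exact hs.comp (contDiff_const.prodMk (contDiff_const.prodMk contDiff_id))
    have e2 : ∀ x ξ η : Rn n,
        dirD (lξ.map (inXi n)) (dirD (lη.map (inEta n)) (symFun a)) (x, ξ, η) =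
        Λη (Λξ (iteratedFDeriv ℝ lξ.length
          (fun ξ' => iteratedFDeriv ℝ lη.length (fun η' => a x ξ' η') η) ξ)) := by
      intro x ξ η
      have h := dirD_comp_affine (x, 0, η) (inXi n) lξ (hs.dirD (lη.map (inEta n))) ξ
      simp only [inXi_apply, Prod.mk_add_mk, add_zero, zero_add, e1] at h
      have hsm : ContDiff ℝ ∞
          (fun ξ' => iteratedFDeriv ℝ lη.length (fun η' => a x ξ' η') η) :=
        hA.comp ((contDiff_const.prodMk contDiff_id).prodMk contDiff_const)
      rw [← h, dirD_clm_comp Λη lξ hsm]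
      exact congrArg Λη (hξ _ hsm ξ)
    have h := dirD_comp_affine (0, ξ, η) (inX n) lx
      ((hs.dirD (lη.map (inEta n))).dirD (lξ.map (inXi n))) x
    simp only [inX_apply, Prod.mk_add_mk, add_zero, zero_add, e2] at h
    have hsm : ContDiff ℝ ∞ (fun x' => iteratedFDeriv ℝ lξ.length
        (fun ξ' => iteratedFDeriv ℝ lη.length (fun η' => a x' ξ' η') η) ξ) :=
      hB.comp ((contDiff_id.prodMk contDiff_const).prodMk contDiff_const)
    rw [dirD_append, dirD_append, ← h]
    have := dirD_clm_comp (Λη.comp Λξ) lx hsm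
    simp only [ContinuousLinearMap.comp_apply] at this
    rw [this]
    exact congrArg (fun z => Λη (Λξ z)) (hx _ hsm x)
  have hC0 : 0 ≤ C := by
    have := (norm_nonneg _).trans (hC 0 0 0)
    simpa using this
  refine ⟨Cη * (Cξ * (Cx * C)), by positivity, fun ⟨x, ξ, η⟩ => ?_⟩
  rw [key, mul_assoc, mul_assoc, mul_assoc]
  refine (hbη _).trans (mul_le_mul_of_nonneg_left ?_ hCη)
  refine (hbξ _).trans (mul_le_mul_of_nonneg_left ?_ hCξ)
  exact (hbx _).trans (mul_le_mul_of_nonneg_left (hC x ξ η) hCx)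

end Symbols

section Decomposition

variable {n : ℕ}

/-- A family of amplitudes with uniformly bounded derivatives, the `j`-th one living on
frequencies of size at most `R j`. -/
structure SymFam (n : ℕ) (b : ℕ → Rn n × Rn n × Rn n → ℂ) (R : ℕ → ℝ) : Prop where
  smooth : ∀ j, ContDiff ℝ ∞ (b j)
  supp : ∀ j p, b j p ≠ 0 → ‖p.2.1‖ ≤ R j ∧ ‖p.2.2‖ ≤ R j
  bdd : BddDirOn (pureDir n) (fun _ => Set.univ) b

/-- A smooth cutoff on frequency space, equal to one near the origin. -/
def cutoff (P : Rn n × Rn n) : ℂ :=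
  ((Real.smoothTransition (2 - (‖P.1‖ ^ 2 + ‖P.2‖ ^ 2)) : ℝ) : ℂ)

theorem contDiff_cutoff : ContDiff ℝ ∞ (cutoff (n := n)) := by
  refine Complex.ofRealCLM.contDiff.comp (Real.smoothTransition.contDiff.comp ?_)
  exact contDiff_const.sub (((contDiff_norm_sq ℝ).comp contDiff_fst).add
    ((contDiff_norm_sq ℝ).comp contDiff_snd))

theorem cutoff_eq_one {P : Rn n × Rn n} (h : ‖P.1‖ ^ 2 + ‖P.2‖ ^ 2 ≤ 1) : cutoff P = 1 := by
  rw [cutoff, Real.smoothTransition.one_of_one_le (by linarith), Complex.ofReal_one]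

theorem cutoff_eq_zero {P : Rn n × Rn n} (h : 2 ≤ ‖P.1‖ ^ 2 + ‖P.2‖ ^ 2) : cutoff P = 0 := by
  rw [cutoff, Real.smoothTransition.zero_of_nonpos (by linarith), Complex.ofReal_zero]

theorem norm_cutoff_le (P : Rn n × Rn n) : ‖cutoff P‖ ≤ 1 := by
  rw [cutoff, Complex.norm_real, Real.norm_of_nonneg (Real.smoothTransition.nonneg _)]
  exact Real.smoothTransition.le_one _

theorem hasCompactSupport_cutoff : HasCompactSupport (cutoff (n := n)) := by
  refine HasCompactSupport.intro (isCompact_closedBall (0 : Rn n × Rn n) 2) fun P hP => ?_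
  refine cutoff_eq_zero ?_
  rw [mem_closedBall_zero_iff, Prod.norm_def, sup_le_iff, not_and_or, not_le, not_le] at hP
  rcases hP with h | h <;> nlinarith [sq_nonneg ‖P.1‖, sq_nonneg ‖P.2‖]

theorem dirD_map_const_smul {E F : Type*} [NormedAddCommGroup E] [NormedSpace ℝ E]
    [NormedAddCommGroup F] [NormedSpace ℝ F] (c : ℝ) (l : List E) {f : E → F}
    (hf : ContDiff ℝ ∞ f) :
    dirD (l.map fun v => c • v) f = fun x => c ^ l.length • dirD l f x := by
  ext x
  have := dirD_map_smul (fun _ : E => c) id l hf x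
  simpa using this

theorem bddDirOn_cutoff (c e : ℕ → ℝ) (hc : ∀ j, |c j| ≤ 2) (he : ∀ j, |e j| ≤ 1)
    (W : Set (Rn n × Rn n × Rn n)) (S : ℕ → Set (Rn n × Rn n × Rn n)) :
    BddDirOn W S (fun j p => e j • cutoff (c j • p.2)) := fun l _ => by
  obtain ⟨C, hC⟩ := exists_bound_dirD_of_hasCompactSupport contDiff_cutoff
    (hasCompactSupport_cutoff (n := n)) (l.map Prod.snd)
  refine ⟨2 ^ l.length * C, fun j p _ => ?_⟩
  have hs : ContDiff ℝ ∞ fun p : Rn n × Rn n × Rn n => cutoff (c j • p.2) :=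
    contDiff_cutoff.comp (contDiff_snd.const_smul (c j))
  rw [dirD_const_smul (e j) l hs]
  have h := dirD_comp_clm (c j • ContinuousLinearMap.snd ℝ (Rn n) (Rn n × Rn n)) l
    (contDiff_cutoff (n := n))
  simp only [_root_.smul_apply, ContinuousLinearMap.coe_snd'] at h
  have h2 : (l.map (c j • ContinuousLinearMap.snd ℝ (Rn n) (Rn n × Rn n))) =
      (l.map Prod.snd).map fun v => c j • v := by
    simp [Function.comp_def]
  rw [h, h2, dirD_map_const_smul _ _ contDiff_cutoff, norm_smul, norm_smul, Real.norm_eq_abs,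
    norm_pow, Real.norm_eq_abs, List.length_map]
  have h3 := hC (c j • p.2)
  calc |e j| * (|c j| ^ l.length * _) ≤ 1 * (2 ^ l.length * C) := by
        gcongr
        · exact he j
        · exact hc j
    _ = _ := one_mul _

/-- The dyadic partition of unity on frequency space. -/
def dyad (j : ℕ) (P : Rn n × Rn n) : ℂ :=
  cutoff (((2 : ℝ) ^ j)⁻¹ • P) - if j = 0 then 0 else cutoff ((2 * ((2 : ℝ) ^ j)⁻¹) • P)

theorem sum_dyad (J : ℕ) (P : Rn n × Rn n) :
    ∑ j ∈ Finset.range (J + 1), dyad j P = cutoff (((2 : ℝ) ^ J)⁻¹ • P) := by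
  induction J with
  | zero => simp [dyad]
  | succ J ih =>
    rw [Finset.sum_range_succ, ih, dyad, if_neg (Nat.succ_ne_zero J)]
    have : (2 * ((2 : ℝ) ^ (J + 1))⁻¹) = ((2 : ℝ) ^ J)⁻¹ := by
      rw [pow_succ]; field_simp
    rw [this]; ring

theorem dyad_ne_zero {j : ℕ} {P : Rn n × Rn n} (h : dyad j P ≠ 0) :
    (2 : ℝ) ^ j * 2 ^ j / 4 ≤ 1 + ‖P.1‖ ^ 2 + ‖P.2‖ ^ 2 ∧
      1 + ‖P.1‖ ^ 2 + ‖P.2‖ ^ 2 ≤ 3 * ((2 : ℝ) ^ j * 2 ^ j) := by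
  have hT : (1 : ℝ) ≤ 2 ^ j := one_le_pow₀ (by norm_num)
  set T : ℝ := 2 ^ j with hTd
  have hT0 : 0 < T := by positivity
  have n1 : ∀ c : ℝ, ‖(c • P).1‖ ^ 2 + ‖(c • P).2‖ ^ 2 = c ^ 2 * (‖P.1‖ ^ 2 + ‖P.2‖ ^ 2) := by
    intro c
    simp only [Prod.smul_fst, Prod.smul_snd, norm_smul, mul_pow, Real.norm_eq_abs, sq_abs]
    ring
  have hi : T⁻¹ ^ 2 * (T * T) = 1 := by field_simp
  constructor
  · by_contra! hlt
    apply h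
    rcases eq_or_ne j 0 with rfl | hj
    · simp only [pow_zero] at hTd
      rw [hTd] at hlt
      nlinarith [sq_nonneg ‖P.1‖, sq_nonneg ‖P.2‖]
    rw [dyad, if_neg hj, cutoff_eq_one, cutoff_eq_one, sub_self]
    · rw [n1]
      have : (2 * T⁻¹) ^ 2 * (‖P.1‖ ^ 2 + ‖P.2‖ ^ 2) ≤ (2 * T⁻¹) ^ 2 * (T * T / 4) := by
        gcongr; linarith
      linarith
    · rw [n1]
      have : (T⁻¹) ^ 2 * (‖P.1‖ ^ 2 + ‖P.2‖ ^ 2) ≤ (T⁻¹) ^ 2 * (T * T / 4) := by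
        gcongr; linarith
      linarith
  · by_contra! hlt
    apply h
    have h2 : 2 * (T * T) ≤ ‖P.1‖ ^ 2 + ‖P.2‖ ^ 2 := by nlinarith
    rw [dyad, cutoff_eq_zero, zero_sub, neg_eq_zero, ite_eq_left_iff]
    · intro _
      apply cutoff_eq_zero
      rw [n1]
      have : (2 * T⁻¹) ^ 2 * (2 * (T * T)) ≤ (2 * T⁻¹) ^ 2 * (‖P.1‖ ^ 2 + ‖P.2‖ ^ 2) := by gcongr
      linarith
    · rw [n1]
      have : (T⁻¹) ^ 2 * (2 * (T * T)) ≤ (T⁻¹) ^ 2 * (‖P.1‖ ^ 2 + ‖P.2‖ ^ 2) := by gcongr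
      linarith

/-- The dilation of phase space, contracting space and expanding frequencies by `h`. -/
def dil (n : ℕ) (h : ℝ) : Rn n × Rn n × Rn n →L[ℝ] Rn n × Rn n × Rn n :=
  (h⁻¹ • ContinuousLinearMap.fst ℝ (Rn n) (Rn n × Rn n)).prod
    (h • ContinuousLinearMap.snd ℝ (Rn n) (Rn n × Rn n))

@[simp] theorem dil_apply (h : ℝ) (p : Rn n × Rn n × Rn n) : dil n h p = (h⁻¹ • p.1, h • p.2) := rfl

theorem norm_dirD_dil (h : ℝ) (hh : 0 < h) (lx lξ lη : List (Rn n)) {f : Rn n × Rn n × Rn n → ℂ}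
    (hf : ContDiff ℝ ∞ f) (p : Rn n × Rn n × Rn n) :
    ‖dirD (lη.map (inEta n) ++ lξ.map (inXi n) ++ lx.map (inX n)) (fun p => f (dil n h p)) p‖ =
      h⁻¹ ^ lx.length * (h ^ lξ.length * (h ^ lη.length *
        ‖dirD (lη.map (inEta n) ++ lξ.map (inXi n) ++ lx.map (inX n)) f (dil n h p)‖)) := by
  have e1 : (lη.map (inEta n)).map (dil n h) = (lη.map (inEta n)).map fun v => h • v := by
    simp [Function.comp_def]
  have e2 : (lξ.map (inXi n)).map (dil n h) = (lξ.map (inXi n)).map fun v => h • v := by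
    simp [Function.comp_def]
  have e3 : (lx.map (inX n)).map (dil n h) = (lx.map (inX n)).map fun v => h⁻¹ • v := by
    simp [Function.comp_def]
  rw [dirD_comp_clm _ _ hf, List.map_append, List.map_append, e1, e2, e3, dirD_append, dirD_append,
    dirD_map_const_smul _ _ hf, dirD_const_smul _ _ (hf.dirD _),
    dirD_map_const_smul _ _ (hf.dirD _), dirD_const_smul _ _ (((hf.dirD _).dirD _).const_smul _),
    dirD_const_smul _ _ ((hf.dirD _).dirD _),
    dirD_map_const_smul _ _ ((hf.dirD _).dirD _), dirD_append, dirD_append]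
  simp only [norm_smul, norm_pow, norm_inv, Real.norm_of_nonneg hh.le, List.length_map]
  ring

theorem rpow_le_of_comparable {N T s : ℝ} (hT : 0 < T) (h1 : T / 4 ≤ N) (h2 : N ≤ 4 * T) :
    N ^ s ≤ 4 ^ |s| * T ^ s := by
  have hN : 0 < N := by linarith
  rcases le_total 0 s with h | h
  · rw [abs_of_nonneg h, ← Real.mul_rpow (by norm_num) hT.le]
    exact Real.rpow_le_rpow hN.le h2 h
  · rw [abs_of_nonpos h, Real.rpow_neg (by norm_num), ← Real.inv_rpow (by norm_num),
      ← Real.mul_rpow (by norm_num) hT.le]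
    exact Real.rpow_le_rpow_of_nonpos (by positivity) (by linarith) h

/-- The dyadic pieces of a symbol, normalised and rescaled. -/
def piece (m ρ : ℝ) (a : Rn n → Rn n → Rn n → ℂ) (j : ℕ) (p : Rn n × Rn n × Rn n) : ℂ :=
  dyad j ((dil n (((2 : ℝ) ^ j) ^ ρ) p).2) *
    ((((2 : ℝ) ^ j) ^ (-m)) • symFun a (dil n (((2 : ℝ) ^ j) ^ ρ) p))

theorem rescaled_bound_le {T m ρ δ C K X s : ℝ} (hδρ : δ ≤ ρ) (hT1 : 1 ≤ T) (hC : 0 ≤ C)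
    (hK : 0 ≤ K) (kx kξ kη : ℕ) (hs : s = (m - ρ * (kξ + kη) + δ * kx) / 2)
    (hX : X ≤ C * (K * (T * T) ^ s)) :
    T ^ (-m) * ((T ^ ρ)⁻¹ ^ kx * ((T ^ ρ) ^ kξ * ((T ^ ρ) ^ kη * X))) ≤ C * K := by
  have h0 : 0 < T := by linarith
  have e1 : (T ^ ρ)⁻¹ ^ kx = T ^ (-(ρ * kx)) := by
    rw [inv_pow, ← Real.rpow_natCast, ← Real.rpow_mul h0.le, Real.rpow_neg h0.le]
  have e2 : ∀ k : ℕ, (T ^ ρ) ^ k = T ^ (ρ * k) := fun k => by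
    rw [← Real.rpow_natCast, ← Real.rpow_mul h0.le]
  have e3 : (T * T) ^ s = T ^ (2 * s) := by
    rw [Real.mul_rpow h0.le h0.le, ← Real.rpow_add h0]; ring_nf
  rw [e1, e2, e2]
  rw [e3] at hX
  calc _ ≤ T ^ (-m) * (T ^ (-(ρ * kx)) * (T ^ (ρ * kξ) * (T ^ (ρ * kη) *
        (C * (K * T ^ (2 * s)))))) := by gcongr
    _ = C * K * (T ^ (-m) * T ^ (-(ρ * kx)) * T ^ (ρ * kξ) *
        T ^ (ρ * kη) * T ^ (2 * s)) := by ring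
    _ = C * K * T ^ ((δ - ρ) * kx) := by
        rw [← Real.rpow_add h0, ← Real.rpow_add h0, ← Real.rpow_add h0, ← Real.rpow_add h0]
        congr 2
        rw [hs]; ring
    _ ≤ C * K * 1 := by
        gcongr
        refine Real.rpow_le_one_of_one_le_of_nonpos hT1 ?_
        exact mul_nonpos_of_nonpos_of_nonneg (by linarith) (by positivity)
    _ = _ := mul_one _

/-- The region of phase space where the `j`-th rescaled piece lives. -/
def shell (n : ℕ) (ρ : ℝ) (j : ℕ) : Set (Rn n × Rn n × Rn n) :=
  {p | (2 : ℝ) ^ j * 2 ^ j / 4 ≤ 1 + ‖((2 : ℝ) ^ j) ^ ρ • p.2.1‖ ^ 2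
        + ‖((2 : ℝ) ^ j) ^ ρ • p.2.2‖ ^ 2 ∧
      1 + ‖((2 : ℝ) ^ j) ^ ρ • p.2.1‖ ^ 2 + ‖((2 : ℝ) ^ j) ^ ρ • p.2.2‖ ^ 2 ≤
        3 * ((2 : ℝ) ^ j * 2 ^ j)}

theorem isClosed_shell (ρ : ℝ) (j : ℕ) : IsClosed (shell n ρ j) := by
  simp only [shell, Set.ofPred_and]
  exact (isClosed_le (by fun_prop) (by fun_prop)).inter (isClosed_le (by fun_prop) (by fun_prop))

theorem contDiff_symFun_dil {m ρ δ : ℝ} {a : Rn n → Rn n → Rn n → ℂ}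
    (ha : BilinSmRhoDelta n m ρ δ a) (h : ℝ) : ContDiff ℝ ∞ (fun p => symFun a (dil n h p)) := by
  have hs : ContDiff ℝ ∞ (symFun a) := ha.1
  exact hs.comp (dil n _).contDiff

theorem bddDirOn_symFun {m ρ δ : ℝ} (hδρ : δ ≤ ρ)
    {a : Rn n → Rn n → Rn n → ℂ} (ha : BilinSmRhoDelta n m ρ δ a) :
    BddDirOn (pureDir n) (shell n ρ) (fun j p =>
      (((2 : ℝ) ^ j) ^ (-m)) • symFun a (dil n (((2 : ℝ) ^ j) ^ ρ) p)) := by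
  have hs : ContDiff ℝ ∞ (symFun a) := ha.1
  intro l hl
  obtain ⟨lx, lξ, lη, hperm⟩ := perm_of_pureDir l hl
  obtain ⟨C, hC0, hC⟩ := ha.exists_dirD_le lx lξ lη
  refine ⟨C * 4 ^ |(m - ρ * (lξ.length + lη.length) + δ * lx.length) / 2|, fun j p hp => ?_⟩
  have hT : (1 : ℝ) ≤ 2 ^ j := one_le_pow₀ (by norm_num)
  have hT0 : (0 : ℝ) < 2 ^ j := by positivity
  rw [dirD_perm hperm ((contDiff_symFun_dil ha _).const_smul _),
    dirD_const_smul _ _ (contDiff_symFun_dil ha _), norm_smul,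
    norm_dirD_dil _ (by positivity) _ _ _ hs, Real.norm_of_nonneg (by positivity)]
  have hTT : (0 : ℝ) < 2 ^ j * 2 ^ j := by positivity
  refine rescaled_bound_le (δ := δ) hδρ hT hC0 (by positivity) _ _ _ rfl ((hC _).trans ?_)
  exact mul_le_mul_of_nonneg_left (rpow_le_of_comparable hTT hp.1 (hp.2.trans (by linarith))) hC0

theorem dyad_dil_eq (ρ : ℝ) (j : ℕ) (p : Rn n × Rn n × Rn n) :
    dyad j ((dil n (((2 : ℝ) ^ j) ^ ρ) p).2) =
      (1 : ℝ) • cutoff ((((2 : ℝ) ^ j)⁻¹ * ((2 : ℝ) ^ j) ^ ρ) • p.2) +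
        (if j = 0 then (0 : ℝ) else -1) •
          cutoff ((2 * (((2 : ℝ) ^ j)⁻¹ * ((2 : ℝ) ^ j) ^ ρ)) • p.2) := by
  simp only [dyad, dil_apply, smul_smul]
  split_ifs <;> simp [sub_eq_add_neg, mul_assoc]

theorem contDiff_cutoff_smul (c e : ℝ) :
    ContDiff ℝ ∞ (fun p : Rn n × Rn n × Rn n => e • cutoff (c • p.2)) :=
  (contDiff_cutoff.comp (contDiff_snd.const_smul _)).const_smul _

theorem contDiff_dyad_dil (ρ : ℝ) (j : ℕ) :
    ContDiff ℝ ∞ (fun p : Rn n × Rn n × Rn n => dyad j ((dil n (((2 : ℝ) ^ j) ^ ρ) p).2)) := by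
  simp only [dyad_dil_eq]
  exact (contDiff_cutoff_smul _ _).add (contDiff_cutoff_smul _ _)

theorem bddDirOn_dyad {ρ : ℝ} (hρ1 : ρ ≤ 1) (S : ℕ → Set (Rn n × Rn n × Rn n)) :
    BddDirOn (pureDir n) S (fun j p => dyad j ((dil n (((2 : ℝ) ^ j) ^ ρ) p).2)) := by
  have hc0 : ∀ j : ℕ, 0 ≤ ((2 : ℝ) ^ j)⁻¹ * ((2 : ℝ) ^ j) ^ ρ := fun j => by positivity
  have hc : ∀ j : ℕ, ((2 : ℝ) ^ j)⁻¹ * ((2 : ℝ) ^ j) ^ ρ ≤ 1 := fun j => by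
    have hT : (1 : ℝ) ≤ 2 ^ j := one_le_pow₀ (by norm_num)
    have : ((2 : ℝ) ^ j) ^ ρ ≤ ((2 : ℝ) ^ j) ^ (1 : ℝ) := Real.rpow_le_rpow_of_exponent_le hT hρ1
    rw [Real.rpow_one] at this
    calc _ ≤ ((2 : ℝ) ^ j)⁻¹ * (2 : ℝ) ^ j := by gcongr
      _ = 1 := inv_mul_cancel₀ (by positivity)
  simp only [dyad_dil_eq]
  refine BddDirOn.add (bddDirOn_cutoff _ _ (fun j => ?_) (fun j => ?_) _ _)
    (bddDirOn_cutoff _ _ (fun j => ?_) (fun j => ?_) _ _) (fun j => contDiff_cutoff_smul _ _)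
    (fun j => contDiff_cutoff_smul _ _)
  · rw [abs_of_nonneg (hc0 j)]; linarith [hc j]
  · simp
  · rw [abs_of_nonneg (by linarith [hc0 j])]; linarith [hc j]
  · split_ifs <;> simp

theorem mem_shell_of_piece_ne_zero {m ρ : ℝ} {a : Rn n → Rn n → Rn n → ℂ} {j : ℕ}
    {p : Rn n × Rn n × Rn n} (hp : piece m ρ a j p ≠ 0) : p ∈ shell n ρ j := by
  rw [piece] at hp
  have h := dyad_ne_zero (left_ne_zero_of_mul hp)
  simp only [dil_apply, Prod.smul_fst, Prod.smul_snd] at h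
  rw [shell, Set.mem_ofPred_eq]
  exact h

theorem norm_le_of_shell {ρ : ℝ} {j : ℕ} {v : Rn n}
    (hv : ‖((2 : ℝ) ^ j) ^ ρ • v‖ ^ 2 ≤ 3 * ((2 : ℝ) ^ j * 2 ^ j)) :
    ‖v‖ ≤ 2 * ((2 : ℝ) ^ j) ^ (1 - ρ) := by
  have hT0 : (0 : ℝ) < 2 ^ j := by positivity
  have hh0 : (0 : ℝ) < (2 ^ j) ^ ρ := by positivity
  have e1 : ((2 : ℝ) ^ j) ^ (1 - ρ) * ((2 : ℝ) ^ j) ^ ρ = 2 ^ j := by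
    rw [← Real.rpow_add hT0]; simp
  rw [norm_smul, Real.norm_of_nonneg hh0.le] at hv
  have h4 : ((2 : ℝ) ^ j) ^ ρ * ‖v‖ ≤ 2 * 2 ^ j := by
    refine abs_le_of_sq_le_sq' ?_ (by positivity) |>.2
    nlinarith [hT0]
  refine le_of_mul_le_mul_left (h4.trans_eq ?_) hh0
  linear_combination (-2) * e1

theorem symFam_piece {m ρ δ : ℝ} (hδρ : δ ≤ ρ) (hρ1 : ρ ≤ 1)
    {a : Rn n → Rn n → Rn n → ℂ} (ha : BilinSmRhoDelta n m ρ δ a) :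
    SymFam n (piece m ρ a) (fun j => 2 * ((2 : ℝ) ^ j) ^ (1 - ρ)) := by
  have hsm : ∀ j : ℕ, ContDiff ℝ ∞ (fun p =>
      (((2 : ℝ) ^ j) ^ (-m)) • symFun a (dil n (((2 : ℝ) ^ j) ^ ρ) p)) := fun j =>
    (contDiff_symFun_dil ha _).const_smul _
  refine ⟨fun j => (contDiff_dyad_dil ρ j).mul (hsm j), fun j p hp => ?_, fun l hl => ?_⟩
  · have h := (mem_shell_of_piece_ne_zero hp).2
    constructor
    · exact norm_le_of_shell (by nlinarith [sq_nonneg ‖((2 : ℝ) ^ j) ^ ρ • p.2.2‖])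
    · exact norm_le_of_shell (by nlinarith [sq_nonneg ‖((2 : ℝ) ^ j) ^ ρ • p.2.1‖])
  · obtain ⟨C, hC⟩ := (bddDirOn_dyad hρ1 (shell n ρ)).mul (bddDirOn_symFun hδρ ha)
      (contDiff_dyad_dil ρ) hsm l hl
    refine ⟨max C 0, fun j p _ => ?_⟩
    by_cases hp : p ∈ shell n ρ j
    · exact (hC j p hp).trans (le_max_left _ _)
    · rw [dirD_eq_zero_of_notMem_tsupport, norm_zero]
      · exact le_max_right _ _
      · exact fun h => hp (closure_minimal (fun q hq => mem_shell_of_piece_ne_zero hq)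
          (isClosed_shell ρ j) h)

end Decomposition

section Fourier

variable {n : ℕ}

theorem eLpNorm_comp_smul {F : Type*} [NormedAddCommGroup F] {h : ℝ} (hh : h ≠ 0) (p : ℝ≥0∞)
    (f : Rn n → F) :
    eLpNorm (fun x => f (h • x)) p volume =
      ENNReal.ofReal |(h ^ n)⁻¹| ^ (1 / p).toReal * eLpNorm f p volume := by
  have h1 : MeasurableEmbedding fun x : Rn n => h • x :=
    (Homeomorph.smulOfNeZero h hh).measurableEmbedding
  have h2 := h1.eLpNorm_map_measure (μ := volume) (g := f) (p := p)
  rw [Measure.map_addHaar_smul volume hh, finrank_euclideanSpace_fin,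
    eLpNorm_smul_measure_of_ne_zero (by simpa using pow_pos (abs_pos.2 hh) n)] at h2
  rw [smul_eq_mul] at h2
  exact h2.symm

theorem fourierT_eq (f : Rn n → ℂ) (ξ : Rn n) : fourierT f ξ = 𝓕 f ((2 * Real.pi)⁻¹ • ξ) := by
  rw [fourierT, Real.fourier_eq']
  congr 1
  ext y
  rw [smul_eq_mul, mul_comm, inner_smul_right, real_inner_comm]
  congr 2
  have : -2 * Real.pi * ((2 * Real.pi)⁻¹ * ⟪y, ξ⟫) = -⟪y, ξ⟫ := by
    field_simp
  rw [this]
  push_cast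
  ring

theorem contDiff_fourierT (f : 𝓢(Rn n, ℂ)) : ContDiff ℝ ∞ (fourierT f) := by
  have : fourierT f = fun ξ => (𝓕 f : 𝓢(Rn n, ℂ)) ((2 * Real.pi)⁻¹ • ξ) := by
    ext ξ; rw [fourierT_eq]; rfl
  rw [this]
  exact ((𝓕 f : 𝓢(Rn n, ℂ)).smooth ⊤).comp (contDiff_id.const_smul _)

theorem integrable_fourierT (f : 𝓢(Rn n, ℂ)) : Integrable (fourierT f) := by
  have : fourierT f = fun ξ => (𝓕 f : 𝓢(Rn n, ℂ)) ((2 * Real.pi)⁻¹ • ξ) := by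
    ext ξ; rw [fourierT_eq]; rfl
  rw [this]
  exact (𝓕 f : 𝓢(Rn n, ℂ)).integrable.comp_smul (by positivity)

theorem exists_eLpNorm_fourierT_le (n : ℕ) : ∃ C : ℝ≥0, ∀ f : 𝓢(Rn n, ℂ),
    eLpNorm (fourierT f) 2 volume ≤ C * eLpNorm f 2 volume := by
  refine ⟨Real.toNNReal |(((2 * Real.pi)⁻¹ : ℝ) ^ n)⁻¹| ^ ((1 / 2 : ℝ≥0∞)).toReal, fun f => ?_⟩
  have h0 : fourierT f = fun ξ => (𝓕 f : 𝓢(Rn n, ℂ)) ((2 * Real.pi)⁻¹ • ξ) := by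
    ext ξ; rw [fourierT_eq]; rfl
  have h1 : eLpNorm (𝓕 f : 𝓢(Rn n, ℂ)) 2 volume = eLpNorm f 2 volume := by
    have := SchwartzMap.norm_fourier_toL2_eq f
    rw [SchwartzMap.norm_toLp, SchwartzMap.norm_toLp] at this
    exact (ENNReal.toReal_eq_toReal_iff' ((𝓕 f : 𝓢(Rn n, ℂ)).memLp 2 volume).eLpNorm_ne_top
      (f.memLp 2 volume).eLpNorm_ne_top).1 this
  rw [h0, eLpNorm_comp_smul (by positivity), h1, ENNReal.coe_rpow_of_nonneg _ (by positivity)]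
  rfl

/-- The `k`-th vector of the standard basis. -/
def bv (k : Fin n) : Rn n := EuclideanSpace.single k 1

@[simp] theorem inner_bv_right (x : Rn n) (k : Fin n) : ⟪x, bv k⟫ = x k := by
  simp [bv, EuclideanSpace.inner_single_right]

/-- Multiplication by the coordinate `y k - u k`. -/
def mulC (k : Fin n) (u : Rn n) (f : 𝓢(Rn n, ℂ)) : 𝓢(Rn n, ℂ) :=
  SchwartzMap.smulLeftCLM ℂ (fun y : Rn n => ⟪y, bv k⟫) f - u k • f

@[simp] theorem mulC_apply (k : Fin n) (u : Rn n) (f : 𝓢(Rn n, ℂ)) (y : Rn n) :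
    mulC k u f y = (y k - u k) • f y := by
  have : (fun y : Rn n => ⟪y, bv k⟫).HasTemperateGrowth :=
    Function.hasTemperateGrowth_inner_left _
  rw [mulC, _root_.sub_apply, SchwartzMap.smulLeftCLM_apply_apply this, _root_.smul_apply,
    inner_bv_right, sub_smul]

theorem fourierT_mulC (k : Fin n) (u : Rn n) (f : 𝓢(Rn n, ℂ)) (ξ : Rn n) :
    fourierT (mulC k u f) ξ = I * fderiv ℝ (fourierT f) ξ (bv k) - u k * fourierT f ξ := by
  have h0 : fourierT f = fun ξ => (𝓕 f : 𝓢(Rn n, ℂ)) ((2 * Real.pi)⁻¹ • ξ) := by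
    ext ξ; rw [fourierT_eq]; rfl
  have h1 : fderiv ℝ (fourierT f) ξ (bv k) =
      (2 * Real.pi)⁻¹ • fderiv ℝ (𝓕 f : 𝓢(Rn n, ℂ)) ((2 * Real.pi)⁻¹ • ξ) (bv k) := by
    rw [h0, fderiv_comp_smul]
    rfl
  have h2 := SchwartzMap.lineDerivOp_fourier_eq f (bv k)
  have h3 := congrArg (fun F : 𝓢(Rn n, ℂ) => F ((2 * Real.pi)⁻¹ • ξ)) h2
  simp only [SchwartzMap.lineDerivOp_apply_eq_fderiv] at h3
  rw [h1, h3, fourierT_eq, fourierT_eq]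
  rw [FourierTransform.fourier_smul, _root_.smul_apply]
  have h4 : 𝓕 (mulC k u f : Rn n → ℂ) ((2 * Real.pi)⁻¹ • ξ) =
      (𝓕 (mulC k u f) : 𝓢(Rn n, ℂ)) ((2 * Real.pi)⁻¹ • ξ) := rfl
  have h5 : 𝓕 (f : Rn n → ℂ) ((2 * Real.pi)⁻¹ • ξ) =
      (𝓕 f : 𝓢(Rn n, ℂ)) ((2 * Real.pi)⁻¹ • ξ) := rfl
  rw [h4, h5, mulC, sub_eq_add_neg, FourierTransform.fourier_add, FourierTransform.fourier_neg,
    FourierTransform.fourier_smul]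
  simp only [_root_.add_apply, _root_.neg_apply, _root_.smul_apply, real_smul,
    smul_eq_mul]
  push_cast
  field_simp
  ring_nf
  simp [I_sq]

end Fourier

section Oscillatory

variable {n : ℕ}

/-- The phase factor `e^{i x·(ξ+η)}`. -/
def osc (x : Rn n) (P : Rn n × Rn n) : ℂ := Complex.exp (I * ((⟪x, P.1 + P.2⟫ : ℝ) : ℂ))

theorem norm_osc (x : Rn n) (P : Rn n × Rn n) : ‖osc x P‖ = 1 := by
  rw [osc, mul_comm, Complex.norm_exp_ofReal_mul_I]

theorem contDiff_osc : ContDiff ℝ ∞ (fun p : Rn n × Rn n × Rn n => osc p.1 p.2) := by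
  refine ContDiff.cexp (contDiff_const.mul (Complex.ofRealCLM.contDiff.comp ?_))
  exact contDiff_fst.inner ℝ
    ((contDiff_fst.comp contDiff_snd).add (contDiff_snd.comp contDiff_snd))

theorem contDiff_osc_right (x : Rn n) : ContDiff ℝ ∞ (osc x) := by
  have h : ContDiff ℝ ∞ fun P : Rn n × Rn n => (x, P) := contDiff_const.prodMk contDiff_id
  have := (contDiff_osc (n := n)).comp h
  exact this

theorem fderiv_osc (x : Rn n) (P w : Rn n × Rn n) :
    fderiv ℝ (osc x) P w = I * ((⟪x, w.1 + w.2⟫ : ℝ) : ℂ) * osc x P := by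
  let L : Rn n × Rn n →L[ℝ] ℝ := (innerSL ℝ x).comp
    (ContinuousLinearMap.fst ℝ (Rn n) (Rn n) + ContinuousLinearMap.snd ℝ (Rn n) (Rn n))
  have h1 : HasFDerivAt (fun P => I * ((L P : ℝ) : ℂ)) (I • Complex.ofRealCLM.comp L) P :=
    (Complex.ofRealCLM.hasFDerivAt.comp P L.hasFDerivAt).const_mul I
  have h2 := h1.cexp
  have h3 : fderiv ℝ (osc x) P = _ := h2.fderiv
  rw [h3]
  simp only [_root_.smul_apply, smul_eq_mul]
  change osc x P * (I * ((⟪x, w.1 + w.2⟫ : ℝ) : ℂ)) = _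
  ring

/-- The oscillatory integral `∬ b(x,P) Φ(P) e^{i x·(ξ+η)} dP`. -/
def oscInt (b : Rn n × Rn n × Rn n → ℂ) (Φ : Rn n × Rn n → ℂ) (x : Rn n) : ℂ :=
  ∫ P, b (x, P) * Φ P * osc x P

theorem SymFam.hasCompactSupport {b : ℕ → Rn n × Rn n × Rn n → ℂ} {R : ℕ → ℝ} (hb : SymFam n b R)
    (j : ℕ) (x : Rn n) : HasCompactSupport fun P => b j (x, P) := by
  refine HasCompactSupport.intro (isCompact_closedBall (0 : Rn n × Rn n) (R j)) fun P hP => ?_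
  by_contra h
  refine hP ?_
  rw [mem_closedBall_zero_iff, Prod.norm_def, sup_le_iff]
  exact hb.supp j (x, P) h

theorem SymFam.integrable {b : ℕ → Rn n × Rn n × Rn n → ℂ} {R : ℕ → ℝ} (hb : SymFam n b R)
    (j : ℕ) (x : Rn n) {Ψ : Rn n × Rn n → ℂ} (hΨ : Continuous Ψ) :
    Integrable fun P => b j (x, P) * Ψ P := by
  refine Continuous.integrable_of_hasCompactSupport ?_ ((hb.hasCompactSupport j x).mul_right)
  exact ((hb.smooth j).continuous.comp (by fun_prop)).mul hΨ

theorem SymFam.fderiv {b : ℕ → Rn n × Rn n × Rn n → ℂ} {R : ℕ → ℝ} (hb : SymFam n b R)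
    {w : Rn n × Rn n × Rn n} (hw : w ∈ pureDir n) :
    SymFam n (fun j p => fderiv ℝ (b j) p w) R := by
  refine ⟨fun j => (hb.smooth j).fderiv_dir w, fun j p hp => ?_, hb.bdd.fderiv hw⟩
  have hc : IsClosed {p : Rn n × Rn n × Rn n | ‖p.2.1‖ ≤ R j ∧ ‖p.2.2‖ ≤ R j} := by
    simp only [Set.ofPred_and]
    exact (isClosed_le (by fun_prop) (by fun_prop)).inter (isClosed_le (by fun_prop) (by fun_prop))
  have h : p ∈ tsupport (b j) := tsupport_fderiv_apply_subset ℝ w (subset_tsupport _ hp)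
  exact closure_minimal (fun q hq => hb.supp j q hq) hc h

instance : (volume : Measure (Rn n × Rn n)).IsAddHaarMeasure :=
  Measure.prod.instIsAddHaarMeasure volume volume

theorem oscInt_fderiv {b : ℕ → Rn n × Rn n × Rn n → ℂ} {R : ℕ → ℝ} (hb : SymFam n b R)
    (j : ℕ) (x : Rn n) {Φ : Rn n × Rn n → ℂ} (hΦ : ContDiff ℝ ∞ Φ) (w : Rn n × Rn n)
    (hw : ((0 : Rn n), w) ∈ pureDir n) :
    oscInt (b j) (fun P => I * fderiv ℝ Φ P w) x =
      (⟪x, w.1 + w.2⟫ : ℝ) * oscInt (b j) Φ x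
        - I * oscInt (fun p => fderiv ℝ (b j) p (0, w)) Φ x := by
  have hd : ∀ P, fderiv ℝ (fun P => b j (x, P) * osc x P) P w =
      fderiv ℝ (b j) (x, P) (0, w) * osc x P
        + b j (x, P) * (I * ((⟪x, w.1 + w.2⟫ : ℝ) : ℂ) * osc x P) := by
    intro P
    have h1 : HasFDerivAt (fun P : Rn n × Rn n => (x, P))
        (ContinuousLinearMap.inr ℝ (Rn n) (Rn n × Rn n)) P := hasFDerivAt_prodMk_right x P
    have h2 := (((hb.smooth j).differentiable (by simp)) (x, P)).hasFDerivAt.comp P h1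
    have h3 := (((contDiff_osc_right x).differentiable (by simp)) P).hasFDerivAt
    have h4 : fderiv ℝ (fun P => b j (x, P) * osc x P) P = _ := (h2.mul h3).fderiv
    rw [h4]
    simp only [_root_.add_apply, _root_.smul_apply, smul_eq_mul, fderiv_osc,
      ContinuousLinearMap.comp_apply, ContinuousLinearMap.inr_apply, Function.comp_apply]
    ring
  have hbc : Continuous fun P => b j (x, P) := (hb.smooth j).continuous.comp (by fun_prop)
  have hoc : Continuous (osc x) := (contDiff_osc_right x).continuous
  have hdΦ : Continuous fun P => fderiv ℝ Φ P w := (hΦ.fderiv_dir w).continuous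
  have hint1 : Integrable fun P => fderiv ℝ (b j) (x, P) (0, w) * (Φ P * osc x P) :=
    (hb.fderiv hw).integrable j x (hΦ.continuous.mul hoc)
  have hint2 : Integrable fun P => b j (x, P) * (Φ P * osc x P) :=
    hb.integrable j x (hΦ.continuous.mul hoc)
  have hint3 : Integrable fun P => b j (x, P) * (fderiv ℝ Φ P w * osc x P) :=
    hb.integrable j x (hdΦ.mul hoc)
  have hrew : ∀ P, (fderiv ℝ (fun P => b j (x, P) * osc x P) P w) * Φ P =
      fderiv ℝ (b j) (x, P) (0, w) * (Φ P * osc x P)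
        + (I * ((⟪x, w.1 + w.2⟫ : ℝ) : ℂ)) * (b j (x, P) * (Φ P * osc x P)) := by
    intro P; rw [hd]; ring
  have hsm : ContDiff ℝ ∞ fun P => b j (x, P) * osc x P :=
    ((hb.smooth j).comp (contDiff_const.prodMk contDiff_id)).mul (contDiff_osc_right x)
  have ibp := integral_mul_fderiv_eq_neg_fderiv_mul_of_integrable (μ := volume)
    (f := fun P => b j (x, P) * osc x P) (g := Φ) (v := w)
    (by simp only [hrew]; exact hint1.add (hint2.const_mul _))
    (hint3.congr (.of_forall fun P => by ring))
    (hint2.congr (.of_forall fun P => by ring))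
    (fun P _ => hsm.differentiable (by simp) P) (fun P _ => hΦ.differentiable (by simp) P)
  simp only [hrew] at ibp
  rw [integral_add hint1 (hint2.const_mul _), integral_const_mul] at ibp
  simp only [oscInt]
  have e1 : ∫ P, b j (x, P) * (I * fderiv ℝ Φ P w) * osc x P =
      I * ∫ P, b j (x, P) * osc x P * fderiv ℝ Φ P w := by
    rw [← integral_const_mul]; congr 1; ext P; ring
  have e2 : ∫ P, b j (x, P) * Φ P * osc x P = ∫ P, b j (x, P) * (Φ P * osc x P) := by
    congr 1; ext P; ring
  have e3 : ∫ P, fderiv ℝ (b j) (x, P) (0, w) * Φ P * osc x P =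
      ∫ P, fderiv ℝ (b j) (x, P) (0, w) * (Φ P * osc x P) := by
    congr 1; ext P; ring
  rw [e1, e2, e3, ibp]
  ring_nf
  simp [I_sq]

theorem SymFam.oscInt_add {b : ℕ → Rn n × Rn n × Rn n → ℂ} {R : ℕ → ℝ} (hb : SymFam n b R)
    (j : ℕ) (x : Rn n) {Φ Ψ : Rn n × Rn n → ℂ} (hΦ : Continuous Φ) (hΨ : Continuous Ψ) (c : ℂ) :
    oscInt (b j) (fun P => Φ P + c * Ψ P) x = oscInt (b j) Φ x + c * oscInt (b j) Ψ x := by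
  have hoc : Continuous (osc x) := (contDiff_osc_right x).continuous
  have h1 := hb.integrable j x (hΦ.mul hoc)
  have h2 := hb.integrable j x (hΨ.mul hoc)
  simp only [oscInt]
  rw [← integral_const_mul, ← integral_add]
  · congr 1; ext P; ring
  · exact h1.congr (.of_forall fun P => by simp only [Pi.mul_apply]; ring)
  · exact (h2.const_mul c).congr (.of_forall fun P => by simp only [Pi.mul_apply]; ring)

/-- The tensor product of the two Fourier transforms. -/
def ftProd (f g : Rn n → ℂ) (P : Rn n × Rn n) : ℂ := fourierT f P.1 * fourierT g P.2

theorem contDiff_ftProd (f g : 𝓢(Rn n, ℂ)) : ContDiff ℝ ∞ (ftProd f g) :=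
  ((contDiff_fourierT f).comp contDiff_fst).mul ((contDiff_fourierT g).comp contDiff_snd)

theorem fderiv_ftProd (f g : 𝓢(Rn n, ℂ)) (P w : Rn n × Rn n) :
    fderiv ℝ (ftProd f g) P w = fderiv ℝ (fourierT f) P.1 w.1 * fourierT g P.2
      + fourierT f P.1 * fderiv ℝ (fourierT g) P.2 w.2 := by
  have h1 := (((contDiff_fourierT f).differentiable (by simp)) P.1).hasFDerivAt.comp P
    (hasFDerivAt_fst (𝕜 := ℝ))
  have h2 := (((contDiff_fourierT g).differentiable (by simp)) P.2).hasFDerivAt.comp P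
    (hasFDerivAt_snd (𝕜 := ℝ))
  have h4 : fderiv ℝ (ftProd f g) P = _ := (h1.mul h2).fderiv
  rw [h4]
  simp only [_root_.add_apply, _root_.smul_apply, smul_eq_mul,
    ContinuousLinearMap.comp_apply, ContinuousLinearMap.coe_fst', ContinuousLinearMap.coe_snd',
    Function.comp_apply]
  ring

theorem oscInt_mulC_left {b : ℕ → Rn n × Rn n × Rn n → ℂ} {R : ℕ → ℝ} (hb : SymFam n b R)
    (j : ℕ) (x u : Rn n) (k : Fin n) (f g : 𝓢(Rn n, ℂ)) :
    oscInt (b j) (ftProd (mulC k u f) g) x = ((x k - u k : ℝ) : ℂ) * oscInt (b j) (ftProd f g) x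
      + (-I) * oscInt (fun p => fderiv ℝ (b j) p (inXi n (bv k))) (ftProd f g) x := by
  have h := oscInt_fderiv hb j x (contDiff_ftProd f g) (bv k, 0) (.inl (.inr ⟨bv k, rfl⟩))
  have e : ftProd (mulC k u f) g = fun P => I * fderiv ℝ (ftProd f g) P (bv k, 0)
      + (-(u k : ℂ)) * ftProd f g P := by
    ext P
    rw [fderiv_ftProd, ftProd, fourierT_mulC, ftProd]
    simp only [map_zero]
    ring
  have hc : Continuous fun P => I * fderiv ℝ (ftProd f g) P (bv k, 0) :=
    continuous_const.mul ((contDiff_ftProd f g).fderiv_dir (bv k, 0)).continuous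
  rw [e, hb.oscInt_add j x hc (contDiff_ftProd f g).continuous, h]
  simp only [add_zero, inner_bv_right, inXi_apply]
  push_cast
  ring

theorem oscInt_mulC_right {b : ℕ → Rn n × Rn n × Rn n → ℂ} {R : ℕ → ℝ} (hb : SymFam n b R)
    (j : ℕ) (x u : Rn n) (k : Fin n) (f g : 𝓢(Rn n, ℂ)) :
    oscInt (b j) (ftProd f (mulC k u g)) x = ((x k - u k : ℝ) : ℂ) * oscInt (b j) (ftProd f g) x
      + (-I) * oscInt (fun p => fderiv ℝ (b j) p (inEta n (bv k))) (ftProd f g) x := by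
  have h := oscInt_fderiv hb j x (contDiff_ftProd f g) (0, bv k) (.inr ⟨bv k, rfl⟩)
  have e : ftProd f (mulC k u g) = fun P => I * fderiv ℝ (ftProd f g) P (0, bv k)
      + (-(u k : ℂ)) * ftProd f g P := by
    ext P
    rw [fderiv_ftProd, ftProd, fourierT_mulC, ftProd]
    simp only [map_zero]
    ring
  have hc : Continuous fun P => I * fderiv ℝ (ftProd f g) P (0, bv k) :=
    continuous_const.mul ((contDiff_ftProd f g).fderiv_dir (0, bv k)).continuous
  rw [e, hb.oscInt_add j x hc (contDiff_ftProd f g).continuous, h]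
  simp only [zero_add, inner_bv_right, inEta_apply]
  push_cast
  ring

theorem SymFam.stronglyMeasurable_oscInt {b : ℕ → Rn n × Rn n × Rn n → ℂ} {R : ℕ → ℝ}
    (hb : SymFam n b R) (j : ℕ) {Φ : Rn n × Rn n → ℂ} (hΦ : Continuous Φ) :
    StronglyMeasurable (oscInt (b j) Φ) := by
  have h : Continuous (Function.uncurry fun (x : Rn n) (P : Rn n × Rn n) =>
      b j (x, P) * Φ P * osc x P) :=
    ((hb.smooth j).continuous.mul (hΦ.comp continuous_snd)).mul contDiff_osc.continuous
  exact h.stronglyMeasurable.integral_prod_right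

end Oscillatory

section Localisation

variable {n : ℕ}

/-- Local `L² × L² → L^s(μ_u)` bounds, uniform in the centre `u`, for all families of amplitudes,
after the modifications `A` and `B` of the arguments. -/
def LocBdd (s : ℝ≥0∞) (μ : Rn n → Measure (Rn n)) (R : ℕ → ℝ) (K : ℕ → ℝ≥0∞)
    (A B : Rn n → 𝓢(Rn n, ℂ) → 𝓢(Rn n, ℂ)) : Prop :=
  ∀ b, SymFam n b R → ∃ C : ℝ≥0, ∀ j (f g : 𝓢(Rn n, ℂ)) u,
    eLpNorm (oscInt (b j) (ftProd (A u f) (B u g))) s (μ u) ≤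
      C * K j * (eLpNorm f 2 volume * eLpNorm g 2 volume)

variable {s : ℝ≥0∞} {μ : Rn n → Measure (Rn n)} {R : ℕ → ℝ} {K : ℕ → ℝ≥0∞}
  {A A' B B' : Rn n → 𝓢(Rn n, ℂ) → 𝓢(Rn n, ℂ)}

theorem eLpNorm_coord_add_le (hs : 1 ≤ s) (hμ : ∀ u, ∀ᵐ x ∂μ u, ‖x - u‖ ≤ 1) (u : Rn n) (k : Fin n)
    {S T : Rn n → ℂ} (hS : StronglyMeasurable S) (hT : StronglyMeasurable T) :
    eLpNorm (fun x => ((x k - u k : ℝ) : ℂ) * S x + (-I) * T x) s (μ u) ≤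
      eLpNorm S s (μ u) + eLpNorm T s (μ u) := by
  have hx : StronglyMeasurable fun x : Rn n => ((x k - u k : ℝ) : ℂ) := by
    refine Continuous.stronglyMeasurable ?_
    fun_prop
  refine (eLpNorm_add_le (hx.mul hS).aestronglyMeasurable
    (hT.const_mul (-I)).aestronglyMeasurable hs).trans (add_le_add ?_ ?_)
  · refine eLpNorm_mono_ae ?_
    filter_upwards [hμ u] with x hx
    simp only [Pi.mul_apply, norm_mul, Complex.norm_real]
    refine mul_le_of_le_one_left (norm_nonneg _) (le_trans ?_ hx)
    exact PiLp.norm_apply_le (x - u) k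
  · refine (eLpNorm_congr_norm_ae (.of_forall fun x => ?_)).le
    simp

theorem LocBdd.mulC_left (h : LocBdd s μ R K A B) (hs : 1 ≤ s)
    (hμ : ∀ u, ∀ᵐ x ∂μ u, ‖x - u‖ ≤ 1) (k : Fin n) :
    LocBdd s μ R K (fun u f => mulC k u (A u f)) B := by
  intro b hb
  have hb' := hb.fderiv (w := inXi n (bv k)) (.inl (.inr ⟨bv k, rfl⟩))
  obtain ⟨C₁, h₁⟩ := h b hb
  obtain ⟨C₂, h₂⟩ := h _ hb'
  refine ⟨C₁ + C₂, fun j f g u => ?_⟩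
  have e : oscInt (b j) (ftProd (mulC k u (A u f)) (B u g)) = _ :=
    funext fun x => oscInt_mulC_left hb j x u k (A u f) (B u g)
  have hc : Continuous (ftProd (A u f) (B u g)) := (contDiff_ftProd _ _).continuous
  rw [e]
  refine (eLpNorm_coord_add_le hs hμ u k (hb.stronglyMeasurable_oscInt j hc)
    (hb'.stronglyMeasurable_oscInt j hc)).trans ((add_le_add (h₁ j f g u) (h₂ j f g u)).trans_eq ?_)
  push_cast
  ring

theorem LocBdd.mulC_right (h : LocBdd s μ R K A B) (hs : 1 ≤ s)
    (hμ : ∀ u, ∀ᵐ x ∂μ u, ‖x - u‖ ≤ 1) (k : Fin n) :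
    LocBdd s μ R K A (fun u f => mulC k u (B u f)) := by
  intro b hb
  have hb' := hb.fderiv (w := inEta n (bv k)) (.inr ⟨bv k, rfl⟩)
  obtain ⟨C₁, h₁⟩ := h b hb
  obtain ⟨C₂, h₂⟩ := h _ hb'
  refine ⟨C₁ + C₂, fun j f g u => ?_⟩
  have e : oscInt (b j) (ftProd (A u f) (mulC k u (B u g))) = _ :=
    funext fun x => oscInt_mulC_right hb j x u k (A u f) (B u g)
  have hc : Continuous (ftProd (A u f) (B u g)) := (contDiff_ftProd _ _).continuous
  rw [e]
  refine (eLpNorm_coord_add_le hs hμ u k (hb.stronglyMeasurable_oscInt j hc)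
    (hb'.stronglyMeasurable_oscInt j hc)).trans ((add_le_add (h₁ j f g u) (h₂ j f g u)).trans_eq ?_)
  push_cast
  ring

theorem fourierT_add (f g : 𝓢(Rn n, ℂ)) (ξ : Rn n) :
    fourierT (f + g : 𝓢(Rn n, ℂ)) ξ = fourierT f ξ + fourierT g ξ := by
  simp only [fourierT_eq]
  have h := congrArg (fun F : 𝓢(Rn n, ℂ) => F ((2 * Real.pi)⁻¹ • ξ))
    (FourierTransform.fourier_add f g)
  exact h

theorem LocBdd.add_left (h : LocBdd s μ R K A B) (h' : LocBdd s μ R K A' B) (hs : 1 ≤ s) :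
    LocBdd s μ R K (fun u f => A u f + A' u f) B := by
  intro b hb
  obtain ⟨C₁, h₁⟩ := h b hb
  obtain ⟨C₂, h₂⟩ := h' b hb
  refine ⟨C₁ + C₂, fun j f g u => ?_⟩
  have hc := (contDiff_ftProd (A u f) (B u g)).continuous
  have hc' := (contDiff_ftProd (A' u f) (B u g)).continuous
  have e : oscInt (b j) (ftProd (A u f + A' u f : 𝓢(Rn n, ℂ)) (B u g)) =
      oscInt (b j) (ftProd (A u f) (B u g)) + oscInt (b j) (ftProd (A' u f) (B u g)) := by
    ext x
    have := hb.oscInt_add j x hc hc' 1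
    rw [one_mul] at this
    rw [Pi.add_apply, ← this]
    congr 1
    ext P
    simp only [ftProd, fourierT_add]
    ring
  rw [e]
  refine (eLpNorm_add_le (hb.stronglyMeasurable_oscInt j hc).aestronglyMeasurable
    (hb.stronglyMeasurable_oscInt j hc').aestronglyMeasurable hs).trans
    ((add_le_add (h₁ j f g u) (h₂ j f g u)).trans_eq ?_)
  push_cast
  ring

theorem LocBdd.add_right (h : LocBdd s μ R K A B) (h' : LocBdd s μ R K A B') (hs : 1 ≤ s) :
    LocBdd s μ R K A (fun u f => B u f + B' u f) := by
  intro b hb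
  obtain ⟨C₁, h₁⟩ := h b hb
  obtain ⟨C₂, h₂⟩ := h' b hb
  refine ⟨C₁ + C₂, fun j f g u => ?_⟩
  have hc := (contDiff_ftProd (A u f) (B u g)).continuous
  have hc' := (contDiff_ftProd (A u f) (B' u g)).continuous
  have e : oscInt (b j) (ftProd (A u f) (B u g + B' u g : 𝓢(Rn n, ℂ))) =
      oscInt (b j) (ftProd (A u f) (B u g)) + oscInt (b j) (ftProd (A u f) (B' u g)) := by
    ext x
    have := hb.oscInt_add j x hc hc' 1
    rw [one_mul] at this
    rw [Pi.add_apply, ← this]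
    congr 1
    ext P
    simp only [ftProd, fourierT_add]
    ring
  rw [e]
  refine (eLpNorm_add_le (hb.stronglyMeasurable_oscInt j hc).aestronglyMeasurable
    (hb.stronglyMeasurable_oscInt j hc').aestronglyMeasurable hs).trans
    ((add_le_add (h₁ j f g u) (h₂ j f g u)).trans_eq ?_)
  push_cast
  ring

/-- Multiplication by `1 + |y - u|²`. -/
def wt (u : Rn n) (f : 𝓢(Rn n, ℂ)) : 𝓢(Rn n, ℂ) := f + ∑ k, mulC k u (mulC k u f)

theorem wt_apply (u : Rn n) (f : 𝓢(Rn n, ℂ)) (y : Rn n) :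
    wt u f y = (1 + ‖y - u‖ ^ 2) • f y := by
  rw [wt, _root_.add_apply, _root_.sum_apply, EuclideanSpace.norm_sq_eq]
  simp only [mulC_apply, smul_smul, add_smul, one_smul, Finset.sum_smul, PiLp.sub_apply,
    Real.norm_eq_abs, sq, abs_mul_abs_self]

theorem LocBdd.wt_left (h : LocBdd s μ R K A B) (hs : 1 ≤ s)
    (hμ : ∀ u, ∀ᵐ x ∂μ u, ‖x - u‖ ≤ 1) : LocBdd s μ R K (fun u f => wt u (A u f)) B := by
  have : ∀ S : Finset (Fin n),
      LocBdd s μ R K (fun u f => A u f + ∑ k ∈ S, mulC k u (mulC k u (A u f))) B := by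
    intro S
    induction S using Finset.induction_on with
    | empty => simpa using h
    | insert k S hk ih =>
      have h2 := ((h.mulC_left hs hμ k).mulC_left hs hμ k).add_left ih hs
      simp only [Finset.sum_insert hk]
      convert! h2 using 3
      abel
  exact this Finset.univ

theorem LocBdd.wt_right (h : LocBdd s μ R K A B) (hs : 1 ≤ s)
    (hμ : ∀ u, ∀ᵐ x ∂μ u, ‖x - u‖ ≤ 1) : LocBdd s μ R K A (fun u f => wt u (B u f)) := by
  have : ∀ S : Finset (Fin n),
      LocBdd s μ R K A (fun u f => B u f + ∑ k ∈ S, mulC k u (mulC k u (B u f))) := by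
    intro S
    induction S using Finset.induction_on with
    | empty => simpa using h
    | insert k S hk ih =>
      have h2 := ((h.mulC_right hs hμ k).mulC_right hs hμ k).add_right ih hs
      simp only [Finset.sum_insert hk]
      convert! h2 using 3
      abel
  exact this Finset.univ

theorem LocBdd.iterate_wt (h : LocBdd s μ R K (fun _ f => f) (fun _ f => f)) (hs : 1 ≤ s)
    (hμ : ∀ u, ∀ᵐ x ∂μ u, ‖x - u‖ ≤ 1) (N : ℕ) :
    LocBdd s μ R K (fun u f => (wt u)^[N] f) (fun u f => (wt u)^[N] f) := by
  induction N with
  | zero => exact h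
  | succ N ih =>
    simp only [Function.iterate_succ_apply']
    exact (ih.wt_left hs hμ).wt_right hs hμ

/-- The `L²` norm of `f` with a weight concentrated near `u`. -/
def locNorm (N : ℕ) (f : Rn n → ℂ) (u : Rn n) : ℝ≥0∞ :=
  eLpNorm (fun y => ((1 + ‖y - u‖ ^ 2) ^ (-(N : ℝ))) • f y) 2 volume

theorem exists_iterate_wt_eq (N : ℕ) (f : 𝓢(Rn n, ℂ)) (u : Rn n) :
    ∃ F : 𝓢(Rn n, ℂ), (wt u)^[N] F = f ∧ eLpNorm F 2 volume = locNorm N f u := by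
  have hg : (fun y : Rn n => (1 + ‖y - u‖ ^ 2) ^ (-(N : ℝ))).HasTemperateGrowth := by
    have h1 : (fun y : Rn n => y - u).HasTemperateGrowth := by fun_prop
    exact (Function.hasTemperateGrowth_one_add_norm_sq_rpow (Rn n) (-(N : ℝ))).comp h1
  have hF : ∀ y, SchwartzMap.smulLeftCLM ℂ (fun y : Rn n => (1 + ‖y - u‖ ^ 2) ^ (-(N : ℝ))) f y =
      ((1 + ‖y - u‖ ^ 2) ^ (-(N : ℝ))) • f y := fun y =>
    SchwartzMap.smulLeftCLM_apply_apply hg f y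
  refine ⟨SchwartzMap.smulLeftCLM ℂ (fun y : Rn n => (1 + ‖y - u‖ ^ 2) ^ (-(N : ℝ))) f, ?_, ?_⟩
  · have h1 : ∀ (M : ℕ) (F : 𝓢(Rn n, ℂ)) y, (wt u)^[M] F y = (1 + ‖y - u‖ ^ 2) ^ M • F y := by
      intro M
      induction M with
      | zero => simp
      | succ M ih =>
        intro F y
        rw [Function.iterate_succ_apply', wt_apply, ih, smul_smul, pow_succ' (1 + ‖y - u‖ ^ 2) M]
    ext y
    rw [h1, hF, smul_smul, Real.rpow_neg (by positivity), Real.rpow_natCast,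
      mul_inv_cancel₀ (by positivity), one_smul]
  · rw [locNorm]
    congr 1
    ext y
    exact hF y

theorem LocBdd.exists_le_locNorm (h : LocBdd s μ R K (fun _ f => f) (fun _ f => f)) (hs : 1 ≤ s)
    (hμ : ∀ u, ∀ᵐ x ∂μ u, ‖x - u‖ ≤ 1) (N : ℕ) {b : ℕ → Rn n × Rn n × Rn n → ℂ}
    (hb : SymFam n b R) : ∃ C : ℝ≥0, ∀ j (f g : 𝓢(Rn n, ℂ)) u,
    eLpNorm (oscInt (b j) (ftProd f g)) s (μ u) ≤ C * K j * (locNorm N f u * locNorm N g u) := by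
  obtain ⟨C, hC⟩ := h.iterate_wt hs hμ N b hb
  refine ⟨C, fun j f g u => ?_⟩
  obtain ⟨F, hF, hF2⟩ := exists_iterate_wt_eq N f u
  obtain ⟨G, hG, hG2⟩ := exists_iterate_wt_eq N g u
  have := hC j F G u
  beta_reduce at this
  rwa [hF, hG, hF2, hG2] at this

end Localisation

section LocalBounds

variable {n : ℕ}

theorem exists_lintegral_fourierT_le (n : ℕ) : ∃ C : ℝ≥0, ∀ (f : 𝓢(Rn n, ℂ)) (R : ℝ), 0 ≤ R →
    ∫⁻ ξ in closedBall 0 R, ‖fourierT f ξ‖ₑ ≤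
      C * ENNReal.ofReal (R ^ n) ^ (1 / 2 : ℝ) * eLpNorm f 2 volume := by
  obtain ⟨C, hC⟩ := exists_eLpNorm_fourierT_le n
  refine ⟨C * ((volume (ball (0 : Rn n) 1)).toNNReal) ^ (1 / 2 : ℝ), fun f R hR => ?_⟩
  have h := eLpNorm_le_eLpNorm_mul_rpow_measure_univ (p := 1) (q := 2)
    (μ := volume.restrict (closedBall (0 : Rn n) R)) (by norm_num)
    (contDiff_fourierT f).continuous.aestronglyMeasurable
  rw [eLpNorm_one_eq_lintegral_enorm, Measure.restrict_apply_univ,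
    Measure.addHaar_closedBall _ _ hR, finrank_euclideanSpace_fin] at h
  have e : (1 / (1 : ℝ≥0∞).toReal - 1 / (2 : ℝ≥0∞).toReal : ℝ) = 1 / 2 := by norm_num
  rw [e, ENNReal.mul_rpow_of_nonneg _ _ (by norm_num)] at h
  refine h.trans ((mul_le_mul' ((eLpNorm_mono_measure _ Measure.restrict_le_self).trans (hC f))
    le_rfl).trans_eq ?_)
  rw [ENNReal.coe_mul, ENNReal.coe_rpow_of_nonneg _ (by norm_num),
    ENNReal.coe_toNNReal measure_ball_lt_top.ne]
  ring

theorem SymFam.exists_enorm_le {b : ℕ → Rn n × Rn n × Rn n → ℂ} {R : ℕ → ℝ} (hb : SymFam n b R) :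
    ∃ C : ℝ≥0, ∀ j p, ‖b j p‖ₑ ≤ C := by
  obtain ⟨C, hC⟩ := hb.bdd [] (by simp)
  refine ⟨C.toNNReal, fun j p => ?_⟩
  rw [← ofReal_norm]
  exact ENNReal.ofReal_le_ofReal (hC j p trivial)

theorem locBdd_dirac {R : ℕ → ℝ} (hR : ∀ j, 0 ≤ R j) :
    LocBdd 1 (fun u : Rn n => Measure.dirac u) R (fun j => ENNReal.ofReal (R j ^ n))
      (fun _ f => f) (fun _ f => f) := by
  intro b hb
  obtain ⟨C, hC⟩ := hb.exists_enorm_le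
  obtain ⟨D, hD⟩ := exists_lintegral_fourierT_le n
  refine ⟨C * (D * D), fun j f g u => ?_⟩
  rw [eLpNorm_one_eq_lintegral_enorm, lintegral_dirac' _
    (hb.stronglyMeasurable_oscInt j (contDiff_ftProd f g).continuous).measurable.enorm]
  set B : Set (Rn n) := closedBall 0 (R j) with hB
  have hBm : MeasurableSet B := measurableSet_closedBall
  have hf : Measurable fun ξ => ‖fourierT f ξ‖ₑ := (contDiff_fourierT f).continuous.measurable.enorm
  have hg : Measurable fun ξ => ‖fourierT g ξ‖ₑ := (contDiff_fourierT g).continuous.measurable.enorm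
  have h1 : ‖oscInt (b j) (ftProd f g) u‖ₑ ≤ ∫⁻ P : Rn n × Rn n,
      (C : ℝ≥0∞) * (B.indicator (fun ξ => ‖fourierT f ξ‖ₑ) P.1 *
        B.indicator (fun ξ => ‖fourierT g ξ‖ₑ) P.2) := by
    refine (enorm_integral_le_lintegral_enorm _).trans (lintegral_mono fun P => ?_)
    rw [enorm_mul, enorm_mul, ← ofReal_norm (osc u P), norm_osc, ENNReal.ofReal_one, mul_one]
    by_cases h0 : b j (u, P) = 0
    · simp [h0]
    · obtain ⟨h1, h2⟩ := hb.supp j _ h0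
      have h1' : P.1 ∈ B := by simpa [hB] using h1
      have h2' : P.2 ∈ B := by simpa [hB] using h2
      rw [Set.indicator_of_mem h1', Set.indicator_of_mem h2', ftProd, enorm_mul]
      exact mul_le_mul' (hC j _) le_rfl
  rw [lintegral_const_mul' _ _ ENNReal.coe_ne_top] at h1
  have h2 : ∫⁻ P : Rn n × Rn n, B.indicator (fun ξ => ‖fourierT f ξ‖ₑ) P.1 *
        B.indicator (fun ξ => ‖fourierT g ξ‖ₑ) P.2 =
      (∫⁻ ξ in B, ‖fourierT f ξ‖ₑ) * ∫⁻ ξ in B, ‖fourierT g ξ‖ₑ := by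
    rw [← lintegral_indicator hBm, ← lintegral_indicator hBm]
    exact lintegral_prod_mul (hf.indicator hBm).aemeasurable (hg.indicator hBm).aemeasurable
  rw [h2] at h1
  refine h1.trans ((mul_le_mul' le_rfl
    (mul_le_mul' (hD f _ (hR j)) (hD g _ (hR j)))).trans_eq ?_)
  set Q := ENNReal.ofReal (R j ^ n)
  have e : Q = Q ^ (1 / 2 : ℝ) * Q ^ (1 / 2 : ℝ) := by
    rw [← ENNReal.rpow_add_of_nonneg _ _ (by norm_num) (by norm_num)]
    norm_num
  beta_reduce
  rw [show ENNReal.ofReal (R j ^ n) = Q ^ (1 / 2 : ℝ) * Q ^ (1 / 2 : ℝ) from e]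
  push_cast
  ring

theorem norm_coord_mul_integral_le {F : Rn n → ℂ} (hF : ContDiff ℝ ∞ F) (hc : HasCompactSupport F)
    (σ : Rn n) (k : Fin n) (N : ℕ) :
    |σ k| ^ N * ‖∫ x, F x * Complex.exp (I * ((⟪x, σ⟫ : ℝ) : ℂ))‖ ≤
      ∫ x, ‖dirD (List.replicate N (bv k)) F x‖ := by
  induction N generalizing F with
  | zero =>
    rw [pow_zero, one_mul]
    refine (norm_integral_le_integral_norm _).trans_eq ?_
    congr 1
    ext x
    rw [norm_mul, mul_comm I, Complex.norm_exp_ofReal_mul_I, mul_one]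
    rfl
  | succ N ih =>
    have hF' := hF.fderiv_dir (bv k)
    have hc' : HasCompactSupport fun x => fderiv ℝ F x (bv k) := hc.fderiv_apply ℝ (bv k)
    have h := ih hF' hc'
    refine le_trans (le_of_eq ?_) h
    have he : ContDiff ℝ ∞ fun x : Rn n => Complex.exp (I * ((⟪x, σ⟫ : ℝ) : ℂ)) :=
      ContDiff.cexp (contDiff_const.mul (Complex.ofRealCLM.contDiff.comp
        (contDiff_id.inner ℝ contDiff_const)))
    have hd : ∀ x : Rn n, fderiv ℝ (fun x : Rn n => Complex.exp (I * ((⟪x, σ⟫ : ℝ) : ℂ))) x (bv k) =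
        I * (σ k : ℂ) * Complex.exp (I * ((⟪x, σ⟫ : ℝ) : ℂ)) := by
      intro x
      let L : Rn n →L[ℝ] ℝ := innerSL ℝ σ
      have h1 : HasFDerivAt (fun x => I * ((L x : ℝ) : ℂ)) (I • Complex.ofRealCLM.comp L) x :=
        (Complex.ofRealCLM.hasFDerivAt.comp x L.hasFDerivAt).const_mul I
      have e : (fun x : Rn n => Complex.exp (I * ((⟪x, σ⟫ : ℝ) : ℂ))) =
          fun x => Complex.exp (I * ((L x : ℝ) : ℂ)) := by
        ext x; rw [real_inner_comm]; rfl
      rw [e, h1.cexp.fderiv]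
      have e2 : (⟪x, σ⟫ : ℝ) = L x := by rw [real_inner_comm]; rfl
      have e3 : L (bv k) = σ k := inner_bv_right σ k
      rw [e2]
      simp only [_root_.smul_apply, smul_eq_mul, ContinuousLinearMap.comp_apply,
        Complex.ofRealCLM_apply, e3]
      ring
    have ibp := integral_mul_fderiv_eq_neg_fderiv_mul_of_integrable (μ := volume)
      (f := F) (g := fun x : Rn n => Complex.exp (I * ((⟪x, σ⟫ : ℝ) : ℂ))) (v := bv k)
      ((hF'.continuous.mul he.continuous).integrable_of_hasCompactSupport hc'.mul_right)
      ((hF.continuous.mul (he.fderiv_dir (bv k)).continuous).integrable_of_hasCompactSupport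
        hc.mul_right)
      ((hF.continuous.mul he.continuous).integrable_of_hasCompactSupport hc.mul_right)
      (fun x _ => hF.differentiable (by simp) x) (fun x _ => he.differentiable (by simp) x)
    simp only [hd] at ibp
    have e : ∫ x, F x * (I * (σ k : ℂ) * Complex.exp (I * ((⟪x, σ⟫ : ℝ) : ℂ))) =
        I * (σ k : ℂ) * ∫ x, F x * Complex.exp (I * ((⟪x, σ⟫ : ℝ) : ℂ)) := by
      rw [← integral_const_mul]; congr 1; ext x; ring
    rw [e] at ibp
    have := congrArg norm ibp
    rw [norm_neg, norm_mul, norm_mul, norm_I, one_mul, Complex.norm_real, Real.norm_eq_abs] at this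
    rw [← this]
    ring

theorem one_add_norm_pow_le (σ : Rn n) :
    (1 + ‖σ‖) ^ (n + 1) ≤ ((n : ℝ) + 1) ^ n * (1 + ∑ k, |σ k| ^ (n + 1)) := by
  have h1 : ‖σ‖ ≤ ∑ k, |σ k| := by
    have : σ = ∑ k, σ k • bv k := by
      have := (EuclideanSpace.basisFun (Fin n) ℝ).sum_repr σ
      simp only [EuclideanSpace.basisFun_repr, EuclideanSpace.basisFun_apply] at this
      exact this.symm
    conv_lhs => rw [this]
    refine (norm_sum_le _ _).trans (Finset.sum_le_sum fun k _ => ?_)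
    simp [norm_smul, bv]
  have h2 := pow_sum_div_card_le_sum_pow (s := (Finset.univ : Finset (Option (Fin n))))
    (f := fun o => o.elim 1 fun k => |σ k|) (by rintro (_ | k) _ <;> simp) n
  rw [div_le_iff₀' (by simp; positivity)] at h2
  simp only [Fintype.sum_option, Option.elim, one_pow, Finset.card_univ, Fintype.card_option,
    Fintype.card_fin, Nat.cast_add, Nat.cast_one] at h2
  refine le_trans ?_ h2
  gcongr

theorem SymFam.exists_kernel_le {b : ℕ → Rn n × Rn n × Rn n → ℂ} {R : ℕ → ℝ} (hb : SymFam n b R)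
    {ψ : Rn n → ℂ} (hψ : ContDiff ℝ ∞ ψ) (hψc : HasCompactSupport ψ) :
    ∃ C : ℝ, ∀ j (u σ : Rn n) (P P' : Rn n × Rn n), (1 + ‖σ‖) ^ (n + 1) *
      ‖∫ x, ψ (x - u) * (b j (x, P) * starRingEnd ℂ (b j (x, P'))) *
        Complex.exp (I * ((⟪x, σ⟫ : ℝ) : ℂ))‖ ≤ C := by
  let ι := ℕ × Rn n × (Rn n × Rn n) × (Rn n × Rn n)
  let F : ι → Rn n → ℂ := fun i x =>
    ψ (x - i.2.1) * (b i.1 (x, i.2.2.1) * starRingEnd ℂ (b i.1 (x, i.2.2.2)))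
  have hbs : ∀ j P, ContDiff ℝ ∞ fun x => b j (x, P) := fun j P =>
    (hb.smooth j).comp (contDiff_id.prodMk contDiff_const)
  have hconj : ∀ j P, ContDiff ℝ ∞ fun x => starRingEnd ℂ (b j (x, P)) := fun j P =>
    (Complex.conjCLE : ℂ →L[ℝ] ℂ).contDiff.comp (hbs j P)
  have hψs : ∀ u, ContDiff ℝ ∞ fun x => ψ (x - u) := fun u =>
    hψ.comp (contDiff_id.sub contDiff_const)
  have hF : ∀ i, ContDiff ℝ ∞ (F i) := fun i => (hψs _).mul ((hbs _ _).mul (hconj _ _))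
  have hψb : BddDirOn Set.univ (fun _ : ι => Set.univ) fun i x => ψ (x - i.2.1) := by
    intro l _
    obtain ⟨C, hC⟩ := exists_bound_dirD_of_hasCompactSupport hψ hψc l
    refine ⟨C, fun i x _ => ?_⟩
    have := congrFun (dirD_const_add (-i.2.1) l ψ) x
    simp only [neg_add_eq_sub] at this
    rw [this]
    exact hC _
  have hbb : ∀ G : ι → Rn n × Rn n, BddDirOn Set.univ (fun _ : ι => Set.univ)
      fun i x => b i.1 (x, G i) := by
    intro G l _
    obtain ⟨C, hC⟩ := hb.bdd (l.map (inX n)) (by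
      intro w hw
      obtain ⟨v, -, rfl⟩ := List.mem_map.1 hw
      exact .inl (.inl ⟨v, rfl⟩))
    refine ⟨C, fun i x _ => ?_⟩
    have := dirD_comp_affine ((0 : Rn n), G i) (inX n) l (hb.smooth i.1) x
    simp only [inX_apply, Prod.mk_add_mk, zero_add, Prod.mk_zero_zero, add_zero] at this
    rw [this]
    exact hC _ _ trivial
  have hFb : BddDirOn Set.univ (fun _ : ι => Set.univ) F :=
    hψb.mul ((hbb fun i => i.2.2.1).mul ((hbb fun i => i.2.2.2).conj fun _ => hbs _ _)
      (fun _ => hbs _ _) fun _ => hconj _ _) (fun _ => hψs _) fun _ => (hbs _ _).mul (hconj _ _)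
  have hts : ∀ i, tsupport (F i) ⊆ (fun x => x - i.2.1) ⁻¹' tsupport ψ := fun i =>
    closure_minimal (fun x hx => subset_tsupport _ fun h0 => hx (by
      simp only [F]
      rw [h0, zero_mul])) ((isClosed_tsupport ψ).preimage (by fun_prop))
  have hFc : ∀ i, HasCompactSupport (F i) := fun i =>
    (hψc.comp_homeomorph (Homeomorph.subRight i.2.1)).mul_right
  have hint : ∀ l : List (Rn n), ∃ D : ℝ, ∀ i, ∫ x, ‖dirD l (F i) x‖ ≤ D := by
    intro l
    obtain ⟨C, hC⟩ := hFb l fun _ _ => trivial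
    refine ⟨∫ x, (tsupport ψ).indicator (fun _ => C) x, fun i => ?_⟩
    have hi : Integrable ((tsupport ψ).indicator fun _ : Rn n => C) :=
      (integrable_indicator_iff (isClosed_tsupport ψ).measurableSet).2
        (integrableOn_const hψc.isCompact.measure_lt_top.ne)
    rw [← integral_sub_right_eq_self ((tsupport ψ).indicator fun _ : Rn n => C) i.2.1]
    refine integral_mono_of_nonneg (.of_forall fun x => norm_nonneg _) (hi.comp_sub_right i.2.1)
      (.of_forall fun x => ?_)
    beta_reduce
    by_cases hx : x - i.2.1 ∈ tsupport ψ
    · rw [Set.indicator_of_mem hx]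
      exact hC i x trivial
    · rw [Set.indicator_of_notMem hx,
        dirD_eq_zero_of_notMem_tsupport l fun h => hx (hts i h), norm_zero]
  obtain ⟨D₀, hD₀⟩ := hint []
  choose D hD using fun k : Fin n => hint (List.replicate (n + 1) (bv k))
  refine ⟨((n : ℝ) + 1) ^ n * (D₀ + ∑ k, D k), fun j u σ P P' => ?_⟩
  set T : ℝ := ‖∫ x, ψ (x - u) * (b j (x, P) * starRingEnd ℂ (b j (x, P'))) *
        Complex.exp (I * ((⟪x, σ⟫ : ℝ) : ℂ))‖ with hT
  have h0 : T ≤ D₀ := by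
    refine (norm_integral_le_integral_norm _).trans ((le_of_eq ?_).trans (hD₀ (j, u, P, P')))
    congr 1
    ext x
    rw [norm_mul, mul_comm I, Complex.norm_exp_ofReal_mul_I, mul_one]
    rfl
  have hk : ∀ k, |σ k| ^ (n + 1) * T ≤ D k := fun k =>
    (norm_coord_mul_integral_le (hF (j, u, P, P')) (hFc _) σ k (n + 1)).trans (hD k _)
  calc (1 + ‖σ‖) ^ (n + 1) * T ≤ ((n : ℝ) + 1) ^ n * (1 + ∑ k, |σ k| ^ (n + 1)) * T :=
        mul_le_mul_of_nonneg_right (one_add_norm_pow_le σ) (norm_nonneg _)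
    _ = ((n : ℝ) + 1) ^ n * (T + ∑ k, |σ k| ^ (n + 1) * T) := by
        rw [mul_assoc, add_mul, one_mul, Finset.sum_mul]
    _ ≤ _ := by
        refine mul_le_mul_of_nonneg_left (add_le_add h0 (Finset.sum_le_sum fun k _ => hk k)) ?_
        positivity

theorem lintegral_mul_kernel_le {B : Set (Rn n)} (hB : MeasurableSet B)
    {F : Rn n × Rn n → ℝ≥0∞} (hF : Measurable F) (hFB : ∀ P, P.1 ∉ B → F P = 0)
    {w : Rn n → ℝ≥0∞} (hw : Measurable w) :
    ∫⁻ Q : (Rn n × Rn n) × (Rn n × Rn n),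
      w (Q.1.1 + Q.1.2 - (Q.2.1 + Q.2.2)) * (F Q.1 * F Q.2) ≤
      2 * (volume B * ∫⁻ σ, w σ) * ∫⁻ P, F P ^ 2 := by
  have hi : Measurable (B.indicator (1 : Rn n → ℝ≥0∞)) := measurable_one.indicator hB
  have hi' : ∀ ξ, B.indicator (1 : Rn n → ℝ≥0∞) ξ ≠ ⊤ := fun ξ => by
    by_cases h : ξ ∈ B <;> simp [h]
  set G₁ : (Rn n × Rn n) × (Rn n × Rn n) → ℝ≥0∞ := fun Q =>
    F Q.1 ^ 2 * (B.indicator (1 : Rn n → ℝ≥0∞) Q.2.1 * w (Q.1.1 + Q.1.2 - (Q.2.1 + Q.2.2))) with hG₁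
  set G₂ : (Rn n × Rn n) × (Rn n × Rn n) → ℝ≥0∞ := fun Q =>
    F Q.2 ^ 2 * (B.indicator (1 : Rn n → ℝ≥0∞) Q.1.1 * w (Q.1.1 + Q.1.2 - (Q.2.1 + Q.2.2))) with hG₂
  have hm₁ : Measurable G₁ := by
    simp only [hG₁]
    exact ((hF.comp measurable_fst).pow_const 2).mul
      ((hi.comp (by fun_prop)).mul (hw.comp (by fun_prop)))
  have hm₂ : Measurable G₂ := by
    simp only [hG₂]
    exact ((hF.comp measurable_snd).pow_const 2).mul
      ((hi.comp (by fun_prop)).mul (hw.comp (by fun_prop)))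
  have hle : ∀ Q : (Rn n × Rn n) × (Rn n × Rn n),
      w (Q.1.1 + Q.1.2 - (Q.2.1 + Q.2.2)) * (F Q.1 * F Q.2) ≤ G₁ Q + G₂ Q := by
    intro Q
    by_cases h1 : Q.1.1 ∈ B
    · by_cases h2 : Q.2.1 ∈ B
      · simp only [hG₁, hG₂, Set.indicator_of_mem h1, Set.indicator_of_mem h2, Pi.one_apply, one_mul]
        rw [← add_mul, mul_comm]
        refine mul_le_mul' ?_ le_rfl
        rcases le_total (F Q.1) (F Q.2) with h | h
        · exact (mul_le_mul' h le_rfl).trans ((sq (F Q.2)).symm.le.trans le_add_self)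
        · exact (mul_le_mul' le_rfl h).trans ((sq (F Q.1)).symm.le.trans le_self_add)
      · simp [hFB Q.2 h2]
    · simp [hFB Q.1 h1]
  have e₁ : ∫⁻ Q, G₁ Q = (volume B * ∫⁻ σ, w σ) * ∫⁻ P, F P ^ 2 := by
    have h0 : ∫⁻ Q, G₁ Q = _ := lintegral_prod _ hm₁.aemeasurable
    rw [h0, mul_comm, ← lintegral_mul_const _ (hF.pow_const 2)]
    congr 1
    ext P
    simp only [hG₁]
    have hm : Measurable fun P' : Rn n × Rn n => B.indicator (1 : Rn n → ℝ≥0∞) P'.1 *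
        w (P.1 + P.2 - (P'.1 + P'.2)) := (hi.comp measurable_fst).mul (hw.comp (by fun_prop))
    rw [lintegral_const_mul _ hm]
    congr 1
    have h1 : ∫⁻ P' : Rn n × Rn n, B.indicator (1 : Rn n → ℝ≥0∞) P'.1 *
        w (P.1 + P.2 - (P'.1 + P'.2)) = _ :=
      lintegral_prod _ hm.aemeasurable
    rw [h1, ← lintegral_indicator_one hB, ← lintegral_mul_const _ hi]
    congr 1
    ext ξ
    simp only
    rw [lintegral_const_mul' _ _ (hi' ξ)]
    congr 1
    rw [← lintegral_sub_left_eq_self w (P.1 + P.2 - ξ)]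
    simp only [sub_sub]
  have e₂ : ∫⁻ Q, G₂ Q = (volume B * ∫⁻ σ, w σ) * ∫⁻ P, F P ^ 2 := by
    have h0 : ∫⁻ Q, G₂ Q = _ := lintegral_prod_symm _ hm₂.aemeasurable
    rw [h0, mul_comm, ← lintegral_mul_const _ (hF.pow_const 2)]
    congr 1
    ext P'
    simp only [hG₂]
    have hm : Measurable fun P : Rn n × Rn n => B.indicator (1 : Rn n → ℝ≥0∞) P.1 *
        w (P.1 + P.2 - (P'.1 + P'.2)) := (hi.comp measurable_fst).mul (hw.comp (by fun_prop))
    rw [lintegral_const_mul _ hm]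
    congr 1
    have h1 : ∫⁻ P : Rn n × Rn n, B.indicator (1 : Rn n → ℝ≥0∞) P.1 *
        w (P.1 + P.2 - (P'.1 + P'.2)) = _ :=
      lintegral_prod _ hm.aemeasurable
    rw [h1, ← lintegral_indicator_one hB, ← lintegral_mul_const _ hi]
    congr 1
    ext ξ
    simp only
    rw [lintegral_const_mul' _ _ (hi' ξ)]
    congr 1
    rw [← lintegral_add_left_eq_self w (ξ - (P'.1 + P'.2))]
    congr 1
    ext η
    congr 1
    abel
  calc _ ≤ ∫⁻ Q, (G₁ Q + G₂ Q) := lintegral_mono hle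
    _ = _ := by rw [lintegral_add_left hm₁, e₁, e₂]; ring

theorem eLpNorm_two_sq {α F : Type*} [MeasurableSpace α] {μ : Measure α} [NormedAddCommGroup F]
    (f : α → F) : eLpNorm f 2 μ ^ 2 = ∫⁻ x, ‖f x‖ₑ ^ 2 ∂μ := by
  have := eLpNorm_nnreal_pow_eq_lintegral (f := f) (μ := μ) (p := 2) (by norm_num)
  simpa using this

theorem continuous_mul_osc {X : Type*} [TopologicalSpace X] {b : Rn n × Rn n × Rn n → ℂ}
    (hb : Continuous b) {H : Rn n × Rn n → ℂ} (hH : Continuous H) (K : X → Rn n)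
    (L : X → Rn n × Rn n) (hK : Continuous K) (hL : Continuous L) :
    Continuous fun z => b (K z, L z) * H (L z) * osc (K z) (L z) := by
  have h1 : Continuous fun z => b (K z, L z) := hb.comp (hK.prodMk hL)
  have h2 : Continuous fun z => H (L z) := hH.comp hL
  have h3 : Continuous fun z => osc (K z) (L z) := by
    have := (contDiff_osc (n := n)).continuous.comp (hK.prodMk hL)
    exact this
  exact (h1.mul h2).mul h3

theorem SymFam.exists_integral_bump_le {b : ℕ → Rn n × Rn n × Rn n → ℂ} {R : ℕ → ℝ}
    (hb : SymFam n b R) (hR : ∀ j, 0 ≤ R j) {ψ : Rn n → ℂ} (hψ : ContDiff ℝ ∞ ψ)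
    (hψc : HasCompactSupport ψ) :
    ∃ C : ℝ≥0, ∀ j u (H : Rn n × Rn n → ℂ), Continuous H →
      Integrable (fun x => ψ (x - u) * (oscInt (b j) H x * starRingEnd ℂ (oscInt (b j) H x))) ∧
      ‖∫ x, ψ (x - u) * (oscInt (b j) H x * starRingEnd ℂ (oscInt (b j) H x))‖ₑ ≤
        C * ENNReal.ofReal (R j ^ n) * ∫⁻ P, ‖H P‖ₑ ^ 2 := by
  obtain ⟨C, hC⟩ := hb.exists_kernel_le hψ hψc
  set w : Rn n → ℝ≥0∞ := fun σ => ENNReal.ofReal ((1 + ‖σ‖) ^ (-((n : ℝ) + 1))) with hw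
  have hwm : Measurable w := by
    refine ENNReal.measurable_ofReal.comp (Continuous.measurable ?_)
    exact Continuous.rpow_const (by fun_prop) fun σ => .inl (by positivity)
  have hwi : ∫⁻ σ, w σ < ⊤ := finite_integral_one_add_norm (by simp)
  refine ⟨C.toNNReal * (2 * ((volume (ball (0 : Rn n) 1)).toNNReal * (∫⁻ σ, w σ).toNNReal)),
    fun j u H hH => ?_⟩
  set B : Set (Rn n) := closedBall 0 (R j) with hB
  have hBm : MeasurableSet B := measurableSet_closedBall
  set W : Rn n × (Rn n × Rn n) × (Rn n × Rn n) → ℂ := fun z =>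
    ψ (z.1 - u) * ((b j (z.1, z.2.1) * H z.2.1 * osc z.1 z.2.1) *
      starRingEnd ℂ (b j (z.1, z.2.2) * H z.2.2 * osc z.1 z.2.2)) with hW
  have hWc : Continuous W := by
    have h1 := continuous_mul_osc (hb.smooth j).continuous hH (X := Rn n × (Rn n × Rn n) × Rn n × Rn n)
    have h2 : Continuous fun z : Rn n × (Rn n × Rn n) × Rn n × Rn n => ψ (z.1 - u) :=
      hψ.continuous.comp (by fun_prop)
    have h3 := h1 (fun z => z.1) (fun z => z.2.1) continuous_fst (by fun_prop)
    have h4 := h1 (fun z => z.1) (fun z => z.2.2) continuous_fst (by fun_prop)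
    have h5 := h2.mul (h3.mul (Complex.continuous_conj.comp h4))
    exact h5
  have hbz : ∀ x P, P ∉ closedBall (0 : Rn n × Rn n) (R j) → b j (x, P) = 0 := by
    intro x P hP
    by_contra h
    refine hP ?_
    rw [mem_closedBall_zero_iff, Prod.norm_def, sup_le_iff]
    exact hb.supp j (x, P) h
  have hWs : HasCompactSupport W := by
    refine HasCompactSupport.intro (((hψc.comp_homeomorph (Homeomorph.subRight u)).isCompact).prod
      ((isCompact_closedBall (0 : Rn n × Rn n) (R j)).prod
        (isCompact_closedBall (0 : Rn n × Rn n) (R j)))) fun z hz => ?_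
    simp only [Set.mem_prod, not_and_or] at hz
    rcases hz with h | h | h
    · have : ψ (z.1 - u) = 0 :=
        image_eq_zero_of_notMem_tsupport (f := ψ ∘ Homeomorph.subRight u) h
      simp [hW, this]
    · simp [hW, hbz _ _ h]
    · simp [hW, hbz _ _ h]
  have hWi : Integrable W (volume.prod volume) := by
    exact hWc.integrable_of_hasCompactSupport hWs
  have hin : ∀ x, ∫ Q, W (x, Q) =
      ψ (x - u) * (oscInt (b j) H x * starRingEnd ℂ (oscInt (b j) H x)) := by
    intro x
    simp only [hW]
    rw [integral_const_mul]
    congr 1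
    simp only [oscInt]
    rw [← integral_conj]
    exact integral_prod_mul (fun P => b j (x, P) * H P * osc x P)
      fun P => starRingEnd ℂ (b j (x, P) * H P * osc x P)
  have hfirst := hWi.integral_prod_left
  simp only [hin] at hfirst
  refine ⟨hfirst, ?_⟩
  simp only [← hin]
  rw [integral_integral_swap hWi]
  refine (enorm_integral_le_lintegral_enorm _).trans ?_
  set F : Rn n × Rn n → ℝ≥0∞ := fun P => B.indicator (1 : Rn n → ℝ≥0∞) P.1 * ‖H P‖ₑ with hF
  have hFm : Measurable F :=
    ((measurable_one.indicator hBm).comp measurable_fst).mul hH.measurable.enorm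
  have hbd : ∀ Q : (Rn n × Rn n) × (Rn n × Rn n), ‖∫ x, W (x, Q)‖ₑ ≤
      C.toNNReal * (w (Q.1.1 + Q.1.2 - (Q.2.1 + Q.2.2)) * (F Q.1 * F Q.2)) := by
    intro Q
    by_cases h1 : Q.1.1 ∈ B
    swap
    · have : ∀ x, W (x, Q) = 0 := fun x => by
        have : b j (x, Q.1) = 0 := by
          by_contra h
          exact h1 (by simpa [hB] using (hb.supp j _ h).1)
        simp [hW, this]
      simp [this]
    by_cases h2 : Q.2.1 ∈ B
    swap
    · have : ∀ x, W (x, Q) = 0 := fun x => by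
        have : b j (x, Q.2) = 0 := by
          by_contra h
          exact h2 (by simpa [hB] using (hb.supp j _ h).1)
        simp [hW, this]
      simp [this]
    set σ := Q.1.1 + Q.1.2 - (Q.2.1 + Q.2.2) with hσ
    have e : ∀ x, W (x, Q) = (ψ (x - u) * (b j (x, Q.1) * starRingEnd ℂ (b j (x, Q.2))) *
        Complex.exp (I * ((⟪x, σ⟫ : ℝ) : ℂ))) * (H Q.1 * starRingEnd ℂ (H Q.2)) := by
      intro x
      have : Complex.exp (I * ((⟪x, σ⟫ : ℝ) : ℂ)) = osc x Q.1 * starRingEnd ℂ (osc x Q.2) := by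
        rw [osc, osc, ← Complex.exp_conj, ← Complex.exp_add, hσ, inner_sub_right]
        congr 1
        simp only [map_mul, conj_I, Complex.conj_ofReal]
        push_cast
        ring
      rw [this]
      simp only [hW, map_mul]
      ring
    simp only [e]
    rw [integral_mul_const, enorm_mul]
    have hk := hC j u σ Q.1 Q.2
    have hpos : 0 < (1 + ‖σ‖) ^ (n + 1) := by positivity
    rw [mul_comm, ← le_div_iff₀ hpos] at hk
    have hk' : ‖∫ x, ψ (x - u) * (b j (x, Q.1) * starRingEnd ℂ (b j (x, Q.2))) *
        Complex.exp (I * ((⟪x, σ⟫ : ℝ) : ℂ))‖ₑ ≤ C.toNNReal * w σ := by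
      rw [← ofReal_norm]
      refine (ENNReal.ofReal_le_ofReal hk).trans_eq ?_
      rw [div_eq_mul_inv, ENNReal.ofReal_mul' (by positivity), hw]
      beta_reduce
      rw [Real.rpow_neg (by positivity), ← Nat.cast_add_one, Real.rpow_natCast]
      rfl
    rw [← mul_assoc]
    refine mul_le_mul' hk' (le_of_eq ?_)
    simp only [hF, Set.indicator_of_mem h1, Set.indicator_of_mem h2, Pi.one_apply, one_mul]
    rw [enorm_mul, RCLike.enorm_conj]
  refine (lintegral_mono hbd).trans ?_
  rw [lintegral_const_mul' _ _ ENNReal.coe_ne_top]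
  have hS := lintegral_mul_kernel_le hBm hFm (fun P hP => by simp [hF, hP]) hwm
  have hFH : ∫⁻ P, F P ^ 2 ≤ ∫⁻ P, ‖H P‖ₑ ^ 2 := by
    refine lintegral_mono fun P => pow_le_pow_left' ?_ 2
    simp only [hF]
    refine mul_le_of_le_one_left' ?_
    by_cases h : P.1 ∈ B <;> simp [h]
  refine (mul_le_mul' le_rfl (hS.trans (mul_le_mul' le_rfl hFH))).trans_eq ?_
  rw [hB, Measure.addHaar_closedBall _ _ (hR j), finrank_euclideanSpace_fin]
  push_cast
  rw [ENNReal.coe_toNNReal measure_ball_lt_top.ne, ENNReal.coe_toNNReal hwi.ne]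
  ring

theorem locBdd_ball {R : ℕ → ℝ} (hR : ∀ j, 0 ≤ R j) :
    LocBdd 2 (fun u : Rn n => volume.restrict (closedBall u 1)) R
      (fun j => ENNReal.ofReal (R j ^ n) ^ (1 / 2 : ℝ)) (fun _ f => f) (fun _ f => f) := by
  intro b hb
  let φ : ContDiffBump (0 : Rn n) := ⟨1, 2, by norm_num, by norm_num⟩
  have hψ : ContDiff ℝ ∞ fun x : Rn n => ((φ x : ℝ) : ℂ) :=
    Complex.ofRealCLM.contDiff.comp φ.contDiff
  have hψc : HasCompactSupport fun x : Rn n => ((φ x : ℝ) : ℂ) :=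
    φ.hasCompactSupport.comp_left (g := Complex.ofReal) Complex.ofReal_zero
  obtain ⟨C, hC⟩ := hb.exists_integral_bump_le hR hψ hψc
  obtain ⟨D, hD⟩ := exists_eLpNorm_fourierT_le n
  refine ⟨C ^ (1 / 2 : ℝ) * (D * D), fun j f g u => ?_⟩
  have hc := (contDiff_ftProd f g).continuous
  set T := oscInt (b j) (ftProd f g) with hT
  obtain ⟨hi, hle⟩ := hC j u _ hc
  have e1 : ∀ x, ((φ (x - u) : ℝ) : ℂ) * (T x * starRingEnd ℂ (T x)) =
      ((φ (x - u) * ‖T x‖ ^ 2 : ℝ) : ℂ) := fun x => by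
    rw [Complex.mul_conj']; push_cast; rfl
  simp only [← hT, e1] at hi hle
  have hi' : Integrable fun x => φ (x - u) * ‖T x‖ ^ 2 := 
    hi.re.congr (.of_forall fun x => Complex.ofReal_re _)
  have hnn : ∀ x, 0 ≤ φ (x - u) * ‖T x‖ ^ 2 := fun x => mul_nonneg φ.nonneg (sq_nonneg _)
  rw [integral_complex_ofReal, ← ofReal_norm, Complex.norm_real, Real.norm_of_nonneg
    (integral_nonneg hnn), ofReal_integral_eq_lintegral_ofReal hi' (.of_forall hnn)] at hle
  have h1 : eLpNorm T 2 (volume.restrict (closedBall u 1)) ^ 2 ≤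
      ∫⁻ x, ENNReal.ofReal (φ (x - u) * ‖T x‖ ^ 2) := by
    rw [eLpNorm_two_sq]
    refine le_trans (setLIntegral_mono_ae' measurableSet_closedBall (.of_forall fun x hx => ?_))
      (setLIntegral_le_lintegral (closedBall u 1) _)
    have : φ (x - u) = 1 := φ.one_of_mem_closedBall (by
      simpa [mem_closedBall, dist_eq_norm, φ] using hx)
    rw [this, one_mul, ENNReal.ofReal_pow (norm_nonneg _), ofReal_norm]
  have h2 : ∫⁻ P, ‖ftProd f g P‖ₑ ^ 2 =
      eLpNorm (fourierT f) 2 volume ^ 2 * eLpNorm (fourierT g) 2 volume ^ 2 := by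
    rw [eLpNorm_two_sq, eLpNorm_two_sq]
    simp only [ftProd, enorm_mul, mul_pow]
    exact lintegral_prod_mul
      ((contDiff_fourierT f).continuous.measurable.enorm.pow_const 2).aemeasurable
      ((contDiff_fourierT g).continuous.measurable.enorm.pow_const 2).aemeasurable
  rw [h2] at hle
  have hsq : ∀ a : ℝ≥0∞, (a ^ (1 / 2 : ℝ)) ^ 2 = a := fun a => by
    rw [← ENNReal.rpow_natCast, ← ENNReal.rpow_mul]; norm_num
  have h3 := h1.trans (hle.trans (mul_le_mul' le_rfl
    (mul_le_mul' (pow_le_pow_left' (hD f) 2) (pow_le_pow_left' (hD g) 2))))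
  rw [← ENNReal.pow_le_pow_left_iff (n := 2) two_ne_zero]
  refine h3.trans_eq ?_
  beta_reduce
  rw [ENNReal.coe_mul, ENNReal.coe_rpow_of_nonneg _ (by norm_num)]
  simp only [mul_pow, hsq]
  push_cast
  ring

end LocalBounds

section Globalisation

variable {n : ℕ}

/-- The weight `(1 + |y|²)^{-N}`. -/
def wgt (N : ℕ) (y : Rn n) : ℝ := (1 + ‖y‖ ^ 2) ^ (-(N : ℝ))

theorem continuous_wgt (N : ℕ) : Continuous (wgt N : Rn n → ℝ) :=
  Continuous.rpow_const (by fun_prop) fun y => .inl (by positivity)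

theorem lintegral_wgt_sq_lt_top : ∫⁻ y : Rn n, ‖wgt (n + 1) y‖ₑ ^ 2 < ⊤ := by
  have h := (integrable_rpow_neg_one_add_norm_sq (E := Rn n) (μ := volume)
    (r := 4 * ((n + 1 : ℕ) : ℝ)) (by simp; linarith [(Nat.cast_nonneg n : (0 : ℝ) ≤ n)])).2
  rw [hasFiniteIntegral_iff_enorm] at h
  refine lt_of_eq_of_lt ?_ h
  congr 1
  ext y
  rw [← enorm_pow, wgt, ← Real.rpow_natCast, ← Real.rpow_mul (by positivity)]
  congr 2
  push_cast
  ring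

theorem locNorm_eq (N : ℕ) (f : Rn n → ℂ) (u : Rn n) :
    locNorm N f u = eLpNorm f 2 (volume.withDensity fun y => ‖wgt N (y - u)‖ₑ ^ 2) := by
  have hm : Measurable fun y : Rn n => ‖wgt N (y - u)‖ₑ ^ 2 :=
    ((continuous_wgt N).comp (continuous_sub_right u)).measurable.enorm.pow_const 2
  have h : locNorm N f u ^ 2 =
      eLpNorm f 2 (volume.withDensity fun y => ‖wgt N (y - u)‖ₑ ^ 2) ^ 2 := by
    rw [locNorm, eLpNorm_two_sq, eLpNorm_two_sq,
      lintegral_withDensity_eq_lintegral_mul_non_measurable _ hm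
        (.of_forall fun y => ENNReal.pow_lt_top enorm_lt_top)]
    congr 1
    ext y
    rw [enorm_smul, mul_pow]
    rfl
  exact le_antisymm ((ENNReal.pow_le_pow_left_iff two_ne_zero).1 h.le)
    ((ENNReal.pow_le_pow_left_iff two_ne_zero).1 h.ge)

theorem lintegral_withDensity_wgt (N : ℕ) {F : Rn n → ℝ≥0∞} (u : Rn n) :
    ∫⁻ y, F y ∂(volume.withDensity fun y => ‖wgt N (y - u)‖ₑ ^ 2) =
      ∫⁻ y, ‖wgt N (y - u)‖ₑ ^ 2 * F y := by
  have hm : Measurable fun y : Rn n => ‖wgt N (y - u)‖ₑ ^ 2 :=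
    ((continuous_wgt N).comp (continuous_sub_right u)).measurable.enorm.pow_const 2
  rw [lintegral_withDensity_eq_lintegral_mul_non_measurable _ hm
    (.of_forall fun y => ENNReal.pow_lt_top enorm_lt_top)]
  rfl

theorem measurable_wgt_mul (N : ℕ) {F : Rn n → ℝ≥0∞} (hF : Measurable F) :
    Measurable (Function.uncurry fun u y : Rn n => ‖wgt N (y - u)‖ₑ ^ 2 * F y) := by
  have h : Continuous fun z : Rn n × Rn n => wgt N (z.2 - z.1) :=
    (continuous_wgt N).comp (by fun_prop)
  exact (h.measurable.enorm.pow_const 2).mul (hF.comp measurable_snd)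

theorem measurable_lintegral_wgt_mul (N : ℕ) {F : Rn n → ℝ≥0∞} (hF : Measurable F) :
    Measurable fun u : Rn n => ∫⁻ y, ‖wgt N (y - u)‖ₑ ^ 2 * F y :=
  (measurable_wgt_mul N hF).lintegral_prod_right

theorem lintegral_lintegral_wgt (N : ℕ) {F : Rn n → ℝ≥0∞} (hF : Measurable F) :
    ∫⁻ u, ∫⁻ y, ‖wgt N (y - u)‖ₑ ^ 2 * F y = (∫⁻ y : Rn n, ‖wgt N y‖ₑ ^ 2) * ∫⁻ y, F y := by
  rw [lintegral_lintegral_swap (measurable_wgt_mul N hF).aemeasurable, ← lintegral_const_mul _ hF]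
  congr 1
  ext y
  have hm : Measurable fun u : Rn n => ‖wgt N (y - u)‖ₑ ^ 2 :=
    ((continuous_wgt N).comp (continuous_sub_left y)).measurable.enorm.pow_const 2
  rw [lintegral_mul_const _ hm, lintegral_sub_left_eq_self (fun z => ‖wgt N z‖ₑ ^ 2) y]

theorem measurable_locNorm (N : ℕ) {f : Rn n → ℂ} (hf : Continuous f) :
    Measurable (locNorm N f) := by
  have h : locNorm N f = fun u => (∫⁻ y, ‖wgt N (y - u)‖ₑ ^ 2 * ‖f y‖ₑ ^ 2) ^ (1 / 2 : ℝ) := by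
    ext u
    rw [← lintegral_withDensity_wgt, ← eLpNorm_two_sq, ← locNorm_eq, ← ENNReal.rpow_natCast,
      ← ENNReal.rpow_mul]
    norm_num
  have hm : Measurable fun u : Rn n => ∫⁻ y, ‖wgt N (y - u)‖ₑ ^ 2 * ‖f y‖ₑ ^ 2 :=
    measurable_lintegral_wgt_mul N (F := fun y => ‖f y‖ₑ ^ 2) (hf.measurable.enorm.pow_const 2)
  rw [h]
  exact hm.pow_const (1 / 2 : ℝ)

/-- The real-valued version of `locNorm`. -/
def locReal (N : ℕ) (f : Rn n → ℂ) (u : Rn n) : ℝ := (locNorm N f u).toReal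

theorem enorm_locReal (N : ℕ) (f : 𝓢(Rn n, ℂ)) (u : Rn n) : ‖locReal N f u‖ₑ = locNorm N f u := by
  obtain ⟨F, -, hF⟩ := exists_iterate_wt_eq N f u
  rw [locReal, Real.enorm_of_nonneg ENNReal.toReal_nonneg, ENNReal.ofReal_toReal]
  rw [← hF]
  exact (F.memLp 2 volume).eLpNorm_ne_top

theorem stronglyMeasurable_locReal (N : ℕ) (f : 𝓢(Rn n, ℂ)) : StronglyMeasurable (locReal N f) :=
  (measurable_locNorm N f.continuous).ennreal_toReal.stronglyMeasurable

theorem exists_eLpNorm_locReal_le (n : ℕ) : ∃ C : ℝ≥0, ∀ (q : ℝ≥0∞), 2 ≤ q →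
    ∀ f : 𝓢(Rn n, ℂ), eLpNorm (locReal (n + 1) f) q volume ≤ C * eLpNorm f q volume := by
  set c := ∫⁻ y : Rn n, ‖wgt (n + 1) y‖ₑ ^ 2 with hc
  have hct : c < ⊤ := lintegral_wgt_sq_lt_top
  refine ⟨c.toNNReal ^ (1 / 2 : ℝ), fun q hq f => ?_⟩
  rw [ENNReal.coe_rpow_of_nonneg _ (by norm_num), ENNReal.coe_toNNReal hct.ne]
  set ν : Rn n → Measure (Rn n) := fun u =>
    volume.withDensity fun y => ‖wgt (n + 1) (y - u)‖ₑ ^ 2 with hν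
  have hν1 : ∀ u, ν u Set.univ = c := fun u => by
    rw [← lintegral_one, hν, lintegral_withDensity_wgt]
    simp only [mul_one]
    exact lintegral_sub_right_eq_self (fun y => ‖wgt (n + 1) y‖ₑ ^ 2) u
  have h1 : ∀ u, ‖locReal (n + 1) f u‖ₑ ≤ eLpNorm f q (ν u) * c ^ (1 / 2 - 1 / q.toReal) := by
    intro u
    rw [enorm_locReal, locNorm_eq, ← hν1 u]
    have := eLpNorm_le_eLpNorm_mul_rpow_measure_univ (μ := ν u) hq
      f.continuous.aestronglyMeasurable
    simpa using this
  by_cases hqt : q = ⊤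
  · subst hqt
    rw [eLpNorm_exponent_top]
    refine eLpNormEssSup_le_of_ae_enorm_bound (.of_forall fun u => (h1 u).trans ?_)
    rw [mul_comm]
    simp only [ENNReal.toReal_top, div_zero, sub_zero, eLpNorm_exponent_top]
    exact mul_le_mul' le_rfl
      (eLpNormEssSup_mono_measure _ (withDensity_absolutelyContinuous _ _))
  have hq0 : q ≠ 0 := (lt_of_lt_of_le (by norm_num) hq).ne'
  have hqpos : 0 < q.toReal := ENNReal.toReal_pos hq0 hqt
  have hq2 : 2 ≤ q.toReal := by simpa using ENNReal.toReal_mono hqt hq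
  rw [eLpNorm_eq_lintegral_rpow_enorm_toReal hq0 hqt]
  have hfm : Measurable fun y => ‖f y‖ₑ ^ q.toReal := f.continuous.measurable.enorm.pow_const _
  have h2 : ∀ u, ‖locReal (n + 1) f u‖ₑ ^ q.toReal ≤
      c ^ ((1 / 2 - 1 / q.toReal) * q.toReal) *
        ∫⁻ y, ‖wgt (n + 1) (y - u)‖ₑ ^ 2 * ‖f y‖ₑ ^ q.toReal := by
    intro u
    refine (ENNReal.rpow_le_rpow (h1 u) hqpos.le).trans_eq ?_
    rw [ENNReal.mul_rpow_of_nonneg _ _ hqpos.le, ← ENNReal.rpow_mul, mul_comm,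
      eLpNorm_eq_lintegral_rpow_enorm_toReal hq0 hqt, ← ENNReal.rpow_mul,
      one_div_mul_cancel hqpos.ne', ENNReal.rpow_one, hν, lintegral_withDensity_wgt]
  have h3 : ∫⁻ u, ‖locReal (n + 1) f u‖ₑ ^ q.toReal ≤
      c ^ (q.toReal / 2) * ∫⁻ y, ‖f y‖ₑ ^ q.toReal := by
    refine (lintegral_mono h2).trans_eq ?_
    rw [lintegral_const_mul _ (measurable_lintegral_wgt_mul (n + 1) hfm),
      lintegral_lintegral_wgt _ hfm, ← mul_assoc]
    congr 1
    have h4 : (0 : ℝ) ≤ (1 / 2 - 1 / q.toReal) * q.toReal := by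
      rw [sub_mul, one_div_mul_cancel hqpos.ne']; linarith
    conv_lhs => rw [← hc, ← ENNReal.rpow_one c, ← ENNReal.rpow_mul, one_mul,
      ← ENNReal.rpow_add_of_nonneg _ _ h4 zero_le_one]
    congr 1
    field_simp
    ring
  refine (ENNReal.rpow_le_rpow h3 (by positivity)).trans_eq ?_
  rw [ENNReal.mul_rpow_of_nonneg _ _ (by positivity), ← ENNReal.rpow_mul,
    eLpNorm_eq_lintegral_rpow_enorm_toReal hq0 hqt]
  congr 2
  field_simp

theorem exists_eLpNorm_mul_locReal_le (n : ℕ) : ∃ C : ℝ≥0, ∀ p q r : ℝ≥0∞, 2 ≤ p → 2 ≤ q →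
    q⁻¹ + p⁻¹ = r⁻¹ → ∀ f g : 𝓢(Rn n, ℂ),
    eLpNorm (fun u => locReal (n + 1) f u * locReal (n + 1) g u) r volume ≤
      C * (eLpNorm f q volume * eLpNorm g p volume) := by
  obtain ⟨C, hC⟩ := exists_eLpNorm_locReal_le n
  refine ⟨C * C, fun p q r hp hq hr f g => ?_⟩
  have : q.HolderTriple p r := ⟨hr⟩
  have h := eLpNorm_smul_le_mul_eLpNorm (μ := volume) (p := q) (q := p) (r := r)
    (stronglyMeasurable_locReal (n + 1) g).aestronglyMeasurable
    (stronglyMeasurable_locReal (n + 1) f).aestronglyMeasurable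
  refine h.trans ((mul_le_mul' (hC q hq f) (hC p hp g)).trans_eq ?_)
  push_cast
  ring

theorem SymFam.exists_eLpNorm_le {b : ℕ → Rn n × Rn n × Rn n → ℂ} {R : ℕ → ℝ} (hb : SymFam n b R)
    (hR : ∀ j, 0 ≤ R j) : ∃ C : ℝ≥0, ∀ p q r : ℝ≥0∞, 2 ≤ p → 2 ≤ q → q⁻¹ + p⁻¹ = r⁻¹ →
    ∀ j (f g : 𝓢(Rn n, ℂ)), eLpNorm (oscInt (b j) (ftProd f g)) r volume ≤
      C * ENNReal.ofReal (R j ^ n) * (eLpNorm f q volume * eLpNorm g p volume) := by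
  obtain ⟨C, hC⟩ := exists_eLpNorm_mul_locReal_le n
  obtain ⟨D, hD⟩ := (locBdd_dirac hR).exists_le_locNorm le_rfl (by
    intro u
    rw [ae_dirac_iff (measurableSet_le (by fun_prop) (by fun_prop))]
    simp) (n + 1) hb
  refine ⟨D * C, fun p q r hp hq hr j f g => ?_⟩
  have hpt : ∀ u, ‖oscInt (b j) (ftProd f g) u‖ ≤ (D * R j ^ n) *
      ‖locReal (n + 1) f u * locReal (n + 1) g u‖ := by
    intro u
    have := hD j f g u
    rw [eLpNorm_one_eq_lintegral_enorm, lintegral_dirac' _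
      (hb.stronglyMeasurable_oscInt j (contDiff_ftProd f g).continuous).measurable.enorm,
      ← enorm_locReal, ← enorm_locReal, ← enorm_mul, ← ofReal_norm, ← ofReal_norm,
      ← ENNReal.ofReal_coe_nnreal, ← ENNReal.ofReal_mul NNReal.zero_le_coe,
      ← ENNReal.ofReal_mul (mul_nonneg NNReal.zero_le_coe (pow_nonneg (hR j) n))] at this
    exact (ENNReal.ofReal_le_ofReal_iff (mul_nonneg (mul_nonneg NNReal.zero_le_coe
      (pow_nonneg (hR j) n)) (norm_nonneg _))).1 this
  refine (eLpNorm_le_mul_eLpNorm_of_ae_le_mul (.of_forall hpt) r).trans ?_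
  refine (mul_le_mul' le_rfl (hC p q r hp hq hr f g)).trans_eq ?_
  rw [ENNReal.ofReal_mul NNReal.zero_le_coe, ENNReal.ofReal_coe_nnreal]
  push_cast
  ring

theorem SymFam.exists_eLpNorm_le_of_le_two {b : ℕ → Rn n × Rn n × Rn n → ℂ} {R : ℕ → ℝ}
    (hb : SymFam n b R) (hR : ∀ j, 0 ≤ R j) {p q r : ℝ≥0∞} (hp : 2 ≤ p) (hq : 2 ≤ q)
    (hr : q⁻¹ + p⁻¹ = r⁻¹) (hr0 : r ≠ 0) (hr2 : r ≤ 2) : ∃ C : ℝ≥0,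
    ∀ j (f g : 𝓢(Rn n, ℂ)), eLpNorm (oscInt (b j) (ftProd f g)) r volume ≤
      C * ENNReal.ofReal (R j ^ n) ^ (1 / 2 : ℝ) *
        (eLpNorm f q volume * eLpNorm g p volume) := by
  obtain ⟨C, hC⟩ := exists_eLpNorm_mul_locReal_le n
  obtain ⟨D, hD⟩ := (locBdd_ball hR).exists_le_locNorm one_le_two (by
    intro u
    filter_upwards [ae_restrict_mem measurableSet_closedBall] with x hx
    rwa [mem_closedBall, dist_eq_norm] at hx) (n + 1) hb
  have hrt : r ≠ ⊤ := (hr2.trans_lt (by simp)).ne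
  have hrpos : 0 < r.toReal := ENNReal.toReal_pos hr0 hrt
  set c := volume (closedBall (0 : Rn n) 1) with hc
  have hct : c < ⊤ := measure_closedBall_lt_top
  have hc0 : c ≠ 0 := (measure_closedBall_pos volume _ one_pos).ne'
  set e := 1 / r.toReal - 1 / 2 with he
  refine ⟨(c ^ (-(1 / r.toReal)) * c ^ e).toNNReal * (D * C), fun j f g => ?_⟩
  set T := oscInt (b j) (ftProd f g) with hT
  have hTm : StronglyMeasurable T :=
    hb.stronglyMeasurable_oscInt j (contDiff_ftProd f g).continuous
  set Q := ENNReal.ofReal (R j ^ n) ^ (1 / 2 : ℝ) with hQ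
  have h1 : ∀ u, (∫⁻ x in closedBall u 1, ‖T x‖ₑ ^ r.toReal) ≤
      (D * Q * c ^ e) ^ r.toReal *
        ‖locReal (n + 1) f u * locReal (n + 1) g u‖ₑ ^ r.toReal := by
    intro u
    have h := eLpNorm_le_eLpNorm_mul_rpow_measure_univ (μ := volume.restrict (closedBall u 1)) hr2
      hTm.aestronglyMeasurable
    rw [Measure.restrict_apply_univ, Measure.addHaar_closedBall_center, ← hc] at h
    have h' := h.trans (mul_le_mul' (hD j f g u) le_rfl)
    rw [eLpNorm_eq_lintegral_rpow_enorm_toReal hr0 hrt, ← enorm_locReal, ← enorm_locReal,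
      ← enorm_mul] at h'
    have h2 := ENNReal.rpow_le_rpow h' hrpos.le
    rw [← ENNReal.rpow_mul, one_div_mul_cancel hrpos.ne', ENNReal.rpow_one] at h2
    refine h2.trans_eq ?_
    rw [← ENNReal.mul_rpow_of_nonneg _ _ hrpos.le]
    congr 1
    rw [ENNReal.toReal_ofNat, ← he]
    ring
  have hTr : Measurable fun x => ‖T x‖ₑ ^ r.toReal := hTm.measurable.enorm.pow_const _
  have h2 : ∫⁻ u, ∫⁻ x in closedBall u 1, ‖T x‖ₑ ^ r.toReal = c * ∫⁻ x, ‖T x‖ₑ ^ r.toReal := by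
    have hms : MeasurableSet {z : Rn n × Rn n | z.2 ∈ closedBall z.1 1} := by
      simp only [mem_closedBall]
      exact measurableSet_le (by fun_prop) (by fun_prop)
    have hm : Measurable (Function.uncurry fun u x : Rn n =>
        (closedBall u 1).indicator (fun x => ‖T x‖ₑ ^ r.toReal) x) := by
      exact (hTr.comp measurable_snd).indicator hms
    simp only [← lintegral_indicator measurableSet_closedBall]
    rw [lintegral_lintegral_swap hm.aemeasurable, ← lintegral_const_mul _ hTr]
    congr 1
    ext x
    have : ∀ u, (closedBall u 1).indicator (fun x => ‖T x‖ₑ ^ r.toReal) x =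
        (closedBall x 1).indicator (fun _ => ‖T x‖ₑ ^ r.toReal) u := fun u => by
      simp only [Set.indicator, mem_closedBall, dist_comm x u]
    simp only [this]
    rw [lintegral_indicator measurableSet_closedBall, setLIntegral_const,
      Measure.addHaar_closedBall_center, mul_comm]
  have h3 := lintegral_mono (μ := volume) h1
  have hmm : Measurable fun u =>
      ‖locReal (n + 1) f u * locReal (n + 1) g u‖ₑ ^ r.toReal :=
    ((stronglyMeasurable_locReal (n + 1) f).measurable.mul
      (stronglyMeasurable_locReal (n + 1) g).measurable).enorm.pow_const r.toReal
  rw [h2, lintegral_const_mul _ hmm] at h3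
  have h4 := ENNReal.rpow_le_rpow h3 (z := 1 / r.toReal) (by positivity)
  rw [ENNReal.mul_rpow_of_nonneg _ _ (by positivity), ENNReal.mul_rpow_of_nonneg _ _ (by positivity),
    ← ENNReal.rpow_mul (D * Q * c ^ e), mul_one_div_cancel hrpos.ne', ENNReal.rpow_one,
    ← eLpNorm_eq_lintegral_rpow_enorm_toReal hr0 hrt,
    ← eLpNorm_eq_lintegral_rpow_enorm_toReal hr0 hrt] at h4
  have h5 := mul_le_mul' (le_refl (c ^ (-(1 / r.toReal))))
    (h4.trans (mul_le_mul' le_rfl (hC p q r hp hq hr f g)))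
  rw [← mul_assoc, ← ENNReal.rpow_add _ _ hc0 hct.ne, neg_add_cancel, ENNReal.rpow_zero,
    one_mul] at h5
  refine h5.trans_eq ?_
  push_cast
  rw [ENNReal.coe_toNNReal (ENNReal.mul_ne_top (ENNReal.rpow_ne_top_of_ne_zero hc0 hct.ne)
    (ENNReal.rpow_ne_top_of_ne_zero hc0 hct.ne))]
  ring

end Globalisation

section Assembly

variable {n : ℕ}

theorem exists_dilate {h : ℝ} (hh : 0 < h) (f : 𝓢(Rn n, ℂ)) :
    ∃ F : 𝓢(Rn n, ℂ), ∀ x, F x = f (h⁻¹ • x) :=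
  ⟨SchwartzMap.compCLMOfContinuousLinearEquiv ℂ
    (ContinuousLinearEquiv.smulLeft (Units.mk0 h⁻¹ (inv_pos.2 hh).ne')) f, fun _ => rfl⟩

theorem fourierT_dilate {h : ℝ} (hh : 0 < h) {F f : Rn n → ℂ} (hF : ∀ x, F x = f (h⁻¹ • x))
    (ξ : Rn n) : fourierT F ξ = (h ^ n : ℝ) • fourierT f (h • ξ) := by
  have h1 := Measure.integral_comp_inv_smul volume
    (fun z : Rn n => f z * Complex.exp (-Complex.I * (⟪h • ξ, z⟫ : ℂ))) h
  rw [finrank_euclideanSpace_fin, abs_of_nonneg (by positivity)] at h1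
  rw [fourierT, fourierT, ← h1]
  congr 1
  ext y
  rw [hF, real_inner_smul_left, real_inner_smul_right, mul_inv_cancel_left₀ hh.ne']

theorem osc_smul (h : ℝ) (x : Rn n) (P : Rn n × Rn n) : osc (h • x) P = osc x (h • P) := by
  rw [osc, osc, Prod.smul_fst, Prod.smul_snd, ← smul_add, real_inner_smul_left,
    real_inner_smul_right]

theorem oscInt_dilate {h : ℝ} (hh : 0 < h) (b : Rn n × Rn n × Rn n → ℂ) {F G f g : Rn n → ℂ}
    (hF : ∀ x, F x = f (h⁻¹ • x)) (hG : ∀ x, G x = g (h⁻¹ • x)) (x : Rn n) :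
    oscInt (fun p => b (dil n h p)) (ftProd F G) (h • x) = oscInt b (ftProd f g) x := by
  have h1 := Measure.integral_comp_smul volume
    (fun P : Rn n × Rn n => b (x, P) * ftProd f g P * osc x P) h
  have h2 : Module.finrank ℝ (Rn n × Rn n) = n + n := by
    rw [Module.finrank_prod, finrank_euclideanSpace_fin]
  rw [h2, abs_of_nonneg (by positivity)] at h1
  have h3 : ∀ P : Rn n × Rn n, b (dil n h (h • x, P)) * ftProd F G P * osc (h • x) P =
      (h ^ (n + n) : ℝ) • (b (x, h • P) * ftProd f g (h • P) * osc x (h • P)) := fun P => by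
    rw [dil_apply, inv_smul_smul₀ hh.ne', osc_smul, ftProd, fourierT_dilate hh hF,
      fourierT_dilate hh hG, ftProd, Prod.smul_fst, Prod.smul_snd]
    simp only [real_smul, pow_add]
    push_cast
    ring
  have h4 : (h ^ (n + n) : ℝ) * (h ^ (n + n))⁻¹ = 1 := mul_inv_cancel₀ (by positivity)
  simp only [oscInt, h3]
  rw [integral_smul, h1, smul_smul, h4, one_smul]

/-- The `j`-th Littlewood-Paley block of the symbol. -/
def block (a : Rn n → Rn n → Rn n → ℂ) (j : ℕ) (p : Rn n × Rn n × Rn n) : ℂ :=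
  dyad j p.2 * symFun a p

theorem oscInt_block (m ρ : ℝ) (a : Rn n → Rn n → Rn n → ℂ) (j : ℕ) {F G f g : Rn n → ℂ}
    (hF : ∀ x, F x = f ((((2 : ℝ) ^ j) ^ ρ)⁻¹ • x))
    (hG : ∀ x, G x = g ((((2 : ℝ) ^ j) ^ ρ)⁻¹ • x)) (x : Rn n) :
    oscInt (block a j) (ftProd f g) x =
      (((2 : ℝ) ^ j) ^ m) • oscInt (piece m ρ a j) (ftProd F G) ((((2 : ℝ) ^ j) ^ ρ) • x) := by
  have hT : (0 : ℝ) < 2 ^ j := by positivity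
  rw [← oscInt_dilate (Real.rpow_pos_of_pos hT ρ) (block a j) hF hG x, oscInt, oscInt,
    ← integral_smul]
  congr 1
  ext P
  have h1 : ((2 : ℝ) ^ j) ^ m * ((2 : ℝ) ^ j) ^ (-m) = 1 := by
    rw [← Real.rpow_add hT, add_neg_cancel, Real.rpow_zero]
  rw [piece, block, ← smul_mul_assoc, ← smul_mul_assoc, ← mul_smul_comm, smul_smul, h1, one_smul]

theorem stronglyMeasurable_oscInt_block {m ρ δ : ℝ} (hδρ : δ ≤ ρ) (hρ1 : ρ ≤ 1)
    {a : Rn n → Rn n → Rn n → ℂ} (ha : BilinSmRhoDelta n m ρ δ a) (j : ℕ) (f g : 𝓢(Rn n, ℂ)) :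
    StronglyMeasurable (oscInt (block a j) (ftProd f g)) := by
  have hh : (0 : ℝ) < ((2 : ℝ) ^ j) ^ ρ := by positivity
  obtain ⟨F, hF⟩ := exists_dilate hh f
  obtain ⟨G, hG⟩ := exists_dilate hh g
  have h1 : StronglyMeasurable (oscInt (piece m ρ a j) (ftProd F G)) :=
    (symFam_piece hδρ hρ1 ha).stronglyMeasurable_oscInt j (contDiff_ftProd F G).continuous
  have h2 : Measurable fun x : Rn n => (((2 : ℝ) ^ j) ^ ρ) • x := measurable_const_smul _
  rw [funext (oscInt_block m ρ a j hF hG)]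
  have h3 : StronglyMeasurable fun x : Rn n =>
      oscInt (piece m ρ a j) (ftProd F G) ((((2 : ℝ) ^ j) ^ ρ) • x) := h1.comp_measurable h2
  exact h3.const_smul (((2 : ℝ) ^ j) ^ m)

theorem eLpNorm_dilate_mul {h : ℝ} (hh : 0 < h) {p q r : ℝ≥0∞} (hp : p ≠ 0) (hq : q ≠ 0)
    (hr : q⁻¹ + p⁻¹ = r⁻¹) {F G f g : Rn n → ℂ} (hF : ∀ x, F x = f (h⁻¹ • x))
    (hG : ∀ x, G x = g (h⁻¹ • x)) :
    ENNReal.ofReal |(h ^ n)⁻¹| ^ (1 / r).toReal * (eLpNorm F q volume * eLpNorm G p volume) =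
      eLpNorm f q volume * eLpNorm g p volume := by
  have hF' : F = fun x => f (h⁻¹ • x) := funext hF
  have hG' : G = fun x => g (h⁻¹ • x) := funext hG
  set s := ENNReal.ofReal |(h ^ n)⁻¹| with hs
  have hs0 : s ≠ 0 := by
    rw [hs, ne_eq, ENNReal.ofReal_eq_zero, not_le]
    positivity
  have hst : s ≠ ⊤ := ENNReal.ofReal_ne_top
  have hs' : ENNReal.ofReal |(h⁻¹ ^ n)⁻¹| = s⁻¹ := by
    rw [hs, ← ENNReal.ofReal_inv_of_pos (by positivity), ← abs_inv, inv_pow]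
  have he : (1 / r).toReal = (1 / q).toReal + (1 / p).toReal := by
    rw [one_div, one_div, one_div, ← hr, ENNReal.toReal_add] <;> simpa
  rw [hF', hG', eLpNorm_comp_smul (inv_pos.2 hh).ne', eLpNorm_comp_smul (inv_pos.2 hh).ne', hs',
    he, ENNReal.rpow_add _ _ hs0 hst, ENNReal.inv_rpow, ENNReal.inv_rpow]
  have h1 : ∀ t : ℝ, s ^ t * (s ^ t)⁻¹ = 1 := fun t =>
    ENNReal.mul_inv_cancel (by simp [hs0, hst]) (by simp [hs0, hst])
  calc _ = (s ^ (1 / q).toReal * (s ^ (1 / q).toReal)⁻¹) *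
        (s ^ (1 / p).toReal * (s ^ (1 / p).toReal)⁻¹) *
        (eLpNorm f q volume * eLpNorm g p volume) := by ring
    _ = _ := by rw [h1, h1, one_mul, one_mul]

theorem eLpNorm_oscInt_block_le {m ρ : ℝ} {a : Rn n → Rn n → Rn n → ℂ} {p q r : ℝ≥0∞}
    (hp : p ≠ 0) (hq : q ≠ 0) (hr : q⁻¹ + p⁻¹ = r⁻¹) {A : ℝ≥0∞} {j : ℕ}
    (hA : ∀ f g : 𝓢(Rn n, ℂ), eLpNorm (oscInt (piece m ρ a j) (ftProd f g)) r volume ≤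
      A * (eLpNorm f q volume * eLpNorm g p volume)) (f g : 𝓢(Rn n, ℂ)) :
    eLpNorm (oscInt (block a j) (ftProd f g)) r volume ≤
      ENNReal.ofReal (((2 : ℝ) ^ j) ^ m) * A * (eLpNorm f q volume * eLpNorm g p volume) := by
  have hT : (0 : ℝ) < 2 ^ j := by positivity
  have hh : (0 : ℝ) < ((2 : ℝ) ^ j) ^ ρ := by positivity
  obtain ⟨F, hF⟩ := exists_dilate hh f
  obtain ⟨G, hG⟩ := exists_dilate hh g
  have h1 : oscInt (block a j) (ftProd f g) = (((2 : ℝ) ^ j) ^ m) •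
      fun x => oscInt (piece m ρ a j) (ftProd F G) ((((2 : ℝ) ^ j) ^ ρ) • x) :=
    funext (oscInt_block m ρ a j hF hG)
  have h2 : ‖((2 : ℝ) ^ j) ^ m‖ₑ = ENNReal.ofReal (((2 : ℝ) ^ j) ^ m) :=
    Real.enorm_of_nonneg (Real.rpow_nonneg hT.le m)
  rw [h1, eLpNorm_const_smul, eLpNorm_comp_smul hh.ne', h2,
    ← eLpNorm_dilate_mul hh hp hq hr hF hG]
  refine (mul_le_mul' le_rfl (mul_le_mul' le_rfl (hA F G))).trans_eq ?_
  ring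

theorem BilinSmRhoDelta.exists_norm_le {m ρ δ : ℝ} (hm : m ≤ 0) {a : Rn n → Rn n → Rn n → ℂ}
    (ha : BilinSmRhoDelta n m ρ δ a) : ∃ C : ℝ, ∀ p, ‖symFun a p‖ ≤ C := by
  obtain ⟨C, hC⟩ := ha.2 0 0 0
  refine ⟨|C|, fun p => ?_⟩
  have h := hC p.1 p.2.1 p.2.2
  simp only [norm_iteratedFDeriv_zero, Nat.cast_zero, add_zero, mul_zero, sub_zero] at h
  refine h.trans ((mul_le_mul_of_nonneg_right (le_abs_self C) (by positivity)).trans ?_)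
  refine mul_le_of_le_one_right (abs_nonneg C)
    (Real.rpow_le_one_of_one_le_of_nonpos ?_ (by linarith))
  nlinarith [sq_nonneg ‖p.2.1‖, sq_nonneg ‖p.2.2‖]

theorem integrable_symFun_mul {m ρ δ : ℝ} (hm : m ≤ 0) {a : Rn n → Rn n → Rn n → ℂ}
    (ha : BilinSmRhoDelta n m ρ δ a) (f g : 𝓢(Rn n, ℂ)) (x : Rn n) :
    Integrable fun P => symFun a (x, P) * ftProd f g P * osc x P := by
  obtain ⟨C, hC⟩ := ha.exists_norm_le hm
  have h1 : Integrable (ftProd f g) := (integrable_fourierT f).mul_prod (integrable_fourierT g)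
  have ha' : Continuous (symFun a) := ha.1.continuous
  have h2 : Continuous fun P : Rn n × Rn n => symFun a (x, P) := ha'.comp (by fun_prop)
  have h3 : Continuous (osc x) := (contDiff_osc_right x).continuous
  have h4 : Integrable fun P => symFun a (x, P) * ftProd f g P :=
    h1.bdd_mul h2.aestronglyMeasurable (.of_forall fun P => hC (x, P))
  exact h4.mul_bdd h3.aestronglyMeasurable (.of_forall fun P => (norm_osc x P).le)

theorem Tbilin_eq_oscInt {m ρ δ : ℝ} (hm : m ≤ 0) {a : Rn n → Rn n → Rn n → ℂ}
    (ha : BilinSmRhoDelta n m ρ δ a) (f g : 𝓢(Rn n, ℂ)) (x : Rn n) :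
    Tbilin a f g x = oscInt (symFun a) (ftProd f g) x := by
  rw [oscInt, Measure.volume_eq_prod, integral_prod _ (integrable_symFun_mul hm ha f g x), Tbilin]
  simp only [symFun, ftProd, osc, mul_assoc]

theorem sum_oscInt_block {m ρ δ : ℝ} {a : Rn n → Rn n → Rn n → ℂ}
    (hm : m ≤ 0) (ha : BilinSmRhoDelta n m ρ δ a) (f g : 𝓢(Rn n, ℂ)) (J : ℕ) (x : Rn n) :
    ∑ j ∈ Finset.range (J + 1), oscInt (block a j) (ftProd f g) x =
      ∫ P, cutoff (((2 : ℝ) ^ J)⁻¹ • P) * (symFun a (x, P) * ftProd f g P * osc x P) := by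
  simp only [oscInt]
  rw [← integral_finsetSum]
  · congr 1
    ext P
    rw [← sum_dyad, Finset.sum_mul]
    simp only [block, mul_assoc]
  · intro j _
    have h1 : ∀ c : ℝ, Continuous fun P : Rn n × Rn n => cutoff (c • P) := fun c =>
      contDiff_cutoff.continuous.comp (continuous_const_smul c)
    have h2 : Continuous (dyad (n := n) j) := by
      unfold dyad
      split_ifs
      exacts [(h1 _).sub continuous_const, (h1 _).sub (h1 _)]
    have h3 : ∀ P : Rn n × Rn n, ‖dyad j P‖ ≤ 1 + 1 := fun P => by
      refine (norm_sub_le _ _).trans (add_le_add (norm_cutoff_le _) ?_)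
      split_ifs
      exacts [by simp, norm_cutoff_le _]
    simp only [block, mul_assoc]
    have h4 := (integrable_symFun_mul hm ha f g x).bdd_mul h2.aestronglyMeasurable
      (.of_forall h3)
    simpa only [mul_assoc] using h4

theorem tendsto_sum_oscInt_block {m ρ δ : ℝ} {a : Rn n → Rn n → Rn n → ℂ}
    (hm : m ≤ 0) (ha : BilinSmRhoDelta n m ρ δ a) (f g : 𝓢(Rn n, ℂ)) (x : Rn n) :
    Tendsto (fun J : ℕ => ∑ j ∈ Finset.range (J + 1), oscInt (block a j) (ftProd f g) x) atTop
      (𝓝 (Tbilin a f g x)) := by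
  have hi := integrable_symFun_mul hm ha f g x
  rw [Tbilin_eq_oscInt hm ha]
  simp only [sum_oscInt_block hm ha]
  refine tendsto_integral_of_dominated_convergence _ (fun J => ?_) hi.norm (fun J => ?_) ?_
  · have h1 : Continuous fun P : Rn n × Rn n => cutoff (((2 : ℝ) ^ J)⁻¹ • P) :=
      contDiff_cutoff.continuous.comp (continuous_const_smul _)
    exact h1.aestronglyMeasurable.mul hi.aestronglyMeasurable
  · refine .of_forall fun P => ?_
    rw [norm_mul]
    exact mul_le_of_le_one_left (norm_nonneg _) (norm_cutoff_le _)
  · refine .of_forall fun P => ?_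
    have h1 : Tendsto (fun J : ℕ => ((2 : ℝ) ^ J)⁻¹ • P) atTop (𝓝 0) := by
      have h := (tendsto_inv_atTop_zero.comp
        (tendsto_pow_atTop_atTop_of_one_lt (one_lt_two (α := ℝ)))).smul_const P
      rwa [zero_smul] at h
    have h2 : cutoff (0 : Rn n × Rn n) = 1 := cutoff_eq_one (by simp)
    have h3 := (contDiff_cutoff.continuous.tendsto (0 : Rn n × Rn n)).comp h1
    rw [h2] at h3
    have h4 := h3.mul_const (symFun a (x, P) * ftProd f g P * osc x P)
    rwa [one_mul] at h4

/-- Summation of the dyadic pieces when their bounds decay geometrically. -/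
theorem exists_eLpNorm_Tbilin_le {m ρ δ κ : ℝ} (hδρ : δ ≤ ρ) (hρ1 : ρ ≤ 1)
    {a : Rn n → Rn n → Rn n → ℂ} (hm : m ≤ 0) (ha : BilinSmRhoDelta n m ρ δ a) {p q r : ℝ≥0∞}
    (hp : p ≠ 0) (hq : q ≠ 0) (hr1 : 1 ≤ r) (hr : q⁻¹ + p⁻¹ = r⁻¹) (hκ0 : 0 ≤ κ)
    (hκ : m + n * (1 - ρ) * κ < 0) {C : ℝ≥0}
    (hC : ∀ j (f g : 𝓢(Rn n, ℂ)), eLpNorm (oscInt (piece m ρ a j) (ftProd f g)) r volume ≤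
      C * ENNReal.ofReal ((2 * ((2 : ℝ) ^ j) ^ (1 - ρ)) ^ n) ^ κ *
        (eLpNorm f q volume * eLpNorm g p volume)) :
    ∃ D : ℝ≥0, ∀ f g : 𝓢(Rn n, ℂ), eLpNorm (Tbilin a f g) r volume ≤
      D * (eLpNorm f q volume * eLpNorm g p volume) := by
  set θ := ENNReal.ofReal ((2 : ℝ) ^ (m + n * (1 - ρ) * κ)) with hθ
  have hθ1 : θ < 1 := by
    rw [hθ, ENNReal.ofReal_lt_one]
    exact Real.rpow_lt_one_of_one_lt_of_neg one_lt_two hκ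
  set E : ℝ≥0∞ := C * ENNReal.ofReal (2 ^ n) ^ κ with hE
  have hEt : E ≠ ⊤ :=
    ENNReal.mul_ne_top ENNReal.coe_ne_top (ENNReal.rpow_ne_top_of_nonneg hκ0 ENNReal.ofReal_ne_top)
  have hθE : ∀ j : ℕ, ENNReal.ofReal (((2 : ℝ) ^ j) ^ m) *
      (C * ENNReal.ofReal ((2 * ((2 : ℝ) ^ j) ^ (1 - ρ)) ^ n) ^ κ) = E * θ ^ j := by
    intro j
    have hT : (0 : ℝ) < 2 ^ j := by positivity
    have h1 : ENNReal.ofReal (((2 : ℝ) ^ j) ^ m) *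
        ENNReal.ofReal ((((2 : ℝ) ^ j) ^ (1 - ρ)) ^ n) ^ κ = θ ^ j := by
      rw [ENNReal.ofReal_rpow_of_nonneg (by positivity) hκ0, ← ENNReal.ofReal_mul (by positivity),
        hθ, ← ENNReal.ofReal_pow (by positivity)]
      congr 1
      rw [← Real.rpow_natCast _ n, ← Real.rpow_mul hT.le, ← Real.rpow_mul hT.le,
        ← Real.rpow_add hT, ← Real.rpow_natCast 2 j, ← Real.rpow_mul zero_le_two, ← Real.rpow_natCast,
        ← Real.rpow_mul zero_le_two]
      congr 1
      ring
    rw [mul_pow, ENNReal.ofReal_mul (by positivity), ENNReal.mul_rpow_of_nonneg _ _ hκ0, ← h1, hE]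
    ring
  have hDt : E * (1 - θ)⁻¹ ≠ ⊤ :=
    ENNReal.mul_ne_top hEt (ENNReal.inv_ne_top.2 (tsub_pos_of_lt hθ1).ne')
  refine ⟨(E * (1 - θ)⁻¹).toNNReal, fun f g => ?_⟩
  rw [ENNReal.coe_toNNReal hDt]
  set N := eLpNorm f q volume * eLpNorm g p volume with hN
  have hmeas : ∀ j, AEStronglyMeasurable (oscInt (block a j) (ftProd f g)) volume := fun j =>
    (stronglyMeasurable_oscInt_block hδρ hρ1 ha j f g).aestronglyMeasurable
  have hpart : ∀ J : ℕ, eLpNorm (∑ j ∈ Finset.range (J + 1), oscInt (block a j) (ftProd f g))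
      r volume ≤ E * (1 - θ)⁻¹ * N := by
    intro J
    refine (eLpNorm_sum_le (fun j _ => hmeas j) hr1).trans ?_
    refine (Finset.sum_le_sum (g := fun j => E * N * θ ^ j) fun j _ => ?_).trans ?_
    · refine (eLpNorm_oscInt_block_le hp hq hr (hC j) f g).trans_eq ?_
      rw [hθE]
      ring
    · rw [← Finset.mul_sum]
      refine (mul_le_mul' le_rfl (ENNReal.sum_le_tsum _)).trans_eq ?_
      rw [ENNReal.tsum_geometric]
      ring
  have hlim := Lp.eLpNorm_lim_le_liminf_eLpNorm (p := r) (μ := volume)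
    (f := fun J => ∑ j ∈ Finset.range (J + 1), oscInt (block a j) (ftProd f g))
    (fun J => Finset.aestronglyMeasurable_sum _ fun j _ => hmeas j) (Tbilin a f g)
    (.of_forall fun x => by
      simpa only [Finset.sum_apply] using tendsto_sum_oscInt_block hm ha f g x)
  refine hlim.trans (liminf_le_of_le (by isBoundedDefault) fun b hb => ?_)
  obtain ⟨J, hJ⟩ := hb.exists
  exact hJ.trans (hpart J)

end Assembly

theorem statement14 (n : ℕ) (m ρ δ : ℝ)
    (hδ0 : 0 ≤ δ) (hδρ : δ ≤ ρ) (hρ1 : ρ ≤ 1) (hδ1 : δ < 1)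
    (a : Rn n → Rn n → Rn n → ℂ) (ha : BilinSmRhoDelta n m ρ δ a)
    (p q r : ℝ≥0∞) (hp : 2 ≤ p) (hq : 2 ≤ q)
    (hpqr : 1 / r = 1 / q + 1 / p)
    (hm : m < 2 * (n : ℝ) * (ρ - 1) *
      max |(p⁻¹).toReal - 1 / 2| |(q⁻¹).toReal - 1 / 2| + (n : ℝ) * (ρ - 1) / 2) :
    ∃ Cst : ℝ≥0, 0 < Cst ∧ ∀ (f g : SchwartzMap (Rn n) ℂ),
      eLpNorm (fun x => Tbilin a (⇑f) (⇑g) x) r volume ≤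
        Cst * eLpNorm (⇑f) q volume * eLpNorm (⇑g) p volume := by
  have hr : q⁻¹ + p⁻¹ = r⁻¹ := by simpa only [one_div] using hpqr.symm
  have hp0 : p ≠ 0 := (lt_of_lt_of_le (by norm_num) hp).ne'
  have hq0 : q ≠ 0 := (lt_of_lt_of_le (by norm_num) hq).ne'
  have hr1 : 1 ≤ r := by
    rw [← ENNReal.inv_le_one, ← hr, ← ENNReal.inv_two_add_inv_two]
    exact add_le_add (ENNReal.inv_le_inv.2 hq) (ENNReal.inv_le_inv.2 hp)
  have hw : (n : ℝ) * (ρ - 1) ≤ 0 :=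
    mul_nonpos_of_nonneg_of_nonpos (Nat.cast_nonneg n) (by linarith)
  set M := max |(p⁻¹).toReal - 1 / 2| |(q⁻¹).toReal - 1 / 2| with hM
  have hM0 : 0 ≤ M := le_max_of_le_left (abs_nonneg _)
  have hm0 : m ≤ 0 := by nlinarith
  have hsym := symFam_piece hδρ hρ1 ha
  have hR : ∀ j : ℕ, (0 : ℝ) ≤ 2 * ((2 : ℝ) ^ j) ^ (1 - ρ) := fun j => by positivity
  have key : ∃ D : ℝ≥0, ∀ f g : 𝓢(Rn n, ℂ), eLpNorm (Tbilin a f g) r volume ≤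
      D * (eLpNorm f q volume * eLpNorm g p volume) := by
    by_cases h : 1 / 4 ≤ M
    · obtain ⟨C, hC⟩ := hsym.exists_eLpNorm_le hR
      refine exists_eLpNorm_Tbilin_le hδρ hρ1 hm0 ha hp0 hq0 hr1 hr zero_le_one (κ := 1)
        (by nlinarith) (C := C) fun j f g => ?_
      rw [ENNReal.rpow_one]
      exact hC p q r hp hq hr j f g
    · have hlt := max_lt_iff.1 (not_le.1 h)
      have hr2 : r ≤ 2 := by
        have h1 := (abs_lt.1 hlt.1).1
        have h2 := (abs_lt.1 hlt.2).1
        rw [← ENNReal.inv_le_inv, ← hr, ← ENNReal.toReal_le_toReal (by simp) (by simp [hp0, hq0]),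
          ENNReal.toReal_add (by simpa) (by simpa), ENNReal.toReal_inv, ENNReal.toReal_ofNat]
        linarith
      obtain ⟨C, hC⟩ := hsym.exists_eLpNorm_le_of_le_two hR hp hq hr
        (zero_lt_one.trans_le hr1).ne' hr2
      exact exists_eLpNorm_Tbilin_le hδρ hρ1 hm0 ha hp0 hq0 hr1 hr (by norm_num)
        (by nlinarith) hC
  obtain ⟨D, hD⟩ := key
  refine ⟨D + 1, by positivity, fun f g => (hD f g).trans ?_⟩
  rw [mul_assoc]
  gcongr
  simp
end
end

section
/- Let a : ℝⁿ × ℝⁿ → ℂ be a smooth function and define, for F in L²(ℝⁿ × ℝⁿ), S(F)(x) = ∫_{ℝⁿ}∫_{ℝⁿ} a(ξ,η) F̂(ξ,η) e^{ix·(ξ+η)} dξ dη, where F̂ is the Fourier transform on ℝⁿ × ℝⁿ. Set A := (sup_{ζ∈ℝⁿ} ∫_{ℝⁿ} |a(ζ−η,η)|² dη)^{1/2}. Then S is bounded from L²(ℝⁿ × ℝⁿ) to L²(ℝⁿ) if and only if A < ∞; moreover, when A < ∞ one has ‖S(F)‖_{L²(ℝⁿ)} ≤ A‖F‖_{L²(ℝⁿ×ℝⁿ)}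 for all F ∈ L²(ℝⁿ × ℝⁿ). -/
open MeasureTheory Metric Complex Real
open scoped ENNReal NNReal RealInnerProductSpace BigOperators

noncomputable section

/-- The Fourier transform on `ℝⁿ × ℝⁿ` (normalised so that Plancherel and the
inversion formula hold without extra constants):
`F̂(ξ,η) = ∬ F(x,y) e^{-2πi(x·ξ + y·η)} dx dy`. -/
def fourierT2 {n : ℕ} (F : Rn n × Rn n → ℂ) (ξ η : Rn n) : ℂ :=
  ∫ z : Rn n × Rn n,
    F z * Complex.exp (-2 * (π : ℂ) * Complex.I * ((⟪z.1, ξ⟫ + ⟪z.2, η⟫ : ℝ) : ℂ))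

/-- The operator `S(F)(x) = ∬ a(ξ,η) F̂(ξ,η) e^{2πi x·(ξ+η)} dξ dη`. -/
def Sop {n : ℕ} (a : Rn n → Rn n → ℂ) (F : Rn n × Rn n → ℂ) (x : Rn n) : ℂ :=
  ∫ ξ : Rn n, ∫ η : Rn n,
    a ξ η * fourierT2 F ξ η * Complex.exp (2 * (π : ℂ) * Complex.I * ((⟪x, ξ + η⟫ : ℝ) : ℂ))

/-- The constant `A = (sup_ζ ∫ |a(ζ-η,η)|² dη)^{1/2}`. -/
def Aconst {n : ℕ} (a : Rn n → Rn n → ℂ) : ℝ≥0∞ :=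
  (⨆ ζ : Rn n, ∫⁻ η : Rn n, (‖a (ζ - η) η‖₊ : ℝ≥0∞) ^ (2 : ℝ)) ^ ((1 : ℝ) / 2)

open scoped FourierTransform SchwartzMap

/-- On integrable square-integrable functions, the Fourier integral agrees almost everywhere with
the Fourier transform on `L²`. -/
lemma fourier_ae_eq_Lp_fourier {V : Type*} [NormedAddCommGroup V] [InnerProductSpace ℝ V]
    [FiniteDimensional ℝ V] [MeasurableSpace V] [BorelSpace V] {G : V → ℂ}
    (hG : Integrable G) (hG2 : MemLp G 2) :
    𝓕 G =ᵐ[volume] (𝓕 (hG2.toLp G) : Lp (α := V) ℂ 2) := by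
  have hcont : Continuous (𝓕 G) :=
    VectorFourier.fourierIntegral_continuous Real.continuous_fourierChar continuous_inner hG
  obtain ⟨H, hH⟩ : ∃ H : Lp (α := V) ℂ 2, H = 𝓕 (hG2.toLp G) := ⟨_, rfl⟩
  rw [← hH]
  have hloc : LocallyIntegrable H volume := (Lp.memLp H).locallyIntegrable one_le_two
  have hloc' : LocallyIntegrable (𝓕 G) volume := hcont.locallyIntegrable
  generalize hK : 𝓕 G = K at *
  suffices h : ∀ g : V → ℝ, ContDiff ℝ (⊤ : ℕ∞) g → HasCompactSupport g →
      ∫ x, g x • K x = ∫ x, g x • H x from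
    ae_eq_of_integral_contDiff_smul_eq (f := K) (f' := H) hloc' hloc h
  intro g hg hgc
  subst hK
  have hc : HasCompactSupport (fun x => (g x : ℂ)) :=
    hgc.comp_left (g := fun t : ℝ => (t : ℂ)) Complex.ofReal_zero
  have hs : ContDiff ℝ (⊤ : ℕ∞) (fun x => (g x : ℂ)) := Complex.ofRealCLM.contDiff.comp hg
  let u : 𝓢(V, ℂ) := hc.toSchwartzMap hs
  have hu : ∀ x, u x = g x := fun x => rfl
  have h1 : ∫ x, g x • H x =
      ∫ x, (𝓕 u) x • (hG2.toLp G) x := by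
    have := congrArg (fun T => T u) (Lp.fourier_toTemperedDistribution_eq (hG2.toLp G))
    simp only [TemperedDistribution.fourier_apply, Lp.toTemperedDistribution_apply] at this
    rw [← hH] at this
    rw [this]
    simp [hu]
  have h2 : ∫ x, g x • 𝓕 G x = ∫ x, (𝓕 u) x • G x := by
    have := VectorFourier.integral_fourierIntegral_smul_eq_flip (μ := volume) (ν := volume)
      (L := innerₗ V) Real.continuous_fourierChar continuous_inner u.integrable hG
    rw [flip_innerₗ] at this
    rw [SchwartzMap.fourier_coe]
    refine Eq.trans ?_ this.symm
    exact integral_congr_ae (Filter.Eventually.of_forall fun x => Complex.coe_smul _ _)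
  rw [h1, h2]
  refine integral_congr_ae ?_
  filter_upwards [hG2.coeFn_toLp] with x hx
  rw [hx]

/-- **Plancherel's theorem** for the inverse Fourier integral. -/
lemma eLpNorm_fourierInv_eq {V : Type*} [NormedAddCommGroup V] [InnerProductSpace ℝ V]
    [FiniteDimensional ℝ V] [MeasurableSpace V] [BorelSpace V] {G : V → ℂ}
    (hG : Integrable G) (hG2 : MemLp G 2) :
    eLpNorm (𝓕⁻ G) 2 volume = eLpNorm G 2 volume := by
  have hcont : Continuous (𝓕 G) :=
    VectorFourier.fourierIntegral_continuous Real.continuous_fourierChar continuous_inner hG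
  have h : 𝓕⁻ G = 𝓕 G ∘ Neg.neg := by
    ext x
    exact Real.fourierInv_eq_fourier_neg G x
  rw [h, eLpNorm_comp_measurePreserving hcont.aestronglyMeasurable
      (Measure.measurePreserving_neg volume),
    eLpNorm_congr_ae (fourier_ae_eq_Lp_fourier hG hG2), ← Lp.enorm_def, 
    ← eLpNorm_congr_ae hG2.coeFn_toLp, ← Lp.enorm_def,
    ← ofReal_norm, ← ofReal_norm, Lp.norm_fourier_eq]

lemma eLpNorm_two_rpow {α : Type*} [MeasurableSpace α] (μ : Measure α) (f : α → ℂ) :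
    eLpNorm f 2 μ ^ (2 : ℝ) = ∫⁻ x, ‖f x‖ₑ ^ (2 : ℝ) ∂μ := by
  simpa using eLpNorm_nnreal_pow_eq_lintegral (f := f) (μ := μ) (p := 2) (by norm_num)

/-- The Fourier transform `fourierT2` acts bijectively and isometrically on Schwartz functions. -/
lemma fourierT2_schwartz (n : ℕ) :
    ∃ T : 𝓢(Rn n × Rn n, ℂ) → 𝓢(Rn n × Rn n, ℂ),
      (∀ F ξ η, T F (ξ, η) = fourierT2 F ξ η) ∧
      (∀ F, eLpNorm (T F) 2 volume = eLpNorm F 2 volume) ∧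
      Function.Surjective T := by
  let e := WithLp.prodContinuousLinearEquiv 2 ℝ (Rn n) (Rn n)
  let P : 𝓢(Rn n × Rn n, ℂ) → 𝓢(WithLp 2 (Rn n × Rn n), ℂ) :=
    SchwartzMap.compCLMOfContinuousLinearEquiv ℂ e
  let Q : 𝓢(WithLp 2 (Rn n × Rn n), ℂ) → 𝓢(Rn n × Rn n, ℂ) :=
    SchwartzMap.compCLMOfContinuousLinearEquiv ℂ e.symm
  have hP : ∀ F w, P F w = F (WithLp.ofLp w) := fun F w => rfl
  have hQ : ∀ F z, Q F z = F (WithLp.toLp 2 z) := fun F w => rfl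
  have nP : ∀ F, eLpNorm (P F) 2 volume = eLpNorm F 2 volume := fun F =>
    eLpNorm_comp_measurePreserving F.continuous.aestronglyMeasurable
      (WithLp.volume_preserving_ofLp (Rn n) (Rn n))
  have nQ : ∀ F, eLpNorm (Q F) 2 volume = eLpNorm F 2 volume := fun F =>
    eLpNorm_comp_measurePreserving F.continuous.aestronglyMeasurable
      (WithLp.volume_preserving_toLp (Rn n) (Rn n))
  refine ⟨fun F => Q (𝓕 (P F)), ?_, ?_, ?_⟩
  · intro F ξ η
    rw [hQ, SchwartzMap.fourier_coe, Real.fourier_eq', fourierT2,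
      ← (WithLp.volume_preserving_toLp (Rn n) (Rn n)).integral_comp
        (MeasurableEquiv.toLp 2 (Rn n × Rn n)).measurableEmbedding]
    refine integral_congr_ae (Filter.Eventually.of_forall fun z => ?_)
    simp only [hP, WithLp.prod_inner_apply, smul_eq_mul]
    rw [mul_comm]
    congr 2
    push_cast
    ring
  · intro F
    have h := congrArg ENNReal.ofReal (SchwartzMap.norm_fourier_toL2_eq (P F))
    simp only [ofReal_norm, Lp.enorm_def] at h
    rw [eLpNorm_congr_ae (SchwartzMap.coeFn_toLp _ _ _),
      eLpNorm_congr_ae (SchwartzMap.coeFn_toLp _ _ _)] at h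
    rw [nQ, h, nP]
  · intro Φ
    refine ⟨Q (𝓕⁻ (P Φ)), ?_⟩
    have hPQ : ∀ F, P (Q F) = F := fun F => by ext w; rfl
    have hQP : ∀ F, Q (P F) = F := fun F => by ext w; rfl
    simp only [hPQ, FourierTransform.fourier_fourierInv_eq, hQP]

lemma measurePreserving_shear (n : ℕ) :
    MeasurePreserving (fun z : Rn n × Rn n => (z.1 - z.2, z.2)) volume volume :=
  measurePreserving_sub_prod volume volume

lemma measurableEmbedding_shear (n : ℕ) :
    MeasurableEmbedding (fun z : Rn n × Rn n => (z.1 - z.2, z.2)) := by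
  let e : (Rn n × Rn n) ≃ᵐ (Rn n × Rn n) :=
    { toFun := fun z => (z.1 - z.2, z.2)
      invFun := fun z => (z.1 + z.2, z.2)
      left_inv := fun z => by simp
      right_inv := fun z => by simp
      measurable_toFun := (by fun_prop : Measurable fun z : Rn n × Rn n => (z.1 - z.2, z.2))
      measurable_invFun := (by fun_prop : Measurable fun z : Rn n × Rn n => (z.1 + z.2, z.2)) }
  exact e.measurableEmbedding

lemma integrable_integral_shear {n : ℕ} {H : Rn n × Rn n → ℂ} (hH : Integrable H) :
    Integrable (fun ζ : Rn n => ∫ η : Rn n, H (ζ - η, η)) :=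
  ((measurePreserving_shear n).integrable_comp_of_integrable hH).integral_prod_left

/-- Integrating along `ξ + η = ζ` turns the double integral into an inverse Fourier transform. -/
lemma integral_integral_exp_eq_fourierInv {n : ℕ} {H : Rn n × Rn n → ℂ} (hH : Integrable H)
    (x : Rn n) :
    ∫ ξ : Rn n, ∫ η : Rn n,
      H (ξ, η) * Complex.exp (2 * (π : ℂ) * Complex.I * ((⟪x, ξ + η⟫ : ℝ) : ℂ)) =
    𝓕⁻ (fun ζ : Rn n => ∫ η : Rn n, H (ζ - η, η)) x := by
  let K : Rn n × Rn n → ℂ := fun z =>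
    H z * Complex.exp (2 * (π : ℂ) * Complex.I * ((⟪x, z.1 + z.2⟫ : ℝ) : ℂ))
  have hK : Integrable K := by
    refine hH.mul_bdd (c := 1) (Continuous.aestronglyMeasurable (by fun_prop)) ?_
    refine Filter.Eventually.of_forall fun z => ?_
    have : 2 * (π : ℂ) * Complex.I * ((⟪x, z.1 + z.2⟫ : ℝ) : ℂ) =
        ((2 * π * ⟪x, z.1 + z.2⟫ : ℝ) : ℂ) * Complex.I := by
      push_cast
      ring
    rw [this, Complex.norm_exp_ofReal_mul_I]
  have hKs := (measurePreserving_shear n).integrable_comp_of_integrable hK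
  calc _ = ∫ z, K z := (integral_prod K hK).symm
    _ = ∫ z : Rn n × Rn n, K (z.1 - z.2, z.2) :=
      ((measurePreserving_shear n).integral_comp (measurableEmbedding_shear n) K).symm
    _ = ∫ ζ : Rn n, ∫ η : Rn n, K (ζ - η, η) := integral_prod _ hKs
    _ = _ := by
      rw [Real.fourierInv_eq']
      refine integral_congr_ae (Filter.Eventually.of_forall fun ζ => ?_)
      simp only [smul_eq_mul]
      rw [← integral_const_mul]
      refine integral_congr_ae (Filter.Eventually.of_forall fun η => ?_)
      simp only [K, sub_add_cancel, real_inner_comm x ζ]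
      rw [mul_comm]
      congr 2
      push_cast
      ring

lemma lintegral_shear {n : ℕ} {f : Rn n × Rn n → ℝ≥0∞} (hf : Measurable f) :
    ∫⁻ z, f z = ∫⁻ ζ : Rn n, ∫⁻ η : Rn n, f (ζ - η, η) := by
  rw [← (measurePreserving_shear n).lintegral_comp hf]
  exact lintegral_prod _ (hf.comp (by fun_prop)).aemeasurable

lemma lintegral_mul_rpow_two_le {α : Type*} [MeasurableSpace α] (μ : Measure α)
    {f g : α → ℝ≥0∞} (hf : Measurable f) (hg : Measurable g) :
    (∫⁻ x, f x * g x ∂μ) ^ (2 : ℝ) ≤ (∫⁻ x, f x ^ (2 : ℝ) ∂μ) * ∫⁻ x, g x ^ (2 : ℝ) ∂μ := by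
  have h := ENNReal.lintegral_mul_le_Lp_mul_Lq μ Real.HolderConjugate.two_two
    hf.aemeasurable hg.aemeasurable
  calc _ ≤ _ := ENNReal.rpow_le_rpow h (by norm_num)
    _ = _ := by
      rw [ENNReal.mul_rpow_of_nonneg _ _ (by norm_num), ← ENNReal.rpow_mul, ← ENNReal.rpow_mul]
      norm_num

lemma Aconst_rpow_two {n : ℕ} (a : Rn n → Rn n → ℂ) :
    Aconst a ^ (2 : ℝ) = ⨆ ζ : Rn n, ∫⁻ η : Rn n, ‖a (ζ - η) η‖ₑ ^ (2 : ℝ) := by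
  rw [Aconst, ← ENNReal.rpow_mul]
  norm_num
  rfl

lemma lintegral_le_Aconst {n : ℕ} (a : Rn n → Rn n → ℂ) (ζ : Rn n) :
    ∫⁻ η : Rn n, ‖a (ζ - η) η‖ₑ ^ (2 : ℝ) ≤ Aconst a ^ (2 : ℝ) := by
  rw [Aconst_rpow_two]
  exact le_iSup (fun ζ : Rn n => ∫⁻ η : Rn n, ‖a (ζ - η) η‖ₑ ^ (2 : ℝ)) ζ

/-- Schwartz functions decay like a product of integrable weights in `ξ + η` and `η`. -/
lemma schwartz_shear_decay {n : ℕ} (Φ : 𝓢(Rn n × Rn n, ℂ)) :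
    ∃ C : ℝ, ∀ ζ η : Rn n, ‖Φ (ζ - η, η)‖ ≤
      C * (1 + ‖ζ‖) ^ (-(n + 1 : ℝ)) * (1 + ‖η‖) ^ (-(n + 1 : ℝ)) := by
  let D := 2 ^ (2 * (n + 1)) * (Finset.Iic (2 * (n + 1), 0)).sup
    (fun m : ℕ × ℕ => SchwartzMap.seminorm ℂ m.1 m.2) Φ
  refine ⟨2 ^ (n + 1) * D, fun ζ η => ?_⟩
  have h := SchwartzMap.one_add_le_sup_seminorm_apply (𝕜 := ℂ) (m := (2 * (n + 1), 0))
    le_rfl le_rfl Φ (ζ - η, η)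
  rw [norm_iteratedFDeriv_zero] at h
  change (1 + ‖(ζ - η, η)‖) ^ (2 * (n + 1)) * ‖Φ (ζ - η, η)‖ ≤ D at h
  set N := ‖(ζ - η, η)‖
  have h1 : ‖ζ - η‖ ≤ N := norm_fst_le (ζ - η, η)
  have h2 : ‖η‖ ≤ N := norm_snd_le (ζ - η, η)
  have h3 : ‖ζ‖ ≤ ‖ζ - η‖ + ‖η‖ := by simpa using norm_add_le (ζ - η) η
  have hr : ∀ y : Rn n, (1 + ‖y‖) ^ (-(n + 1 : ℝ)) = ((1 + ‖y‖) ^ (n + 1))⁻¹ := fun y => by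
    rw [Real.rpow_neg (by positivity), ← Real.rpow_natCast]
    norm_num
  rw [hr, hr, mul_assoc, ← mul_inv, ← div_eq_mul_inv, le_div_iff₀ (by positivity)]
  have h4 : (1 + ‖ζ‖) ^ (n + 1) * (1 + ‖η‖) ^ (n + 1) ≤
      2 ^ (n + 1) * (1 + N) ^ (2 * (n + 1)) := by
    calc _ ≤ (2 * (1 + N)) ^ (n + 1) * (1 + N) ^ (n + 1) := by
          gcongr
          linarith
      _ = _ := by rw [mul_pow, mul_assoc, ← pow_add, ← two_mul]
  calc _ ≤ ‖Φ (ζ - η, η)‖ * (2 ^ (n + 1) * (1 + N) ^ (2 * (n + 1))) := by gcongr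
    _ = 2 ^ (n + 1) * ((1 + N) ^ (2 * (n + 1)) * ‖Φ (ζ - η, η)‖) := by ring
    _ ≤ _ := by gcongr

lemma mul_le_rpow_two_add {t w : ℝ≥0∞} (hw : w ≤ 1) : t * w ≤ t ^ (2 : ℝ) + w := by
  rcases le_total t 1 with ht | ht
  · calc t * w ≤ 1 * w := by gcongr
      _ ≤ _ := by rw [one_mul]; exact le_add_self
  · calc t * w ≤ t * t := by gcongr; exact hw.trans ht
      _ = t ^ (2 : ℝ) := by rw [ENNReal.rpow_two, sq]
      _ ≤ _ := le_self_add

lemma integrable_mul_schwartz {n : ℕ} {a : Rn n → Rn n → ℂ}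
    (ha : Continuous (fun p : Rn n × Rn n => a p.1 p.2)) (hA : Aconst a ≠ ⊤)
    (Φ : 𝓢(Rn n × Rn n, ℂ)) :
    Integrable (fun z : Rn n × Rn n => a z.1 z.2 * Φ z) := by
  have hc : Continuous (fun z : Rn n × Rn n => a z.1 z.2 * Φ z) := ha.mul Φ.continuous
  refine ⟨hc.aestronglyMeasurable, ?_⟩
  rw [HasFiniteIntegral, lintegral_shear hc.enorm.measurable]
  obtain ⟨C, hC⟩ := schwartz_shear_decay Φ
  let W : Rn n → ℝ≥0∞ := fun y => ENNReal.ofReal ((1 + ‖y‖) ^ (-(n + 1 : ℝ)))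
  have hWm : Measurable W := by fun_prop
  have hW1 : ∀ y, W y ≤ 1 := fun y => by
    rw [← ENNReal.ofReal_one]
    refine ENNReal.ofReal_le_ofReal (Real.rpow_le_one_of_one_le_of_nonpos ?_ ?_)
    · linarith [norm_nonneg y]
    · linarith [(Nat.cast_nonneg n : (0 : ℝ) ≤ n)]
  have hWi : ∫⁻ y, W y < ⊤ := by
    have := integrable_one_add_norm (E := Rn n) (μ := volume) (r := n + 1) (by simp)
    exact (hasFiniteIntegral_iff_ofReal
      (Filter.Eventually.of_forall fun y => by positivity)).1 this.2
  have hΦ : ∀ ζ η : Rn n, ‖Φ (ζ - η, η)‖ₑ ≤ ENNReal.ofReal C * W ζ * W η := fun ζ η => by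
    rw [← ofReal_norm, ← ENNReal.ofReal_mul' (by positivity),
      ← ENNReal.ofReal_mul' (by positivity)]
    exact ENNReal.ofReal_le_ofReal (hC ζ η)
  calc ∫⁻ ζ : Rn n, ∫⁻ η : Rn n, ‖a (ζ - η) η * Φ (ζ - η, η)‖ₑ
      ≤ ∫⁻ ζ : Rn n, ENNReal.ofReal C * W ζ * (Aconst a ^ (2 : ℝ) + ∫⁻ y, W y) := by
        refine lintegral_mono fun ζ => ?_
        calc ∫⁻ η : Rn n, ‖a (ζ - η) η * Φ (ζ - η, η)‖ₑ
            ≤ ∫⁻ η : Rn n, ENNReal.ofReal C * W ζ * (‖a (ζ - η) η‖ₑ ^ (2 : ℝ) + W η) := by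
              refine lintegral_mono fun η => ?_
              rw [enorm_mul]
              calc _ ≤ ‖a (ζ - η) η‖ₑ * (ENNReal.ofReal C * W ζ * W η) := by gcongr; exact hΦ ζ η
                _ = ENNReal.ofReal C * W ζ * (‖a (ζ - η) η‖ₑ * W η) := by ring
                _ ≤ _ := by gcongr; exact mul_le_rpow_two_add (hW1 η)
          _ = ENNReal.ofReal C * W ζ *
              ((∫⁻ η : Rn n, ‖a (ζ - η) η‖ₑ ^ (2 : ℝ)) + ∫⁻ y, W y) := by
              rw [lintegral_const_mul' _ _ (by finiteness), lintegral_add_right _ hWm]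
          _ ≤ _ := by gcongr; exact lintegral_le_Aconst a ζ
    _ = ENNReal.ofReal C * (∫⁻ y, W y) * (Aconst a ^ (2 : ℝ) + ∫⁻ y, W y) := by
        have hA2 : Aconst a ^ (2 : ℝ) ≠ ⊤ := by finiteness
        rw [lintegral_mul_const' _ _ (ENNReal.add_ne_top.2 ⟨hA2, hWi.ne⟩),
          lintegral_const_mul' _ _ (by finiteness)]
    _ < ⊤ := by
        have hA2 : Aconst a ^ (2 : ℝ) ≠ ⊤ := by finiteness
        exact ENNReal.mul_lt_top (ENNReal.mul_lt_top (by finiteness) hWi)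
          (ENNReal.add_lt_top.2 ⟨hA2.lt_top, hWi⟩)

lemma eLpNorm_integral_shear_le {n : ℕ} {a : Rn n → Rn n → ℂ}
    (ha : Continuous (fun p : Rn n × Rn n => a p.1 p.2)) {Φ : Rn n × Rn n → ℂ}
    (hΦ : Continuous Φ) :
    eLpNorm (fun ζ : Rn n => ∫ η : Rn n, a (ζ - η) η * Φ (ζ - η, η)) 2 volume ≤
      Aconst a * eLpNorm Φ 2 volume := by
  have hΦm := hΦ.measurable
  rw [← ENNReal.rpow_le_rpow_iff (z := 2) (by norm_num),
    ENNReal.mul_rpow_of_nonneg _ _ (by norm_num), eLpNorm_two_rpow, eLpNorm_two_rpow,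
    lintegral_shear (by fun_prop)]
  have hm : ∀ ζ : Rn n, Measurable fun η : Rn n => ‖a (ζ - η) η‖ₑ := fun ζ =>
    (ha.comp (by fun_prop : Continuous fun η : Rn n => (ζ - η, η))).enorm.measurable
  calc _ ≤ ∫⁻ ζ : Rn n, Aconst a ^ (2 : ℝ) * ∫⁻ η : Rn n, ‖Φ (ζ - η, η)‖ₑ ^ (2 : ℝ) := by
        refine lintegral_mono fun ζ => ?_
        calc _ ≤ (∫⁻ η : Rn n, ‖a (ζ - η) η‖ₑ * ‖Φ (ζ - η, η)‖ₑ) ^ (2 : ℝ) := by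
              refine ENNReal.rpow_le_rpow ?_ (by norm_num)
              simpa only [enorm_mul] using enorm_integral_le_lintegral_enorm
                (fun η : Rn n => a (ζ - η) η * Φ (ζ - η, η))
          _ ≤ _ := lintegral_mul_rpow_two_le _ (hm ζ) (by fun_prop)
          _ ≤ _ := by gcongr; exact lintegral_le_Aconst a ζ
    _ = _ := lintegral_const_mul _ (Measurable.lintegral_prod_right' (f := fun z : Rn n × Rn n =>
        ‖Φ (z.1 - z.2, z.2)‖ₑ ^ (2 : ℝ)) (by fun_prop))
instance isAddHaarMeasure_volume_prod (n : ℕ) :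
    (volume : Measure (Rn n × Rn n)).IsAddHaarMeasure :=
  inferInstanceAs (((volume : Measure (Rn n)).prod (volume : Measure (Rn n))).IsAddHaarMeasure)

lemma eLpNorm_Sop_eq {n : ℕ} {a : Rn n → Rn n → ℂ} {F Φ : Rn n × Rn n → ℂ}
    (hΦ : ∀ ξ η, Φ (ξ, η) = fourierT2 F ξ η)
    (hH : Integrable (fun z : Rn n × Rn n => a z.1 z.2 * Φ z))
    (hG : eLpNorm (fun ζ : Rn n => ∫ η : Rn n, a (ζ - η) η * Φ (ζ - η, η)) 2 volume ≠ ⊤) :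
    eLpNorm (fun x => Sop a F x) 2 volume =
      eLpNorm (fun ζ : Rn n => ∫ η : Rn n, a (ζ - η) η * Φ (ζ - η, η)) 2 volume := by
  have hGi := integrable_integral_shear hH
  rw [← eLpNorm_fourierInv_eq hGi ⟨hGi.1, lt_top_iff_ne_top.2 hG⟩]
  congr 1
  ext x
  rw [← integral_integral_exp_eq_fourierInv hH]
  simp only [Sop, hΦ]

/-- A bound for `S` controls the smoothly truncated integrals of `|a|²` on each line
`ξ + η = ζ₀`. -/
lemma integral_cutoff_le_of_bound {n : ℕ} {a : Rn n → Rn n → ℂ}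
    (ha : ContDiff ℝ (⊤ : ℕ∞) (fun p : Rn n × Rn n => a p.1 p.2)) {c : ℝ≥0}
    (hc : ∀ F : 𝓢(Rn n × Rn n, ℂ),
      eLpNorm (fun x => Sop a F x) 2 volume ≤ c * eLpNorm F 2 volume)
    {χ : Rn n → ℝ} (hχ : ContDiff ℝ (⊤ : ℕ∞) χ) (hχc : HasCompactSupport χ)
    (hχ0 : ∀ η, 0 ≤ χ η) (hχ1 : ∀ η, χ η ≤ 1) (ζ₀ : Rn n) :
    ∫ η : Rn n, ‖a (ζ₀ - η) η‖ ^ 2 * χ η ≤ (c : ℝ) ^ 2 := by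
  have hac : Continuous (fun p : Rn n × Rn n => a p.1 p.2) := ha.continuous
  have hχm := hχ.continuous
  have has : Continuous (fun p : Rn n × Rn n => a (p.1 - p.2) p.2) :=
    hac.comp (by fun_prop : Continuous fun p : Rn n × Rn n => (p.1 - p.2, p.2))
  let m : Rn n → ℝ := fun ζ => ∫ η : Rn n, ‖a (ζ - η) η‖ ^ 2 * χ η
  have hm : Continuous m := by
    rw [← continuousOn_univ]
    refine continuousOn_integral_of_compact_support hχc.isCompact (Continuous.continuousOn ?_) ?_
    · exact (has.norm.pow 2).mul (hχm.comp continuous_snd)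
    · intro ζ η _ hη
      rw [image_eq_zero_of_notMem_tsupport hη, mul_zero]
  have hm0 : ∀ ζ, 0 ≤ m ζ := fun ζ => integral_nonneg fun η => mul_nonneg (by positivity) (hχ0 η)
  by_contra! hlt
  change (c : ℝ) ^ 2 < m ζ₀ at hlt
  obtain ⟨ε, hε, hball⟩ := Metric.mem_nhds_iff.1 ((isOpen_lt continuous_const hm).mem_nhds hlt)
  let ψ : ContDiffBump ζ₀ := ⟨ε / 2, ε, by positivity, by linarith⟩
  have hψ : ContDiff ℝ (⊤ : ℕ∞) ψ := ψ.contDiff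
  have hψm := hψ.continuous
  have hψc : HasCompactSupport ψ := ψ.hasCompactSupport
  -- the test function on the Fourier side
  let Φ₀ : Rn n × Rn n → ℂ := fun z =>
    (starRingEnd ℂ) (a z.1 z.2) * ((ψ (z.1 + z.2) * χ z.2 : ℝ) : ℂ)
  have hΦs : ContDiff ℝ (⊤ : ℕ∞) Φ₀ := by
    refine ContDiff.mul (Complex.conjCLE.contDiff.comp ha) (Complex.ofRealCLM.contDiff.comp ?_)
    exact (hψ.comp (contDiff_fst.add contDiff_snd)).mul (hχ.comp contDiff_snd)
  have hcpt : IsCompact ((fun z : Rn n × Rn n => (z.1 - z.2, z.2)) '' (tsupport ψ ×ˢ tsupport χ)) :=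
    (hψc.isCompact.prod hχc.isCompact).image (by fun_prop)
  have hΦc : HasCompactSupport Φ₀ := by
    refine HasCompactSupport.intro hcpt fun z hz => ?_
    have : ψ (z.1 + z.2) * χ z.2 = 0 := by
      by_contra h
      exact hz ⟨(z.1 + z.2, z.2), ⟨subset_tsupport _ (left_ne_zero_of_mul h),
        subset_tsupport _ (right_ne_zero_of_mul h)⟩, by simp⟩
    simp only [Φ₀, this, Complex.ofReal_zero, mul_zero]
  have hH : Integrable (fun z : Rn n × Rn n => a z.1 z.2 * Φ₀ z) :=
    (hac.mul hΦs.continuous).integrable_of_hasCompactSupport hΦc.mul_left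
  have hG : (fun ζ : Rn n => ∫ η : Rn n, a (ζ - η) η * Φ₀ (ζ - η, η)) =
      fun ζ => ((ψ ζ * m ζ : ℝ) : ℂ) := by
    ext ζ
    simp only [m]
    rw [← integral_const_mul, ← integral_complex_ofReal]
    refine integral_congr_ae (Filter.Eventually.of_forall fun η => ?_)
    simp only [Φ₀, sub_add_cancel]
    rw [← mul_assoc, Complex.mul_conj, Complex.normSq_eq_norm_sq]
    push_cast
    ring
  have hGm : Continuous fun ζ => ψ ζ * m ζ := hψm.mul hm
  -- squared norms on both sides
  have hint1 : Integrable fun ζ => (ψ ζ * m ζ) ^ 2 :=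
    (hGm.pow 2).integrable_of_hasCompactSupport <| HasCompactSupport.intro hψc.isCompact
      fun ζ hζ => by simp [image_eq_zero_of_notMem_tsupport hζ]
  have hint2 : Integrable fun ζ => ψ ζ ^ 2 * m ζ := by
    refine ((hψm.pow 2).mul hm).integrable_of_hasCompactSupport ?_
    exact HasCompactSupport.intro hψc.isCompact
      fun ζ hζ => by simp [image_eq_zero_of_notMem_tsupport hζ]
  have hnorm1 : eLpNorm (fun ζ => ((ψ ζ * m ζ : ℝ) : ℂ)) 2 volume ^ (2 : ℝ) =
      ENNReal.ofReal (∫ ζ, (ψ ζ * m ζ) ^ 2) := by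
    rw [eLpNorm_two_rpow, ofReal_integral_eq_lintegral_ofReal hint1
      (Filter.Eventually.of_forall fun ζ => sq_nonneg _)]
    refine lintegral_congr fun ζ => ?_
    rw [← ofReal_norm, ENNReal.rpow_two, ← ENNReal.ofReal_pow (norm_nonneg _),
      Complex.norm_real, Real.norm_eq_abs, sq_abs]
  have hnorm2 : eLpNorm Φ₀ 2 volume ^ (2 : ℝ) ≤ ENNReal.ofReal (∫ ζ, ψ ζ ^ 2 * m ζ) := by
    rw [eLpNorm_two_rpow, lintegral_shear (hΦs.continuous.enorm.measurable.pow_const _),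
      ofReal_integral_eq_lintegral_ofReal hint2
      (Filter.Eventually.of_forall fun ζ => mul_nonneg (sq_nonneg _) (hm0 ζ))]
    refine lintegral_mono fun ζ => ?_
    have hi : Integrable fun η : Rn n => ψ ζ ^ 2 * (‖a (ζ - η) η‖ ^ 2 * χ η) := by
      refine Integrable.const_mul (Continuous.integrable_of_hasCompactSupport ?_ hχc.mul_left) _
      exact ((has.comp (by fun_prop : Continuous fun η : Rn n => (ζ, η))).norm.pow 2).mul hχm
    simp only [m]
    rw [← integral_const_mul, ofReal_integral_eq_lintegral_ofReal hi
      (Filter.Eventually.of_forall fun η =>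
        mul_nonneg (sq_nonneg _) (mul_nonneg (sq_nonneg _) (hχ0 η)))]
    refine lintegral_mono fun η => ?_
    rw [← ofReal_norm, ENNReal.rpow_two, ← ENNReal.ofReal_pow (norm_nonneg _)]
    refine ENNReal.ofReal_le_ofReal ?_
    simp only [Φ₀, sub_add_cancel]
    rw [norm_mul, Complex.norm_real, RCLike.norm_conj, Real.norm_eq_abs, mul_pow, sq_abs, mul_pow]
    have : χ η ^ 2 ≤ χ η := by nlinarith [hχ0 η, hχ1 η]
    calc _ ≤ ‖a (ζ - η) η‖ ^ 2 * (ψ ζ ^ 2 * χ η) := by gcongr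
      _ = _ := by ring
  obtain ⟨T, hT, hTn, hTs⟩ := fourierT2_schwartz n
  obtain ⟨F, hF⟩ := hTs (hΦc.toSchwartzMap hΦs)
  have hΦF : ∀ ξ η, Φ₀ (ξ, η) = fourierT2 F ξ η := fun ξ η => by rw [← hT, hF]; rfl
  have hFn : eLpNorm F 2 volume = eLpNorm Φ₀ 2 volume := by rw [← hTn, hF]; rfl
  have hfin : eLpNorm (fun ζ => ((ψ ζ * m ζ : ℝ) : ℂ)) 2 volume ≠ ⊤ := fun h => by
    rw [h] at hnorm1
    simp at hnorm1
  have hkey := hc F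
  rw [eLpNorm_Sop_eq hΦF hH (by rwa [hG]), hG, hFn] at hkey
  have hkey2 : ∫ ζ, (ψ ζ * m ζ) ^ 2 ≤ (c : ℝ) ^ 2 * ∫ ζ, ψ ζ ^ 2 * m ζ := by
    have h := ENNReal.rpow_le_rpow hkey (z := 2) (by norm_num)
    rw [ENNReal.mul_rpow_of_nonneg _ _ (by norm_num), hnorm1] at h
    have h' := h.trans (mul_le_mul_right hnorm2 _)
    rw [ENNReal.rpow_two, ← ENNReal.ofReal_coe_nnreal, ← ENNReal.ofReal_pow c.coe_nonneg,
      ← ENNReal.ofReal_mul (by positivity)] at h'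
    refine (ENNReal.ofReal_le_ofReal_iff (mul_nonneg (by positivity) ?_)).1 h'
    exact integral_nonneg fun ζ => mul_nonneg (sq_nonneg _) (hm0 ζ)
  have hpos : 0 < ∫ ζ, ((ψ ζ * m ζ) ^ 2 - (c : ℝ) ^ 2 * (ψ ζ ^ 2 * m ζ)) := by
    refine Continuous.integral_pos_of_hasCompactSupport_nonneg_nonzero (x := ζ₀) (by fun_prop)
      ?_ ?_ ?_
    · refine HasCompactSupport.intro hψc.isCompact fun ζ hζ => ?_
      rw [image_eq_zero_of_notMem_tsupport hζ]
      ring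
    · intro ζ
      have hfac : (ψ ζ * m ζ) ^ 2 - (c : ℝ) ^ 2 * (ψ ζ ^ 2 * m ζ) =
          ψ ζ ^ 2 * (m ζ * (m ζ - (c : ℝ) ^ 2)) := by ring
      change 0 ≤ (ψ ζ * m ζ) ^ 2 - (c : ℝ) ^ 2 * (ψ ζ ^ 2 * m ζ)
      rw [hfac]
      by_cases hz : ψ ζ = 0
      · simp [hz]
      · have hmem : ζ ∈ Metric.ball ζ₀ ε := by
          have hz' : ζ ∈ Function.support ψ := hz
          rwa [ψ.support_eq] at hz'
        have : (c : ℝ) ^ 2 < m ζ := hball hmem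
        exact mul_nonneg (sq_nonneg _) (mul_nonneg (hm0 ζ) (by linarith))
    · have h1 : ψ ζ₀ = 1 := ψ.one_of_mem_closedBall (Metric.mem_closedBall_self ψ.rIn_pos.le)
      have h2 : 0 < m ζ₀ * (m ζ₀ - (c : ℝ) ^ 2) :=
        mul_pos (lt_of_le_of_lt (by positivity) hlt) (by linarith)
      rw [h1]
      nlinarith
  rw [integral_sub hint1 (hint2.const_mul _), integral_const_mul] at hpos
  linarith

lemma Aconst_rpow_two_le_of_bound {n : ℕ} {a : Rn n → Rn n → ℂ}
    (ha : ContDiff ℝ (⊤ : ℕ∞) (fun p : Rn n × Rn n => a p.1 p.2)) {c : ℝ≥0}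
    (hc : ∀ F : 𝓢(Rn n × Rn n, ℂ),
      eLpNorm (fun x => Sop a F x) 2 volume ≤ c * eLpNorm F 2 volume) :
    Aconst a ^ (2 : ℝ) ≤ ENNReal.ofReal ((c : ℝ) ^ 2) := by
  rw [Aconst_rpow_two]
  refine iSup_le fun ζ => ?_
  have hmono : Directed (· ⊆ ·) fun k : ℕ => Metric.closedBall (0 : Rn n) k :=
    Monotone.directed_le fun i j hij => Metric.closedBall_subset_closedBall (by exact_mod_cast hij)
  rw [← setLIntegral_univ, ← Metric.iUnion_closedBall_nat (0 : Rn n),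
    setLIntegral_iUnion_of_directed _ hmono]
  refine iSup_le fun k => ?_
  let χ : ContDiffBump (0 : Rn n) := ⟨k + 1, k + 2, by positivity, by linarith⟩
  have hac : Continuous fun η : Rn n => a (ζ - η) η :=
    ha.continuous.comp (by fun_prop : Continuous fun η : Rn n => (ζ - η, η))
  have hi : Integrable fun η : Rn n => ‖a (ζ - η) η‖ ^ 2 * χ η :=
    Continuous.integrable_of_hasCompactSupport ((hac.norm.pow 2).mul χ.continuous)
      χ.hasCompactSupport.mul_left
  refine le_trans ?_ (ENNReal.ofReal_le_ofReal (integral_cutoff_le_of_bound ha hc χ.contDiff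
    χ.hasCompactSupport (fun η => χ.nonneg) (fun η => χ.le_one) ζ))
  rw [ofReal_integral_eq_lintegral_ofReal hi
    (Filter.Eventually.of_forall fun η => mul_nonneg (sq_nonneg _) χ.nonneg)]
  refine le_trans (setLIntegral_mono' measurableSet_closedBall fun η hη => ?_)
    (setLIntegral_le_lintegral (Metric.closedBall (0 : Rn n) k) _)
  rw [χ.one_of_mem_closedBall (Metric.closedBall_subset_closedBall (by simp [χ]) hη), mul_one,
    ENNReal.ofReal_pow (norm_nonneg _), ofReal_norm, ENNReal.rpow_two]

lemma eLpNorm_Sop_le {n : ℕ} {a : Rn n → Rn n → ℂ}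
    (ha : Continuous (fun p : Rn n × Rn n => a p.1 p.2)) (hA : Aconst a ≠ ⊤)
    (F : 𝓢(Rn n × Rn n, ℂ)) :
    eLpNorm (fun x => Sop a F x) 2 volume ≤ Aconst a * eLpNorm F 2 volume := by
  obtain ⟨T, hT, hTn, -⟩ := fourierT2_schwartz n
  have hle := eLpNorm_integral_shear_le (a := a) (Φ := T F) ha (T F).continuous
  have hM : MemLp (T F) 2 (volume : Measure (Rn n × Rn n)) := (T F).memLp 2 volume
  have hH : Integrable (fun z : Rn n × Rn n => a z.1 z.2 * T F z) :=
    integrable_mul_schwartz ha hA (T F)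
  have hG := ne_top_of_le_ne_top (ENNReal.mul_ne_top hA hM.2.ne) hle
  have heq := eLpNorm_Sop_eq (a := a) (F := F) (Φ := T F) (hT F) hH hG
  rw [heq, ← hTn]
  exact hle

theorem statement15 (n : ℕ) (a : Rn n → Rn n → ℂ)
    (ha : ContDiff ℝ (⊤ : ℕ∞) (fun p : Rn n × Rn n => a p.1 p.2)) :
    ((∃ c : ℝ≥0, ∀ F : SchwartzMap (Rn n × Rn n) ℂ,
        eLpNorm (fun x => Sop a (⇑F) x) 2 volume ≤ c * eLpNorm (⇑F) 2 volume) ↔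
      Aconst a ≠ ⊤) ∧
    (∀ F : SchwartzMap (Rn n × Rn n) ℂ,
      eLpNorm (fun x => Sop a (⇑F) x) 2 volume ≤ Aconst a * eLpNorm (⇑F) 2 volume) := by
  refine ⟨⟨?_, fun hA => ⟨(Aconst a).toNNReal, fun F => ?_⟩⟩, fun F => ?_⟩
  · rintro ⟨c, hc⟩ hA
    have h := Aconst_rpow_two_le_of_bound ha hc
    rw [hA, ENNReal.top_rpow_of_pos (by norm_num)] at h
    exact ENNReal.ofReal_ne_top (top_le_iff.1 h)
  · rw [ENNReal.coe_toNNReal hA]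
    exact eLpNorm_Sop_le ha.continuous hA F
  · by_cases hA : Aconst a = ⊤
    · by_cases hF : eLpNorm F 2 volume = 0
      · have hF0 : (F : Rn n × Rn n → ℂ) = 0 :=
          (F.continuous.ae_eq_iff_eq volume continuous_zero).1
            ((eLpNorm_eq_zero_iff F.continuous.aestronglyMeasurable two_ne_zero).1 hF)
        have hS : (fun x => Sop a F x) = 0 := by
          ext x
          simp [Sop, fourierT2, hF0]
        rw [hS, eLpNorm_zero]
        exact zero_le
      · rw [hA, ENNReal.top_mul hF]
        exact le_top
    · exact eLpNorm_Sop_le ha.continuous hA F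
end
end
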